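/- arXiv:2505.07806 — 7 statements merged into one kernel-verified Lean document; each statement's English description precedes it below -/
import Mathlib

section
/- Let m ≥ 1 be an integer and K a field of characteristic 0 containing nonzero elements q, Φ, z₁, z₂, z₃ and elements 𝔛_{i,j} (1 ≤ i,j ≤ m) with 𝔛_{i,i} = −q² and 𝔛_{i,j}·𝔛_{j,i} = q² for i ≠ j. Then, with the T-matrices and R-matrices defined in the context: (RTT equations) for all X, Y ∈ {L,R} and all 1 ≤ k ≤ m (with k+1 read as 1 when k = m), (id_W ⊗ R^X_Y(z₁,z₂;k+1)) ∘ (T_X(z₁;k) ⊗ id_V) ∘ (id_V ⊗ T_Y(z₂;k)) = (T_Y(z₂;k) ⊗ id_V) ∘ (id_V ⊗ T_X(z₁;k)) ∘ (R^X_Y(z₁,z₂;k) ⊗ id_W) as linear maps V ⊗ V ⊗ W → W ⊗ V ⊗ V; and (RRR equations) for all X, Y, Z ∈ {L,R} and all 1 ≤ k ≤ m, (id_V ⊗ R^X_Y(z₁,z₂;k)) ∘ (R^X_Z(z₁,z₃;k) ⊗ id_V) ∘ (id_V ⊗ R^Y_Z(z₂,z₃;k)) = (R^Y_Z(z₂,z₃;k)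 ⊗ id_V) ∘ (id_V ⊗ R^X_Z(z₁,z₃;k)) ∘ (R^X_Y(z₁,z₂;k) ⊗ id_V) as linear maps V ⊗ V ⊗ V → V ⊗ V ⊗ V. -/
open Matrix

namespace Stmt0

/-- Row types: left-moving (`L`) and right-moving (`R`). -/
inductive RowType | L | R

/-- The condition `C(i,j,k)`: `i < j < k` or `j < k ≤ i` or `k ≤ i < j`. -/
def Ccond (i j k : ℕ) : Prop :=
  (i < j ∧ j < k) ∨ (j < k ∧ k ≤ i) ∨ (k ≤ i ∧ i < j)

instance (i j k : ℕ) : Decidable (Ccond i j k) := by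
  unfold Ccond; infer_instance

/-- `res_m(x) ∈ {0,…,m−1}`, the representative of `x` modulo `m`. -/
def resLo (m : ℕ) (x : ℤ) : ℤ := x % m

/-- `res^m(x) ∈ {1,…,m}`, the representative of `x` modulo `m`. -/
def resHi (m : ℕ) (x : ℤ) : ℤ := (x - 1) % m + 1

variable {K : Type*} [Field K]

/-- T-vertex weights `wt_X(a,b,c,d)` for `X ∈ {L,R}`, row parameter `z` and column color
`c_k`; `a, c` are the left and right horizontal spins, `b, d` the top and bottom vertical
spins. -/
def wtT (m : ℕ) (q Φ : K) (X : ℕ → ℕ → K) (ty : RowType) (z : K) (k : ℕ)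
    (a : Fin (m + 1)) (b : Fin 2) (c : Fin (m + 1)) (d : Fin 2) : K :=
  match ty with
  | .R =>
      if a = 0 ∧ b = 0 ∧ c = 0 ∧ d = 0 then 1
      else if a ≠ 0 ∧ c = a ∧ b = 1 ∧ d = 1 then
        Φ * X (a : ℕ) k * (if (a : ℕ) = k then z else 1)
      else if a = 0 ∧ c = 0 ∧ b = 1 ∧ d = 1 then Φ
      else if a ≠ 0 ∧ c = a ∧ b = 0 ∧ d = 0 then (if (a : ℕ) = k then z else 1)
      else if (a : ℕ) = k ∧ b = 0 ∧ c = 0 ∧ d = 1 then Φ * (1 - q ^ 2) * z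
      else if a = 0 ∧ b = 1 ∧ (c : ℕ) = k ∧ d = 0 then 1
      else 0
  | .L =>
      if a = 0 ∧ b = 0 ∧ c = 0 ∧ d = 0 then 1
      else if a ≠ 0 ∧ c = a ∧ b = 1 ∧ d = 1 then
        Φ * X k (a : ℕ) * (if (a : ℕ) = k then z⁻¹ else 1)
      else if a = 0 ∧ c = 0 ∧ b = 1 ∧ d = 1 then Φ
      else if a ≠ 0 ∧ c = a ∧ b = 0 ∧ d = 0 then (if (a : ℕ) = k then z⁻¹ else 1)
      else if a = 0 ∧ b = 0 ∧ (c : ℕ) = k ∧ d = 1 then Φ * (1 - q ^ 2)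
      else if (a : ℕ) = k ∧ b = 1 ∧ c = 0 ∧ d = 0 then z⁻¹
      else 0

/-- R-vertex weights `W^X_Y(nw, sw; ne, se)` for `X, Y ∈ {L,R}`, parameters `(z, z′)` and
vertex color `c_k`. -/
def wtR (m : ℕ) (q Φ : K) (X : ℕ → ℕ → K) (tx ty : RowType) (z z' : K) (k : ℕ)
    (nw sw ne se : Fin (m + 1)) : K :=
  match tx, ty with
  | .L, .L =>
      if nw = 0 ∧ sw = 0 ∧ ne = 0 ∧ se = 0 then z - q ^ 2 * z'
      else if nw = 0 ∧ sw ≠ 0 ∧ ne = sw ∧ se = 0 then q ^ 2 * Φ * (z - z')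
      else if nw ≠ 0 ∧ sw = 0 ∧ ne = 0 ∧ se = nw then (z - z') / Φ
      else if nw ≠ 0 ∧ sw = nw ∧ ne = nw ∧ se = nw then z' - q ^ 2 * z
      else if nw ≠ 0 ∧ sw ≠ 0 ∧ sw ≠ nw ∧ ne = sw ∧ se = nw then
        X (sw : ℕ) (nw : ℕ) * (z - z')
      else if nw ≠ 0 ∧ sw = 0 ∧ ne = nw ∧ se = 0 then (1 - q ^ 2) * z
      else if nw = 0 ∧ sw ≠ 0 ∧ ne = 0 ∧ se = sw then (1 - q ^ 2) * z'
      else if nw ≠ 0 ∧ sw ≠ 0 ∧ sw ≠ nw ∧ ne = nw ∧ se = sw then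
        (if Ccond (sw : ℕ) (nw : ℕ) k then (1 - q ^ 2) * z'
         else if Ccond (nw : ℕ) (sw : ℕ) k then (1 - q ^ 2) * z else 0)
      else 0
  | .R, .R =>
      if nw = 0 ∧ sw = 0 ∧ ne = 0 ∧ se = 0 then z - q ^ 2 * z'
      else if nw = 0 ∧ sw ≠ 0 ∧ ne = sw ∧ se = 0 then (z - z') / Φ
      else if nw ≠ 0 ∧ sw = 0 ∧ ne = 0 ∧ se = nw then q ^ 2 * Φ * (z - z')
      else if nw ≠ 0 ∧ sw = nw ∧ ne = nw ∧ se = nw then z' - q ^ 2 * z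
      else if nw ≠ 0 ∧ sw ≠ 0 ∧ sw ≠ nw ∧ ne = sw ∧ se = nw then
        X (sw : ℕ) (nw : ℕ) * (z - z')
      else if nw ≠ 0 ∧ sw = 0 ∧ ne = nw ∧ se = 0 then (1 - q ^ 2) * z'
      else if nw = 0 ∧ sw ≠ 0 ∧ ne = 0 ∧ se = sw then (1 - q ^ 2) * z
      else if nw ≠ 0 ∧ sw ≠ 0 ∧ sw ≠ nw ∧ ne = nw ∧ se = sw then
        (if Ccond (sw : ℕ) (nw : ℕ) k then (1 - q ^ 2) * z
         else if Ccond (nw : ℕ) (sw : ℕ) k then (1 - q ^ 2) * z' else 0)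
      else 0
  | .L, .R =>
      if nw = 0 ∧ sw = 0 ∧ ne = 0 ∧ se = 0 then z - z'
      else if nw = 0 ∧ sw ≠ 0 ∧ ne = sw ∧ se = 0 then Φ * (z - q ^ 2 * z')
      else if nw ≠ 0 ∧ sw = 0 ∧ ne = 0 ∧ se = nw then Φ * (z - q ^ 2 * z')
      else if nw ≠ 0 ∧ sw = nw ∧ ne = nw ∧ se = nw then Φ ^ 2 * (q ^ 4 * z' - z)
      else if nw ≠ 0 ∧ sw ≠ 0 ∧ sw ≠ nw ∧ ne = sw ∧ se = nw then
        Φ ^ 2 * X (nw : ℕ) (sw : ℕ) * (z - q ^ 2 * z')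
      else if nw = 0 ∧ sw = 0 ∧ ne ≠ 0 ∧ se = ne then Φ * (1 - q ^ 2) * z
      else if nw ≠ 0 ∧ sw = nw ∧ ne = 0 ∧ se = 0 then Φ * (1 - q ^ 2) * z'
      else if nw ≠ 0 ∧ sw = nw ∧ ne ≠ 0 ∧ ne ≠ nw ∧ se = ne then
        (if Ccond (nw : ℕ) (ne : ℕ) k then -(Φ ^ 2) * (1 - q ^ 2) * q ^ 2 * z'
         else if Ccond (ne : ℕ) (nw : ℕ) k then -(Φ ^ 2) * (1 - q ^ 2) * z else 0)
      else 0
  | .R, .L =>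
      if nw = 0 ∧ sw = 0 ∧ ne = 0 ∧ se = 0 then z' - q ^ (2 * m + 2) * z
      else if nw = 0 ∧ sw ≠ 0 ∧ ne = sw ∧ se = 0 then (z' - q ^ (2 * m) * z) / Φ
      else if nw ≠ 0 ∧ sw = 0 ∧ ne = 0 ∧ se = nw then (z' - q ^ (2 * m) * z) / Φ
      else if nw ≠ 0 ∧ sw = nw ∧ ne = nw ∧ se = nw then (q ^ (2 * m - 2) * z - z') / Φ ^ 2
      else if nw ≠ 0 ∧ sw ≠ 0 ∧ sw ≠ nw ∧ ne = sw ∧ se = nw then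
        X (nw : ℕ) (sw : ℕ) * (z' - q ^ (2 * m) * z) / (q ^ 2 * Φ ^ 2)
      else if nw = 0 ∧ sw = 0 ∧ ne ≠ 0 ∧ se = ne then
        q ^ (2 * resHi m ((k : ℤ) - ((ne : ℕ) : ℤ)) - 2) * (1 - q ^ 2) * z' / Φ
      else if nw ≠ 0 ∧ sw = nw ∧ ne = 0 ∧ se = 0 then
        q ^ (2 * resLo m (((nw : ℕ) : ℤ) - (k : ℤ))) * (1 - q ^ 2) * z / Φ
      else if nw ≠ 0 ∧ sw = nw ∧ ne ≠ 0 ∧ ne ≠ nw ∧ se = ne then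
        (if Ccond (nw : ℕ) (ne : ℕ) k then
            q ^ (2 * resLo m (((nw : ℕ) : ℤ) - ((ne : ℕ) : ℤ)) - 2) * (1 - q ^ 2) * z / Φ ^ 2
         else if Ccond (ne : ℕ) (nw : ℕ) k then
            q ^ (2 * resLo m (((nw : ℕ) : ℤ) - ((ne : ℕ) : ℤ)) - 2) * (1 - q ^ 2) * z' / Φ ^ 2
         else 0)
      else 0

/-- `T_X(z;k) : V ⊗ W → W ⊗ V`, `T_X(v_a ⊗ w_b) = Σ wt_X(a,b,c,d) · w_d ⊗ v_c`, as a matrix. -/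
def Tmat (m : ℕ) (q Φ : K) (X : ℕ → ℕ → K) (ty : RowType) (z : K) (k : ℕ) :
    Matrix (Fin 2 × Fin (m + 1)) (Fin (m + 1) × Fin 2) K :=
  fun o i => wtT m q Φ X ty z k i.1 i.2 o.2 o.1

/-- `R^X_Y(z,z′;k) : V ⊗ V → V ⊗ V`, `R(v_a ⊗ v_b) = Σ W^X_Y(b,a;c,d) · v_d ⊗ v_c`,
as a matrix. -/
def Rmat (m : ℕ) (q Φ : K) (X : ℕ → ℕ → K) (tx ty : RowType) (z z' : K) (k : ℕ) :
    Matrix (Fin (m + 1) × Fin (m + 1)) (Fin (m + 1) × Fin (m + 1)) K :=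
  fun o i => wtR m q Φ X tx ty z z' k i.2 i.1 o.2 o.1

/-- `M ⊗ id_γ` on a right-nested triple of index types, as a matrix. -/
def tenFst {α₁ α₂ β₁ β₂ γ : Type*} [DecidableEq γ]
    (M : Matrix (α₂ × β₂) (α₁ × β₁) K) :
    Matrix (α₂ × β₂ × γ) (α₁ × β₁ × γ) K :=
  fun o i => if o.2.2 = i.2.2 then M (o.1, o.2.1) (i.1, i.2.1) else 0

/-- `id_α ⊗ M` on a right-nested triple of index types, as a matrix. -/
def tenSnd {α β₁ β₂ γ₁ γ₂ : Type*} [DecidableEq α]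
    (M : Matrix (β₂ × γ₂) (β₁ × γ₁) K) :
    Matrix (α × β₂ × γ₂) (α × β₁ × γ₁) K :=
  fun o i => if o.1 = i.1 then M o.2 i.2 else 0

/-- `colorPos m k a` is the position of `a` in the order `k, k+1, …, m, 1, …, k-1, 0`. -/
def colorPos (m k a : ℕ) : ℕ := if a = 0 then m else if k ≤ a then a - k else a + m - k

section Scattering

variable {V : Type*}

/-- Transfer of a test function through a crossing of lines one and two. -/
def act₁₂ (f g : V → V → K) (E : V → V → V → K) (a b c : V) : K :=
  f a b * E a b c + g a b * E b a c

/-- Transfer of a test function through a crossing of lines one and three. -/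
def act₁₃ (f g : V → V → K) (E : V → V → V → K) (a b c : V) : K :=
  f a c * E a b c + g a c * E c b a

/-- Transfer of a test function through a crossing of lines two and three. -/
def act₂₃ (f g : V → V → K) (E : V → V → V → K) (a b c : V) : K :=
  f b c * E a b c + g b c * E a c b

/-- Crossing weight of two lines of the same type: `s` is the coupling, `o` the vacuum. -/
def strF [DecidableEq V] (Q : K) (s : V → V → K) (o : V) (z z' : K) (a b : V) : K :=
  if a = b then (if a = o then z - Q * z' else z' - Q * z) else s a b * (z - z')

/-- Exchange weight of two lines of the same type, for the order defined by `p`. -/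
def strG (Q : K) (p : V → ℤ) (z z' : K) (a b : V) : K :=
  if p a < p b then (1 - Q) * z' else if p b < p a then (1 - Q) * z else 0

/-- Crossing weight of a left-moving and a right-moving line. -/
def mixF [DecidableEq V] (Q Φ : K) (s : V → V → K) (o : V) (z z' : K) (a b : V) : K :=
  if a = b then (if a = o then z - z' else Φ ^ 2 * (Q ^ 2 * z' - z))
  else s a b * (z - Q * z')

/-- Exchange weight of a left-moving and a right-moving line. -/
def mixG [DecidableEq V] (Q Φ : K) (p : V → ℤ) (o : V) (z z' : K) (a b : V) : K :=
  if a = b then 0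
  else if a = o then Φ * (1 - Q) * z
  else if b = o then Φ * (1 - Q) * z'
  else if p a < p b then -(Φ ^ 2) * (1 - Q) * Q * z'
  else -(Φ ^ 2) * (1 - Q) * z

theorem act_straight [DecidableEq V] (Q : K) (hQ : Q ≠ 0) (s : V → V → K)
    (hs : ∀ a b, a ≠ b → s a b * s b a = Q) (o : V) (p : V → ℤ)
    (hp : Function.Injective p) (z₁ z₂ z₃ : K) (E : V → V → V → K) (a b c : V) :
    act₂₃ (strF Q s o z₂ z₃) (strG Q p z₂ z₃)
      (act₁₃ (strF Q s o z₁ z₃) (strG Q p z₁ z₃)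
        (act₁₂ (strF Q s o z₁ z₂) (strG Q p z₁ z₂) E)) a b c =
    act₁₂ (strF Q s o z₁ z₂) (strG Q p z₁ z₂)
      (act₁₃ (strF Q s o z₁ z₃) (strG Q p z₁ z₃)
        (act₂₃ (strF Q s o z₂ z₃) (strG Q p z₂ z₃) E)) a b c := by
  have hne : ∀ {x y : V}, x ≠ y → s y x = Q / s x y := fun {x y} h => by
    rw [← hs x y h]
    have := hs x y h
    rw [mul_div_cancel_left₀]
    rintro h0
    rw [h0, zero_mul] at this
    exact hQ this.symm
  have hn0 : ∀ {x y : V}, x ≠ y → s x y ≠ 0 := fun {x y} h h0 => by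
    have := hs x y h
    rw [h0, zero_mul] at this
    exact hQ this.symm
  have hp' : ∀ {x y : V}, x ≠ y → p x < p y ∨ p y < p x :=
    fun h => lt_or_gt_of_ne fun h' => h (hp h')
  by_cases hab : a = b
  · subst hab
    by_cases hac : a = c
    · subst hac
      simp only [act₁₂, act₁₃, act₂₃, strF, strG, lt_irrefl, if_true, if_false]
      ring
    · have h0 := hn0 hac
      rcases hp' hac with h | h <;>
      simp only [act₁₂, act₁₃, act₂₃, strF, strG, lt_irrefl, if_true, if_false, h, h.not_gt,
        hac, Ne.symm hac, hne hac] <;> split_ifs <;> field_simp <;> ring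
  · by_cases hac : a = c
    · subst hac
      have h0 := hn0 hab
      rcases hp' hab with h | h <;>
      simp only [act₁₂, act₁₃, act₂₃, strF, strG, lt_irrefl, if_true, if_false, h, h.not_gt,
        hab, Ne.symm hab, hne hab] <;> split_ifs <;> field_simp <;> ring
    · by_cases hbc : b = c
      · subst hbc
        have h0 := hn0 hab
        rcases hp' hab with h | h <;>
        simp only [act₁₂, act₁₃, act₂₃, strF, strG, lt_irrefl, if_true, if_false, h, h.not_gt,
          hab, Ne.symm hab, hne hab] <;> split_ifs <;> field_simp <;> ring
      · have h0 := hn0 hab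
        have h0' := hn0 hbc
        have h0'' := hn0 hac
        rcases hp' hab with h | h <;> rcases hp' hbc with h' | h' <;>
        rcases hp' hac with h'' | h'' <;>
        first
        | omega
        | simp only [act₁₂, act₁₃, act₂₃, strF, strG, if_true, if_false, h, h.not_gt,
            h', h'.not_gt, h'', h''.not_gt, hab, Ne.symm hab, hac, Ne.symm hac, hbc,
            Ne.symm hbc, hne hab, hne hac, hne hbc]
          field_simp
          ring

/-- Crossing coupling of two left-moving lines. -/
def coupL [DecidableEq V] (Q Φ : K) (x : V → V → K) (o a b : V) : K :=
  if a = o then Φ⁻¹ else if b = o then Q * Φ else x a b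

/-- Crossing coupling of two right-moving lines. -/
def coupR [DecidableEq V] (Q Φ : K) (x : V → V → K) (o a b : V) : K :=
  if a = o then Q * Φ else if b = o then Φ⁻¹ else x a b

/-- Crossing coupling of a left-moving and a right-moving line. -/
def coupM [DecidableEq V] (Φ : K) (x : V → V → K) (o a b : V) : K :=
  if a = o then Φ else if b = o then Φ else Φ ^ 2 * x b a

theorem act_mixed_left [DecidableEq V] (Q Φ : K) (hQ : Q ≠ 0) (hΦ : Φ ≠ 0) (x : V → V → K)
    (o : V) (hx : ∀ a b, a ≠ o → b ≠ o → a ≠ b → x a b * x b a = Q) (p : V → ℤ)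
    (hp : Function.Injective p) (hpo : ∀ a, a ≠ o → p a < p o)
    (z₁ z₂ z₃ : K) (E : V → V → V → K) (a b c : V) :
    act₁₃ (mixF Q Φ (coupM Φ x o) o z₁ z₃) (mixG Q Φ p o z₁ z₃)
      (act₂₃ (mixF Q Φ (coupM Φ x o) o z₂ z₃) (mixG Q Φ p o z₂ z₃)
        (act₁₂ (strF Q (coupL Q Φ x o) o z₁ z₂) (strG Q p z₁ z₂) E)) a b c =
    act₁₂ (strF Q (coupL Q Φ x o) o z₁ z₂) (strG Q p z₁ z₂)
      (act₂₃ (mixF Q Φ (coupM Φ x o) o z₂ z₃) (mixG Q Φ p o z₂ z₃)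
        (act₁₃ (mixF Q Φ (coupM Φ x o) o z₁ z₃) (mixG Q Φ p o z₁ z₃) E)) a b c := by
  have hn0 : ∀ {u v : V}, u ≠ o → v ≠ o → u ≠ v → x u v ≠ 0 := fun {u v} hu hv h h0 => by
    have := hx u v hu hv h
    rw [h0, zero_mul] at this
    exact hQ this.symm
  have hne : ∀ {u v : V}, u ≠ o → v ≠ o → u ≠ v → x v u = Q / x u v :=
    fun {u v} hu hv h => by
      rw [← hx u v hu hv h, mul_div_cancel_left₀ _ (hn0 hu hv h)]
  have hp' : ∀ {u v : V}, u ≠ v → p u < p v ∨ p v < p u :=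
    fun h => lt_or_gt_of_ne fun h' => h (hp h')
  by_cases hab : a = b
  · subst hab
    by_cases hac : a = c
    · subst hac
      simp only [act₁₂, act₁₃, act₂₃, strF, strG, mixF, mixG, lt_irrefl, if_true, if_false]
      split_ifs <;> ring
    · by_cases ha : a = o
      · subst ha
        have h := hpo _ (Ne.symm hac)
        simp only [act₁₂, act₁₃, act₂₃, strF, strG, mixF, mixG, lt_irrefl, if_true, if_false, coupL, coupM,
          hac, Ne.symm hac, h, h.not_gt]
        field_simp
        ring
      · by_cases hc : c = o
        · subst hc
          have h := hpo _ hac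
          simp only [act₁₂, act₁₃, act₂₃, strF, strG, mixF, mixG, lt_irrefl, if_true, if_false, coupL, coupM,
            hac, Ne.symm hac, h, h.not_gt]
          field_simp
          ring
        · have h0 := hn0 ha hc hac
          rcases hp' hac with h | h <;>
          simp only [act₁₂, act₁₃, act₂₃, strF, strG, mixF, mixG, lt_irrefl, if_true, if_false, coupL, coupM,
            hac, Ne.symm hac, h, h.not_gt, ha, hc, hne ha hc hac] <;>
          field_simp <;> ring
  · by_cases hac : a = c
    · subst hac
      by_cases ha : a = o
      · subst ha
        have h := hpo _ (Ne.symm hab)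
        simp only [act₁₂, act₁₃, act₂₃, strF, strG, mixF, mixG, lt_irrefl, if_true, if_false, coupL, coupM,
          hab, Ne.symm hab, h, h.not_gt]
        field_simp
        ring
      · by_cases hb : b = o
        · subst hb
          have h := hpo _ hab
          simp only [act₁₂, act₁₃, act₂₃, strF, strG, mixF, mixG, lt_irrefl, if_true, if_false, coupL, coupM,
            hab, Ne.symm hab, h, h.not_gt]
          field_simp
          ring
        · have h0 := hn0 ha hb hab
          rcases hp' hab with h | h <;>
          simp only [act₁₂, act₁₃, act₂₃, strF, strG, mixF, mixG, lt_irrefl, if_true, if_false, coupL, coupM,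
            hab, Ne.symm hab, h, h.not_gt, ha, hb, hne ha hb hab] <;>
          field_simp <;> ring
    · by_cases hbc : b = c
      · subst hbc
        by_cases ha : a = o
        · subst ha
          have h := hpo _ (Ne.symm hab)
          simp only [act₁₂, act₁₃, act₂₃, strF, strG, mixF, mixG, lt_irrefl, if_true, if_false, coupL, coupM,
            hab, Ne.symm hab, h, h.not_gt]
          field_simp
          ring
        · by_cases hb : b = o
          · subst hb
            have h := hpo _ hab
            simp only [act₁₂, act₁₃, act₂₃, strF, strG, mixF, mixG, lt_irrefl, if_true, if_false, coupL, coupM,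
              hab, Ne.symm hab, h, h.not_gt]
            field_simp
            ring
          · have h0 := hn0 ha hb hab
            rcases hp' hab with h | h <;>
            simp only [act₁₂, act₁₃, act₂₃, strF, strG, mixF, mixG, lt_irrefl, if_true, if_false, coupL, coupM,
              hab, Ne.symm hab, h, h.not_gt, ha, hb, hne ha hb hab] <;>
            field_simp <;> ring
      · have hba := Ne.symm hab
        have hca := Ne.symm hac
        have hcb := Ne.symm hbc
        by_cases ha : a = o
        · subst ha
          have h := hpo _ hba
          have h' := hpo _ hca
          have h0 := hn0 hba hca hbc
          rcases hp' hbc with h'' | h'' <;>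
          simp only [act₁₂, act₁₃, act₂₃, strF, strG, mixF, mixG, lt_irrefl, if_true, if_false, coupL, coupM,
            h, h.not_gt, h', h'.not_gt, h'', h''.not_gt,
            hab, hba, hac, hca, hbc, hcb, hne hba hca hbc] <;>
          field_simp <;> ring
        by_cases hb : b = o
        · subst hb
          have h := hpo _ hab
          have h' := hpo _ hcb
          have h0 := hn0 hab hcb hac
          rcases hp' hac with h'' | h'' <;>
          simp only [act₁₂, act₁₃, act₂₃, strF, strG, mixF, mixG, lt_irrefl, if_true, if_false, coupL, coupM,
            h, h.not_gt, h', h'.not_gt, h'', h''.not_gt,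
            hab, hba, hac, hca, hbc, hcb, hne hab hcb hac] <;>
          field_simp <;> ring
        by_cases hc : c = o
        · subst hc
          have h := hpo _ hac
          have h' := hpo _ hbc
          have h0 := hn0 hac hbc hab
          rcases hp' hab with h'' | h'' <;>
          simp only [act₁₂, act₁₃, act₂₃, strF, strG, mixF, mixG, lt_irrefl, if_true, if_false, coupL, coupM,
            h, h.not_gt, h', h'.not_gt, h'', h''.not_gt,
            hab, hba, hac, hca, hbc, hcb, hne hac hbc hab] <;>
          field_simp <;> ring
        have h0 := hn0 ha hb hab
        have h0' := hn0 hb hc hbc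
        have h0'' := hn0 ha hc hac
        rcases hp' hab with h | h <;> rcases hp' hbc with h' | h' <;>
        rcases hp' hac with h'' | h'' <;>
        first
        | omega
        | simp only [act₁₂, act₁₃, act₂₃, strF, strG, mixF, mixG, lt_irrefl, if_true, if_false, coupL, coupM,
            h, h.not_gt, h', h'.not_gt, h'', h''.not_gt, hab, hba, hac, hca, hbc, hcb,
            ha, hb, hc, hne ha hb hab, hne ha hc hac, hne hb hc hbc]
          field_simp
          ring

theorem act_mixed_right [DecidableEq V] (Q Φ : K) (hQ : Q ≠ 0) (hΦ : Φ ≠ 0) (x : V → V → K)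
    (o : V) (hx : ∀ a b, a ≠ o → b ≠ o → a ≠ b → x a b * x b a = Q) (p : V → ℤ)
    (hp : Function.Injective p) (hpo : ∀ a, a ≠ o → p a < p o)
    (z₁ z₂ z₃ : K) (E : V → V → V → K) (a b c : V) :
    act₁₃ (mixF Q Φ (coupM Φ x o) o z₁ z₃) (mixG Q Φ p o z₁ z₃)
      (act₁₂ (mixF Q Φ (coupM Φ x o) o z₁ z₂) (mixG Q Φ p o z₁ z₂)
        (act₂₃ (strF Q (coupR Q Φ x o) o z₂ z₃) (strG Q p z₂ z₃) E)) a b c =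
    act₂₃ (strF Q (coupR Q Φ x o) o z₂ z₃) (strG Q p z₂ z₃)
      (act₁₂ (mixF Q Φ (coupM Φ x o) o z₁ z₂) (mixG Q Φ p o z₁ z₂)
        (act₁₃ (mixF Q Φ (coupM Φ x o) o z₁ z₃) (mixG Q Φ p o z₁ z₃) E)) a b c := by
  have hn0 : ∀ {u v : V}, u ≠ o → v ≠ o → u ≠ v → x u v ≠ 0 := fun {u v} hu hv h h0 => by
    have := hx u v hu hv h
    rw [h0, zero_mul] at this
    exact hQ this.symm
  have hne : ∀ {u v : V}, u ≠ o → v ≠ o → u ≠ v → x v u = Q / x u v :=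
    fun {u v} hu hv h => by
      rw [← hx u v hu hv h, mul_div_cancel_left₀ _ (hn0 hu hv h)]
  have hp' : ∀ {u v : V}, u ≠ v → p u < p v ∨ p v < p u :=
    fun h => lt_or_gt_of_ne fun h' => h (hp h')
  by_cases hab : a = b
  · subst hab
    by_cases hac : a = c
    · subst hac
      simp only [act₁₂, act₁₃, act₂₃, strF, strG, mixF, mixG, lt_irrefl, if_true, if_false]
      split_ifs <;> ring
    · by_cases ha : a = o
      · subst ha
        have h := hpo _ (Ne.symm hac)
        simp only [act₁₂, act₁₃, act₂₃, strF, strG, mixF, mixG, lt_irrefl, if_true, if_false, coupR, coupM,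
          hac, Ne.symm hac, h, h.not_gt]
        field_simp
        ring
      · by_cases hc : c = o
        · subst hc
          have h := hpo _ hac
          simp only [act₁₂, act₁₃, act₂₃, strF, strG, mixF, mixG, lt_irrefl, if_true, if_false, coupR, coupM,
            hac, Ne.symm hac, h, h.not_gt]
          field_simp
          ring
        · have h0 := hn0 ha hc hac
          rcases hp' hac with h | h <;>
          simp only [act₁₂, act₁₃, act₂₃, strF, strG, mixF, mixG, lt_irrefl, if_true, if_false, coupR, coupM,
            hac, Ne.symm hac, h, h.not_gt, ha, hc, hne ha hc hac] <;>
          field_simp <;> ring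
  · by_cases hac : a = c
    · subst hac
      by_cases ha : a = o
      · subst ha
        have h := hpo _ (Ne.symm hab)
        simp only [act₁₂, act₁₃, act₂₃, strF, strG, mixF, mixG, lt_irrefl, if_true, if_false, coupR, coupM,
          hab, Ne.symm hab, h, h.not_gt]
        field_simp
        ring
      · by_cases hb : b = o
        · subst hb
          have h := hpo _ hab
          simp only [act₁₂, act₁₃, act₂₃, strF, strG, mixF, mixG, lt_irrefl, if_true, if_false, coupR, coupM,
            hab, Ne.symm hab, h, h.not_gt]
          field_simp
          ring
        · have h0 := hn0 ha hb hab
          rcases hp' hab with h | h <;>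
          simp only [act₁₂, act₁₃, act₂₃, strF, strG, mixF, mixG, lt_irrefl, if_true, if_false, coupR, coupM,
            hab, Ne.symm hab, h, h.not_gt, ha, hb, hne ha hb hab] <;>
          field_simp <;> ring
    · by_cases hbc : b = c
      · subst hbc
        by_cases ha : a = o
        · subst ha
          have h := hpo _ (Ne.symm hab)
          simp only [act₁₂, act₁₃, act₂₃, strF, strG, mixF, mixG, lt_irrefl, if_true, if_false, coupR, coupM,
            hab, Ne.symm hab, h, h.not_gt]
          field_simp
          ring
        · by_cases hb : b = o
          · subst hb
            have h := hpo _ hab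
            simp only [act₁₂, act₁₃, act₂₃, strF, strG, mixF, mixG, lt_irrefl, if_true, if_false, coupR, coupM,
              hab, Ne.symm hab, h, h.not_gt]
            field_simp
            ring
          · have h0 := hn0 ha hb hab
            rcases hp' hab with h | h <;>
            simp only [act₁₂, act₁₃, act₂₃, strF, strG, mixF, mixG, lt_irrefl, if_true, if_false, coupR, coupM,
              hab, Ne.symm hab, h, h.not_gt, ha, hb, hne ha hb hab] <;>
            field_simp <;> ring
      · have hba := Ne.symm hab
        have hca := Ne.symm hac
        have hcb := Ne.symm hbc
        by_cases ha : a = o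
        · subst ha
          have h := hpo _ hba
          have h' := hpo _ hca
          have h0 := hn0 hba hca hbc
          rcases hp' hbc with h'' | h'' <;>
          simp only [act₁₂, act₁₃, act₂₃, strF, strG, mixF, mixG, lt_irrefl, if_true, if_false, coupR, coupM,
            h, h.not_gt, h', h'.not_gt, h'', h''.not_gt,
            hab, hba, hac, hca, hbc, hcb, hne hba hca hbc] <;>
          field_simp <;> ring
        by_cases hb : b = o
        · subst hb
          have h := hpo _ hab
          have h' := hpo _ hcb
          have h0 := hn0 hab hcb hac
          rcases hp' hac with h'' | h'' <;>
          simp only [act₁₂, act₁₃, act₂₃, strF, strG, mixF, mixG, lt_irrefl, if_true, if_false, coupR, coupM,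
            h, h.not_gt, h', h'.not_gt, h'', h''.not_gt,
            hab, hba, hac, hca, hbc, hcb, hne hab hcb hac] <;>
          field_simp <;> ring
        by_cases hc : c = o
        · subst hc
          have h := hpo _ hac
          have h' := hpo _ hbc
          have h0 := hn0 hac hbc hab
          rcases hp' hab with h'' | h'' <;>
          simp only [act₁₂, act₁₃, act₂₃, strF, strG, mixF, mixG, lt_irrefl, if_true, if_false, coupR, coupM,
            h, h.not_gt, h', h'.not_gt, h'', h''.not_gt,
            hab, hba, hac, hca, hbc, hcb, hne hac hbc hab] <;>
          field_simp <;> ring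
        have h0 := hn0 ha hb hab
        have h0' := hn0 hb hc hbc
        have h0'' := hn0 ha hc hac
        rcases hp' hab with h | h <;> rcases hp' hbc with h' | h' <;>
        rcases hp' hac with h'' | h'' <;>
        first
        | omega
        | simp only [act₁₂, act₁₃, act₂₃, strF, strG, mixF, mixG, lt_irrefl, if_true, if_false, coupR, coupM,
            h, h.not_gt, h', h'.not_gt, h'', h''.not_gt, hab, hba, hac, hca, hbc, hcb,
            ha, hb, hc, hne ha hb hab, hne ha hc hac, hne hb hc hbc]
          field_simp
          ring

/-- Crossing weight of a right-moving line with the column of color `k`. -/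
def colRF [DecidableEq V] (Φ : K) (x : V → V → K) (o k : V) (z : K) (a b : V) : K :=
  (if b = o then 1 else if b = k then (if a = o then Φ else Φ * x a k) else 0) *
    (if a = k then z else 1)

/-- Exchange weight of a right-moving line with the column of color `k`. -/
def colRG [DecidableEq V] (Q Φ : K) (o k : V) (z : K) (a b : V) : K :=
  if b = o then (if a = k then Φ * (1 - Q) * z else 0)
  else if b = k then (if a = o then 1 else 0) else 0

/-- Crossing weight of a left-moving line with the column of color `k`. -/
def colLF [DecidableEq V] (Φ : K) (x : V → V → K) (o k : V) (z : K) (a b : V) : K :=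
  (if b = o then 1 else if b = k then (if a = o then Φ else Φ * x k a) else 0) *
    (if a = k then z⁻¹ else 1)

/-- Exchange weight of a left-moving line with the column of color `k`. -/
def colLG [DecidableEq V] (Q Φ : K) (o k : V) (z : K) (a b : V) : K :=
  if b = o then (if a = k then z⁻¹ else 0)
  else if b = k then (if a = o then Φ * (1 - Q) else 0) else 0

/-- The order defined by `p'` is obtained from the one defined by `p`, in which `k` is the
least and `o` the greatest element, by moving `k` right below `o`. -/
structure IsRotation (p p' : V → ℤ) (o k : V) : Prop where
  ne : k ≠ o
  lt_top : ∀ a, a ≠ o → p a < p o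
  lt_top' : ∀ a, a ≠ o → p' a < p' o
  bot_lt : ∀ a, a ≠ k → p k < p a
  lt_k : ∀ a, a ≠ o → a ≠ k → p' a < p' k
  iff : ∀ a b, a ≠ k → b ≠ k → (p' a < p' b ↔ p a < p b)

theorem act_column_right [DecidableEq V] (Q Φ : K) (hQ : Q ≠ 0) (hΦ : Φ ≠ 0) (x : V → V → K)
    (o k : V) (hx : ∀ a b, a ≠ o → b ≠ o → a ≠ b → x a b * x b a = Q) (hk : x k k = -Q)
    (p p' : V → ℤ) (hp : IsRotation p p' o k) (z₁ z₂ : K) 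
    (E : V → V → V → K) (a b c : V) (hc : c = o ∨ c = k) :
    act₂₃ (colRF Φ x o k z₂) (colRG Q Φ o k z₂)
      (act₁₃ (colRF Φ x o k z₁) (colRG Q Φ o k z₁)
        (act₁₂ (strF Q (coupR Q Φ x o) o z₁ z₂) (strG Q p' z₂ z₁) E)) a b c =
    act₁₂ (strF Q (coupR Q Φ x o) o z₁ z₂) (strG Q p z₂ z₁)
      (act₁₃ (colRF Φ x o k z₁) (colRG Q Φ o k z₁)
        (act₂₃ (colRF Φ x o k z₂) (colRG Q Φ o k z₂) E)) a b c := by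
  obtain ⟨hko, ht, ht', hl, hm, hi⟩ := hp
  have hok := hko.symm
  have h₁ := ht k hko
  have h₂ := ht' k hko
  have hn0 : ∀ {v : V}, v ≠ o → v ≠ k → x k v ≠ 0 := fun {v} hv h h0 => by
    have := hx k v hko hv h.symm
    rw [h0, zero_mul] at this
    exact hQ this.symm
  have hne : ∀ {v : V}, v ≠ o → v ≠ k → x v k = Q / x k v :=
    fun {v} hv h => by
      rw [← hx k v hko hv h.symm, mul_div_cancel_left₀ _ (hn0 hv h)]
  by_cases hao : a = o
  · by_cases hbo : b = o
    · rcases hc with hc | hc <;>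
      simp only [act₁₂, act₁₃, act₂₃, colRF, colRG, colLF, colLG, strF, strG, coupR, lt_irrefl,
      if_true, if_false,
        hc, hok, hko, h₁, h₁.not_gt, h₂, h₂.not_gt, hk, hao, hbo] <;>
      field_simp <;> ring
    by_cases hbk : b = k
    · rcases hc with hc | hc <;>
      simp only [act₁₂, act₁₃, act₂₃, colRF, colRG, colLF, colLG, strF, strG, coupR, lt_irrefl,
      if_true, if_false,
        hc, hok, hko, h₁, h₁.not_gt, h₂, h₂.not_gt, hk, hao, hbk] <;>
      field_simp <;> ring
    have h0 := hn0 hbo hbk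
    rcases hc with hc | hc <;>
    simp only [act₁₂, act₁₃, act₂₃, colRF, colRG, colLF, colLG, strF, strG, coupR, lt_irrefl,
      if_true, if_false,
      hc, hok, hko, h₁, h₁.not_gt, h₂, h₂.not_gt, hk, hao, hbo, hbk, Ne.symm hbo, Ne.symm hbk, ht b hbo, (ht b hbo).not_gt, ht' b hbo,
      (ht' b hbo).not_gt, hl b hbk, (hl b hbk).not_gt, hm b hbo hbk, (hm b hbo hbk).not_gt,
      hne hbo hbk] <;>
    field_simp <;> ring
  by_cases hak : a = k
  · by_cases hbo : b = o
    · rcases hc with hc | hc <;>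
      simp only [act₁₂, act₁₃, act₂₃, colRF, colRG, colLF, colLG, strF, strG, coupR, lt_irrefl,
      if_true, if_false,
        hc, hok, hko, h₁, h₁.not_gt, h₂, h₂.not_gt, hk, hak, hbo] <;>
      field_simp <;> ring
    by_cases hbk : b = k
    · rcases hc with hc | hc <;>
      simp only [act₁₂, act₁₃, act₂₃, colRF, colRG, colLF, colLG, strF, strG, coupR, lt_irrefl,
      if_true, if_false,
        hc, hok, hko, h₁, h₁.not_gt, h₂, h₂.not_gt, hk, hak, hbk] <;>
      field_simp <;> ring
    have h0 := hn0 hbo hbk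
    rcases hc with hc | hc <;>
    simp only [act₁₂, act₁₃, act₂₃, colRF, colRG, colLF, colLG, strF, strG, coupR, lt_irrefl,
      if_true, if_false,
      hc, hok, hko, h₁, h₁.not_gt, h₂, h₂.not_gt, hk, hak, hbo, hbk, Ne.symm hbo, Ne.symm hbk, ht b hbo, (ht b hbo).not_gt, ht' b hbo,
      (ht' b hbo).not_gt, hl b hbk, (hl b hbk).not_gt, hm b hbo hbk, (hm b hbo hbk).not_gt,
      hne hbo hbk] <;>
    field_simp <;> ring
  have h0' := hn0 hao hak
  by_cases hbo : b = o
  · rcases hc with hc | hc <;>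
    simp only [act₁₂, act₁₃, act₂₃, colRF, colRG, colLF, colLG, strF, strG, coupR, lt_irrefl,
      if_true, if_false,
      hc, hok, hko, h₁, h₁.not_gt, h₂, h₂.not_gt, hk, hao, hak, Ne.symm hao, Ne.symm hak, ht a hao, (ht a hao).not_gt, ht' a hao,
      (ht' a hao).not_gt, hl a hak, (hl a hak).not_gt, hm a hao hak, (hm a hao hak).not_gt,
      hne hao hak, hbo] <;>
    field_simp <;> ring
  by_cases hbk : b = k
  · rcases hc with hc | hc <;>
    simp only [act₁₂, act₁₃, act₂₃, colRF, colRG, colLF, colLG, strF, strG, coupR, lt_irrefl,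
      if_true, if_false,
      hc, hok, hko, h₁, h₁.not_gt, h₂, h₂.not_gt, hk, hao, hak, Ne.symm hao, Ne.symm hak, ht a hao, (ht a hao).not_gt, ht' a hao,
      (ht' a hao).not_gt, hl a hak, (hl a hak).not_gt, hm a hao hak, (hm a hao hak).not_gt,
      hne hao hak, hbk] <;>
    field_simp <;> ring
  have h0 := hn0 hbo hbk
  by_cases hab : a = b
  · subst hab
    rcases hc with hc | hc <;>
    simp only [act₁₂, act₁₃, act₂₃, colRF, colRG, colLF, colLG, strF, strG, coupR, lt_irrefl,
      if_true, if_false,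
      hc, hok, hko, h₁, h₁.not_gt, h₂, h₂.not_gt, hk, hao, hak, Ne.symm hao, Ne.symm hak, ht a hao, (ht a hao).not_gt, ht' a hao,
      (ht' a hao).not_gt, hl a hak, (hl a hak).not_gt, hm a hao hak, (hm a hao hak).not_gt,
      hne hao hak] <;>
    field_simp <;> ring
  rcases hc with hc | hc <;>
  simp only [act₁₂, act₁₃, act₂₃, colRF, colRG, colLF, colLG, strF, strG, coupR, lt_irrefl,
      if_true, if_false,
    hc, hok, hko, h₁, h₁.not_gt, h₂, h₂.not_gt, hk, hao, hak, Ne.symm hao, Ne.symm hak, ht a hao, (ht a hao).not_gt, ht' a hao,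
      (ht' a hao).not_gt, hl a hak, (hl a hak).not_gt, hm a hao hak, (hm a hao hak).not_gt,
      hne hao hak, hbo, hbk, Ne.symm hbo, Ne.symm hbk, ht b hbo, (ht b hbo).not_gt, ht' b hbo,
      (ht' b hbo).not_gt, hl b hbk, (hl b hbk).not_gt, hm b hbo hbk, (hm b hbo hbk).not_gt,
      hne hbo hbk, hab, Ne.symm hab, hi a b hak hbk, hi b a hbk hak] <;>
  field_simp <;> ring

theorem act_column_left [DecidableEq V] (Q Φ : K) (hQ : Q ≠ 0) (hΦ : Φ ≠ 0) (x : V → V → K)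
    (o k : V) (hx : ∀ a b, a ≠ o → b ≠ o → a ≠ b → x a b * x b a = Q) (hk : x k k = -Q)
    (p p' : V → ℤ) (hp : IsRotation p p' o k) (z₁ z₂ : K) (hz₁ : z₁ ≠ 0) (hz₂ : z₂ ≠ 0)
    (E : V → V → V → K) (a b c : V) (hc : c = o ∨ c = k) :
    act₁₃ (colLF Φ x o k z₁) (colLG Q Φ o k z₁)
      (act₂₃ (colLF Φ x o k z₂) (colLG Q Φ o k z₂)
        (act₁₂ (strF Q (coupL Q Φ x o) o z₁ z₂) (strG Q p' z₁ z₂) E)) a b c =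
    act₁₂ (strF Q (coupL Q Φ x o) o z₁ z₂) (strG Q p z₁ z₂)
      (act₂₃ (colLF Φ x o k z₂) (colLG Q Φ o k z₂)
        (act₁₃ (colLF Φ x o k z₁) (colLG Q Φ o k z₁) E)) a b c := by
  obtain ⟨hko, ht, ht', hl, hm, hi⟩ := hp
  have hok := hko.symm
  have h₁ := ht k hko
  have h₂ := ht' k hko
  have hn0 : ∀ {v : V}, v ≠ o → v ≠ k → x k v ≠ 0 := fun {v} hv h h0 => by
    have := hx k v hko hv h.symm
    rw [h0, zero_mul] at this
    exact hQ this.symm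
  have hne : ∀ {v : V}, v ≠ o → v ≠ k → x v k = Q / x k v :=
    fun {v} hv h => by
      rw [← hx k v hko hv h.symm, mul_div_cancel_left₀ _ (hn0 hv h)]
  by_cases hao : a = o
  · by_cases hbo : b = o
    · rcases hc with hc | hc <;>
      simp only [act₁₂, act₁₃, act₂₃, colRF, colRG, colLF, colLG, strF, strG, coupL, lt_irrefl,
      if_true, if_false,
        hc, hok, hko, h₁, h₁.not_gt, h₂, h₂.not_gt, hk, hao, hbo] <;>
      field_simp <;> ring
    by_cases hbk : b = k
    · rcases hc with hc | hc <;>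
      simp only [act₁₂, act₁₃, act₂₃, colRF, colRG, colLF, colLG, strF, strG, coupL, lt_irrefl,
      if_true, if_false,
        hc, hok, hko, h₁, h₁.not_gt, h₂, h₂.not_gt, hk, hao, hbk] <;>
      field_simp <;> ring
    have h0 := hn0 hbo hbk
    rcases hc with hc | hc <;>
    simp only [act₁₂, act₁₃, act₂₃, colRF, colRG, colLF, colLG, strF, strG, coupL, lt_irrefl,
      if_true, if_false,
      hc, hok, hko, h₁, h₁.not_gt, h₂, h₂.not_gt, hk, hao, hbo, hbk, Ne.symm hbo, Ne.symm hbk, ht b hbo, (ht b hbo).not_gt, ht' b hbo,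
      (ht' b hbo).not_gt, hl b hbk, (hl b hbk).not_gt, hm b hbo hbk, (hm b hbo hbk).not_gt,
      hne hbo hbk] <;>
    field_simp <;> ring
  by_cases hak : a = k
  · by_cases hbo : b = o
    · rcases hc with hc | hc <;>
      simp only [act₁₂, act₁₃, act₂₃, colRF, colRG, colLF, colLG, strF, strG, coupL, lt_irrefl,
      if_true, if_false,
        hc, hok, hko, h₁, h₁.not_gt, h₂, h₂.not_gt, hk, hak, hbo] <;>
      field_simp <;> ring
    by_cases hbk : b = k
    · rcases hc with hc | hc <;>
      simp only [act₁₂, act₁₃, act₂₃, colRF, colRG, colLF, colLG, strF, strG, coupL, lt_irrefl,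
      if_true, if_false,
        hc, hok, hko, h₁, h₁.not_gt, h₂, h₂.not_gt, hk, hak, hbk] <;>
      field_simp <;> ring
    have h0 := hn0 hbo hbk
    rcases hc with hc | hc <;>
    simp only [act₁₂, act₁₃, act₂₃, colRF, colRG, colLF, colLG, strF, strG, coupL, lt_irrefl,
      if_true, if_false,
      hc, hok, hko, h₁, h₁.not_gt, h₂, h₂.not_gt, hk, hak, hbo, hbk, Ne.symm hbo, Ne.symm hbk, ht b hbo, (ht b hbo).not_gt, ht' b hbo,
      (ht' b hbo).not_gt, hl b hbk, (hl b hbk).not_gt, hm b hbo hbk, (hm b hbo hbk).not_gt,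
      hne hbo hbk] <;>
    field_simp <;> ring
  have h0' := hn0 hao hak
  by_cases hbo : b = o
  · rcases hc with hc | hc <;>
    simp only [act₁₂, act₁₃, act₂₃, colRF, colRG, colLF, colLG, strF, strG, coupL, lt_irrefl,
      if_true, if_false,
      hc, hok, hko, h₁, h₁.not_gt, h₂, h₂.not_gt, hk, hao, hak, Ne.symm hao, Ne.symm hak, ht a hao, (ht a hao).not_gt, ht' a hao,
      (ht' a hao).not_gt, hl a hak, (hl a hak).not_gt, hm a hao hak, (hm a hao hak).not_gt,
      hne hao hak, hbo] <;>
    field_simp <;> ring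
  by_cases hbk : b = k
  · rcases hc with hc | hc <;>
    simp only [act₁₂, act₁₃, act₂₃, colRF, colRG, colLF, colLG, strF, strG, coupL, lt_irrefl,
      if_true, if_false,
      hc, hok, hko, h₁, h₁.not_gt, h₂, h₂.not_gt, hk, hao, hak, Ne.symm hao, Ne.symm hak, ht a hao, (ht a hao).not_gt, ht' a hao,
      (ht' a hao).not_gt, hl a hak, (hl a hak).not_gt, hm a hao hak, (hm a hao hak).not_gt,
      hne hao hak, hbk] <;>
    field_simp <;> ring
  have h0 := hn0 hbo hbk
  by_cases hab : a = b
  · subst hab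
    rcases hc with hc | hc <;>
    simp only [act₁₂, act₁₃, act₂₃, colRF, colRG, colLF, colLG, strF, strG, coupL, lt_irrefl,
      if_true, if_false,
      hc, hok, hko, h₁, h₁.not_gt, h₂, h₂.not_gt, hk, hao, hak, Ne.symm hao, Ne.symm hak, ht a hao, (ht a hao).not_gt, ht' a hao,
      (ht' a hao).not_gt, hl a hak, (hl a hak).not_gt, hm a hao hak, (hm a hao hak).not_gt,
      hne hao hak] <;>
    field_simp <;> ring
  rcases hc with hc | hc <;>
  simp only [act₁₂, act₁₃, act₂₃, colRF, colRG, colLF, colLG, strF, strG, coupL, lt_irrefl,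
      if_true, if_false,
    hc, hok, hko, h₁, h₁.not_gt, h₂, h₂.not_gt, hk, hao, hak, Ne.symm hao, Ne.symm hak, ht a hao, (ht a hao).not_gt, ht' a hao,
      (ht' a hao).not_gt, hl a hak, (hl a hak).not_gt, hm a hao hak, (hm a hao hak).not_gt,
      hne hao hak, hbo, hbk, Ne.symm hbo, Ne.symm hbk, ht b hbo, (ht b hbo).not_gt, ht' b hbo,
      (ht' b hbo).not_gt, hl b hbk, (hl b hbk).not_gt, hm b hbo hbk, (hm b hbo hbk).not_gt,
      hne hbo hbk, hab, Ne.symm hab, hi a b hak hbk, hi b a hbk hak] <;>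
  field_simp <;> ring

theorem act_column_mixed [DecidableEq V] (Q Φ : K) (hQ : Q ≠ 0) (hΦ : Φ ≠ 0) (x : V → V → K)
    (o k : V) (hx : ∀ a b, a ≠ o → b ≠ o → a ≠ b → x a b * x b a = Q) (hk : x k k = -Q)
    (p p' : V → ℤ) (hp : IsRotation p p' o k) (z₁ z₂ : K) (hz₁ : z₁ ≠ 0)
    (E : V → V → V → K) (a b c : V) (hc : c = o ∨ c = k) :
    act₁₃ (colLF Φ x o k z₁) (colLG Q Φ o k z₁)
      (act₁₂ (mixF Q Φ (coupM Φ x o) o z₁ z₂) (mixG Q Φ p' o z₁ z₂)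
        (act₂₃ (colRF Φ x o k z₂) (fun u v => colRG Q Φ o k z₂ v u) E)) a b c =
    act₂₃ (colRF Φ x o k z₂) (fun u v => colRG Q Φ o k z₂ v u)
      (act₁₂ (mixF Q Φ (coupM Φ x o) o z₁ z₂) (mixG Q Φ p o z₁ z₂)
        (act₁₃ (colLF Φ x o k z₁) (colLG Q Φ o k z₁) E)) a b c := by
  obtain ⟨hko, ht, ht', hl, hm, hi⟩ := hp
  have hok := hko.symm
  have h₁ := ht k hko
  have h₂ := ht' k hko
  have hn0 : ∀ {v : V}, v ≠ o → v ≠ k → x k v ≠ 0 := fun {v} hv h h0 => by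
    have := hx k v hko hv h.symm
    rw [h0, zero_mul] at this
    exact hQ this.symm
  have hne : ∀ {v : V}, v ≠ o → v ≠ k → x v k = Q / x k v :=
    fun {v} hv h => by
      rw [← hx k v hko hv h.symm, mul_div_cancel_left₀ _ (hn0 hv h)]
  by_cases hao : a = o
  · by_cases hbo : b = o
    · rcases hc with hc | hc <;>
      simp only [act₁₂, act₁₃, act₂₃, colRF, colRG, colLF, colLG, mixF, mixG, coupM, lt_irrefl,
      if_true, if_false,
        hc, hok, hko, h₁, h₁.not_gt, h₂, h₂.not_gt, hk, hao, hbo] <;>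
      field_simp <;> ring
    by_cases hbk : b = k
    · rcases hc with hc | hc <;>
      simp only [act₁₂, act₁₃, act₂₃, colRF, colRG, colLF, colLG, mixF, mixG, coupM, lt_irrefl,
      if_true, if_false,
        hc, hok, hko, h₁, h₁.not_gt, h₂, h₂.not_gt, hk, hao, hbk] <;>
      field_simp <;> ring
    have h0 := hn0 hbo hbk
    rcases hc with hc | hc <;>
    simp only [act₁₂, act₁₃, act₂₃, colRF, colRG, colLF, colLG, mixF, mixG, coupM, lt_irrefl,
      if_true, if_false,
      hc, hok, hko, h₁, h₁.not_gt, h₂, h₂.not_gt, hk, hao, hbo, hbk, Ne.symm hbo, Ne.symm hbk, ht b hbo, (ht b hbo).not_gt, ht' b hbo,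
      (ht' b hbo).not_gt, hl b hbk, (hl b hbk).not_gt, hm b hbo hbk, (hm b hbo hbk).not_gt,
      hne hbo hbk] <;>
    field_simp <;> ring
  by_cases hak : a = k
  · by_cases hbo : b = o
    · rcases hc with hc | hc <;>
      simp only [act₁₂, act₁₃, act₂₃, colRF, colRG, colLF, colLG, mixF, mixG, coupM, lt_irrefl,
      if_true, if_false,
        hc, hok, hko, h₁, h₁.not_gt, h₂, h₂.not_gt, hk, hak, hbo] <;>
      field_simp <;> ring
    by_cases hbk : b = k
    · rcases hc with hc | hc <;>
      simp only [act₁₂, act₁₃, act₂₃, colRF, colRG, colLF, colLG, mixF, mixG, coupM, lt_irrefl,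
      if_true, if_false,
        hc, hok, hko, h₁, h₁.not_gt, h₂, h₂.not_gt, hk, hak, hbk] <;>
      field_simp <;> ring
    have h0 := hn0 hbo hbk
    rcases hc with hc | hc <;>
    simp only [act₁₂, act₁₃, act₂₃, colRF, colRG, colLF, colLG, mixF, mixG, coupM, lt_irrefl,
      if_true, if_false,
      hc, hok, hko, h₁, h₁.not_gt, h₂, h₂.not_gt, hk, hak, hbo, hbk, Ne.symm hbo, Ne.symm hbk, ht b hbo, (ht b hbo).not_gt, ht' b hbo,
      (ht' b hbo).not_gt, hl b hbk, (hl b hbk).not_gt, hm b hbo hbk, (hm b hbo hbk).not_gt,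
      hne hbo hbk] <;>
    field_simp <;> ring
  have h0' := hn0 hao hak
  by_cases hbo : b = o
  · rcases hc with hc | hc <;>
    simp only [act₁₂, act₁₃, act₂₃, colRF, colRG, colLF, colLG, mixF, mixG, coupM, lt_irrefl,
      if_true, if_false,
      hc, hok, hko, h₁, h₁.not_gt, h₂, h₂.not_gt, hk, hao, hak, Ne.symm hao, Ne.symm hak, ht a hao, (ht a hao).not_gt, ht' a hao,
      (ht' a hao).not_gt, hl a hak, (hl a hak).not_gt, hm a hao hak, (hm a hao hak).not_gt,
      hne hao hak, hbo] <;>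
    field_simp <;> ring
  by_cases hbk : b = k
  · rcases hc with hc | hc <;>
    simp only [act₁₂, act₁₃, act₂₃, colRF, colRG, colLF, colLG, mixF, mixG, coupM, lt_irrefl,
      if_true, if_false,
      hc, hok, hko, h₁, h₁.not_gt, h₂, h₂.not_gt, hk, hao, hak, Ne.symm hao, Ne.symm hak, ht a hao, (ht a hao).not_gt, ht' a hao,
      (ht' a hao).not_gt, hl a hak, (hl a hak).not_gt, hm a hao hak, (hm a hao hak).not_gt,
      hne hao hak, hbk] <;>
    field_simp <;> ring
  have h0 := hn0 hbo hbk
  by_cases hab : a = b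
  · subst hab
    rcases hc with hc | hc <;>
    simp only [act₁₂, act₁₃, act₂₃, colRF, colRG, colLF, colLG, mixF, mixG, coupM, lt_irrefl,
      if_true, if_false,
      hc, hok, hko, h₁, h₁.not_gt, h₂, h₂.not_gt, hk, hao, hak, Ne.symm hao, Ne.symm hak, ht a hao, (ht a hao).not_gt, ht' a hao,
      (ht' a hao).not_gt, hl a hak, (hl a hak).not_gt, hm a hao hak, (hm a hao hak).not_gt,
      hne hao hak] <;>
    field_simp <;> ring
  rcases hc with hc | hc <;>
  simp only [act₁₂, act₁₃, act₂₃, colRF, colRG, colLF, colLG, mixF, mixG, coupM, lt_irrefl,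
      if_true, if_false,
    hc, hok, hko, h₁, h₁.not_gt, h₂, h₂.not_gt, hk, hao, hak, Ne.symm hao, Ne.symm hak, ht a hao, (ht a hao).not_gt, ht' a hao,
      (ht' a hao).not_gt, hl a hak, (hl a hak).not_gt, hm a hao hak, (hm a hao hak).not_gt,
      hne hao hak, hbo, hbk, Ne.symm hbo, Ne.symm hbk, ht b hbo, (ht b hbo).not_gt, ht' b hbo,
      (ht' b hbo).not_gt, hl b hbk, (hl b hbk).not_gt, hm b hbo hbk, (hm b hbo hbk).not_gt,
      hne hbo hbk, hab, Ne.symm hab, hi a b hak hbk, hi b a hbk hak] <;>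
  field_simp <;> ring

/-- Vertex weights which preserve the pair of labels: the label `sw` either continues to `ne`,
with weight `f sw nw`, or is exchanged with `nw`, with weight `g sw nw`. -/
def pairWt [DecidableEq V] (f g : V → V → K) (nw sw ne se : V) : K :=
  f sw nw * (if ne = sw then 1 else 0) * (if se = nw then 1 else 0) +
    g sw nw * (if ne = nw then 1 else 0) * (if se = sw then 1 else 0)

theorem pairWt_rotate [DecidableEq V] (f g : V → V → K) (nw sw ne se : V) :
    pairWt f g nw sw ne se = pairWt f (fun u v => g v u) se ne sw nw := by
  unfold pairWt
  congr 1
  · by_cases h₁ : ne = sw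
    · by_cases h₂ : se = nw
      · subst h₁ h₂; rfl
      · simp [h₂, Ne.symm h₂]
    · simp [h₁, Ne.symm h₁]
  · by_cases h₁ : ne = nw
    · by_cases h₂ : se = sw
      · subst h₁ h₂; simp
      · simp [h₂, Ne.symm h₂]
    · simp [h₁, Ne.symm h₁]

section Sums

variable [DecidableEq V] [Fintype V]

theorem sum_pairWt₂ (f g : V → V → K) (a b : V) (F : V → V → K) :
    ∑ x, ∑ y, pairWt f g b a x y * F x y = f a b * F a b + g a b * F b a := by
  simp [pairWt, add_mul, Finset.sum_add_distrib, mul_assoc, ← Finset.mul_sum]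

theorem sum_pairWt_ne (f g : V → V → K) (a b w : V) (F : V → K) :
    ∑ x, pairWt f g b a x w * F x =
      f a b * F a * (if w = b then 1 else 0) + g a b * F b * (if w = a then 1 else 0) := by
  simp [pairWt, add_mul, Finset.sum_add_distrib, mul_assoc, ← Finset.mul_sum]

theorem sum_pairWt_se (f g : V → V → K) (a b w : V) (F : V → K) :
    ∑ x, pairWt f g b a w x * F x =
      f a b * F b * (if w = a then 1 else 0) + g a b * F a * (if w = b then 1 else 0) := by
  have h : ∀ x, pairWt f g b a w x * F x =
      (if w = a then f a b else 0) * ((if x = b then 1 else 0) * F x) +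
        (if w = b then g a b else 0) * ((if x = a then 1 else 0) * F x) := fun x => by
    unfold pairWt; split_ifs <;> ring
  simp only [h, Finset.sum_add_distrib, ← Finset.mul_sum]
  simp [mul_comm]

/-- The indicator function of a word. -/
def wordInd (x₀ y₀ z₀ x y z : V) : K :=
  (if x₀ = x then 1 else 0) * (if y₀ = y then 1 else 0) * (if z₀ = z then 1 else 0)

variable (f₁ g₁ f₂ g₂ f₃ g₃ : V → V → K) (a b c x y z : V)

theorem sum_scatter_23_13_12 :
    ∑ s, ∑ t, pairWt f₁ g₁ c b s t *
      ∑ u, pairWt f₂ g₂ t a u z * pairWt f₃ g₃ s u x y =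
    act₂₃ f₁ g₁ (act₁₃ f₂ g₂ (act₁₂ f₃ g₃ (wordInd x y z))) a b c := by
  rw [sum_pairWt₂]
  simp only [sum_pairWt_ne]
  simp only [act₁₂, act₁₃, act₂₃, pairWt, wordInd]
  ring

theorem sum_scatter_12_13_23 :
    ∑ u, ∑ s, pairWt f₁ g₁ b a u s *
      ∑ t, pairWt f₂ g₂ c u x t * pairWt f₃ g₃ t s y z =
    act₁₂ f₁ g₁ (act₁₃ f₂ g₂ (act₂₃ f₃ g₃ (wordInd x y z))) a b c := by
  rw [sum_pairWt₂]
  simp only [sum_pairWt_se]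
  simp only [act₁₂, act₁₃, act₂₃, pairWt, wordInd]
  ring

theorem sum_scatter_13_23_12 :
    ∑ u, ∑ t, pairWt f₁ g₁ c a u t *
      ∑ s, pairWt f₂ g₂ t b s z * pairWt f₃ g₃ s u x y =
    act₁₃ f₁ g₁ (act₂₃ f₂ g₂ (act₁₂ f₃ g₃ (wordInd x y z))) a b c := by
  rw [sum_pairWt₂]
  simp only [sum_pairWt_ne]
  simp only [act₁₂, act₁₃, act₂₃, pairWt, wordInd]
  ring

theorem sum_scatter_12_23_13 :
    ∑ u, ∑ s, pairWt f₁ g₁ b a u s *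
      ∑ t, pairWt f₂ g₂ c s y t * pairWt f₃ g₃ t u x z =
    act₁₂ f₁ g₁ (act₂₃ f₂ g₂ (act₁₃ f₃ g₃ (wordInd x y z))) a b c := by
  rw [sum_pairWt₂]
  simp only [sum_pairWt_se]
  simp only [act₁₂, act₁₃, act₂₃, pairWt, wordInd]
  ring

theorem sum_scatter_13_12_23 :
    ∑ u, ∑ t, pairWt f₁ g₁ c a u t *
      ∑ s, pairWt f₂ g₂ b u x s * pairWt f₃ g₃ t s y z =
    act₁₃ f₁ g₁ (act₁₂ f₂ g₂ (act₂₃ f₃ g₃ (wordInd x y z))) a b c := by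
  rw [sum_pairWt₂]
  simp only [sum_pairWt_se]
  simp only [act₁₂, act₁₃, act₂₃, pairWt, wordInd]
  ring

theorem sum_scatter_23_12_13 :
    ∑ s, ∑ t, pairWt f₁ g₁ c b s t *
      ∑ u, pairWt f₂ g₂ s a u y * pairWt f₃ g₃ t u x z =
    act₂₃ f₁ g₁ (act₁₂ f₂ g₂ (act₁₃ f₃ g₃ (wordInd x y z))) a b c := by
  rw [sum_pairWt₂]
  simp only [sum_pairWt_ne]
  simp only [act₁₂, act₁₃, act₂₃, pairWt, wordInd]
  ring

end Sums


section Entries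

variable {α β γ δ ε ζ η θ κ : Type*} [Fintype α] [Fintype β] [Fintype γ]
  [DecidableEq α] [DecidableEq β] [DecidableEq γ] [DecidableEq δ] [DecidableEq ε] [DecidableEq ζ]

theorem tenSnd_mul_tenFst_mul_tenSnd_apply (A : Matrix (η × ζ) (γ × α) K)
    (B : Matrix (δ × γ) (ε × β) K) (D : Matrix (β × α) (θ × κ) K)
    (x : δ) (y : η) (z : ζ) (a : ε) (b : θ) (c : κ) [Fintype ε] [Fintype δ] :
    (tenSnd (α := δ) A * (tenFst (γ := α) B * tenSnd (α := ε) D)) (x, y, z) (a, b, c) =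
      ∑ s, ∑ t, D (t, s) (b, c) * ∑ u, B (x, u) (a, t) * A (y, z) (u, s) := by
  simp only [Matrix.mul_apply, Fintype.sum_prod_type, tenSnd, tenFst, ite_mul, mul_ite, zero_mul,
    mul_zero, Finset.sum_ite_eq, Finset.sum_ite_eq', Finset.mem_univ, if_true, Finset.sum_const_zero,
    Finset.sum_ite_irrel]
  simp only [Finset.mul_sum]
  rw [Finset.sum_comm]
  refine Finset.sum_congr rfl fun s _ => ?_
  rw [Finset.sum_comm]
  refine Finset.sum_congr rfl fun t _ => Finset.sum_congr rfl fun u _ => ?_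
  ring

theorem tenFst_mul_tenSnd_mul_tenFst_apply (D : Matrix (η × θ) (α × β) K)
    (B : Matrix (β × ζ) (γ × κ) K) (A : Matrix (α × γ) (ε × δ) K)
    (x : η) (y : θ) (z : ζ) (a : ε) (b : δ) (c : κ) [Fintype ζ] [Fintype κ] [DecidableEq κ] :
    (tenFst (γ := ζ) D * (tenSnd (α := α) B * tenFst (γ := κ) A)) (x, y, z) (a, b, c) =
      ∑ u, ∑ s, A (s, u) (a, b) * ∑ t, B (t, z) (u, c) * D (x, y) (s, t) := by
  simp only [Matrix.mul_apply, Fintype.sum_prod_type, tenSnd, tenFst, ite_mul, mul_ite, zero_mul,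
    mul_zero, Finset.sum_ite_eq, Finset.sum_ite_eq', Finset.mem_univ, if_true, Finset.sum_const_zero,
    Finset.sum_ite_irrel]
  simp only [Finset.mul_sum]
  symm
  rw [Finset.sum_comm]
  refine Finset.sum_congr rfl fun s _ => ?_
  rw [Finset.sum_comm]
  refine Finset.sum_congr rfl fun t _ => Finset.sum_congr rfl fun u _ => ?_
  ring

end Entries

section Words

variable [DecidableEq V] [Fintype V]

/-- The matrix of vertex weights which preserve the pair of labels along the flow of the
two lines. -/
def pairMat (f g : V → V → K) : Matrix (V × V) (V × V) K :=
  fun o i => pairWt f g i.2 i.1 o.2 o.1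

/-- The matrix of vertex weights in which the second line is traversed backwards. -/
def cupMat (f g : V → V → K) : Matrix (V × V) (V × V) K :=
  fun o i => pairWt f g o.1 i.1 o.2 i.2

variable (f₁ g₁ f₂ g₂ f₃ g₃ : V → V → K) (x y z a b c : V)

theorem pair_pair_pair_left :
    (tenSnd (α := V) (pairMat f₁ g₁) * (tenFst (γ := V) (pairMat f₂ g₂) *
      tenSnd (α := V) (pairMat f₃ g₃))) (x, y, z) (a, b, c) =
    act₂₃ f₃ g₃ (act₁₃ f₂ g₂ (act₁₂ f₁ g₁ (wordInd z y x))) a b c := by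
  rw [tenSnd_mul_tenFst_mul_tenSnd_apply, ← sum_scatter_23_13_12]
  rfl

theorem pair_pair_pair_right :
    (tenFst (γ := V) (pairMat f₃ g₃) * (tenSnd (α := V) (pairMat f₂ g₂) *
      tenFst (γ := V) (pairMat f₁ g₁))) (x, y, z) (a, b, c) =
    act₁₂ f₁ g₁ (act₁₃ f₂ g₂ (act₂₃ f₃ g₃ (wordInd z y x))) a b c := by
  rw [tenFst_mul_tenSnd_mul_tenFst_apply, ← sum_scatter_12_13_23]
  rfl

theorem pair_cup_cup_left :
    (tenSnd (α := V) (pairMat f₁ g₁) * (tenFst (γ := V) (cupMat f₂ g₂) *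
      tenSnd (α := V) (cupMat f₃ g₃))) (x, y, z) (a, b, c) =
    act₁₃ f₂ g₂ (act₂₃ f₃ g₃ (act₁₂ f₁ g₁ (wordInd z y c))) a b x := by
  rw [tenSnd_mul_tenFst_mul_tenSnd_apply, ← sum_scatter_13_23_12]
  simp only [Finset.mul_sum, pairMat, cupMat]
  symm
  rw [Finset.sum_comm]
  conv_rhs => rw [Finset.sum_comm]
  refine Finset.sum_congr rfl fun t _ => ?_
  rw [Finset.sum_comm]
  refine Finset.sum_congr rfl fun s _ => Finset.sum_congr rfl fun u _ => ?_
  ring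

theorem pair_cup_cup_right :
    (tenFst (γ := V) (cupMat f₃ g₃) * (tenSnd (α := V) (cupMat f₂ g₂) *
      tenFst (γ := V) (pairMat f₁ g₁))) (x, y, z) (a, b, c) =
    act₁₂ f₁ g₁ (act₂₃ f₃ g₃ (act₁₃ f₂ g₂ (wordInd z y c))) a b x := by
  rw [tenFst_mul_tenSnd_mul_tenFst_apply, ← sum_scatter_12_23_13]
  simp only [pairMat, cupMat, mul_comm (pairWt f₂ _ _ _ _ _)]

theorem cup_cup_pair_left :
    (tenSnd (α := V) (cupMat f₁ g₁) * (tenFst (γ := V) (cupMat f₂ g₂) *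
      tenSnd (α := V) (pairMat f₃ g₃))) (x, y, z) (a, b, c) =
    act₁₃ f₂ g₂ (act₁₂ f₁ g₁ (act₂₃ f₃ (fun u v => g₃ v u) (wordInd z b c))) a y x := by
  rw [tenSnd_mul_tenFst_mul_tenSnd_apply, ← sum_scatter_13_12_23]
  simp only [Finset.mul_sum, pairMat, cupMat, pairWt_rotate f₃ g₃]
  symm
  rw [Finset.sum_comm]
  conv_rhs => rw [Finset.sum_comm]
  refine Finset.sum_congr rfl fun t _ => ?_
  rw [Finset.sum_comm]
  refine Finset.sum_congr rfl fun s _ => Finset.sum_congr rfl fun u _ => ?_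
  ring

theorem cup_cup_pair_right :
    (tenFst (γ := V) (pairMat f₃ g₃) * (tenSnd (α := V) (cupMat f₂ g₂) *
      tenFst (γ := V) (cupMat f₁ g₁))) (x, y, z) (a, b, c) =
    act₂₃ f₃ (fun u v => g₃ v u) (act₁₂ f₁ g₁ (act₁₃ f₂ g₂ (wordInd z b c))) a y x := by
  rw [tenFst_mul_tenSnd_mul_tenFst_apply, ← sum_scatter_23_12_13]
  simp only [Finset.mul_sum, pairMat, cupMat, pairWt_rotate f₃ g₃]
  rw [Finset.sum_comm]
  refine Finset.sum_congr rfl fun s _ => ?_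
  rw [Finset.sum_comm]
  refine Finset.sum_congr rfl fun t _ => Finset.sum_congr rfl fun u _ => ?_
  ring

end Words
end Scattering

section Weights

theorem ccond_iff {m i j k : ℕ} (hi : 1 ≤ i) (him : i ≤ m) (hj : 1 ≤ j) (hjm : j ≤ m)
    (hk : 1 ≤ k) (hkm : k ≤ m) : Ccond i j k ↔ colorPos m k i < colorPos m k j := by
  unfold Ccond colorPos
  split_ifs <;> omega

/-- The order `k ≺ k + 1 ≺ ⋯ ≺ m ≺ 1 ≺ ⋯ ≺ k - 1 ≺ 0` on the labels. -/
def colorOrd (m k : ℕ) (a : Fin (m + 1)) : ℤ := colorPos m k a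

theorem colorOrd_injective {m k : ℕ} (hk : 1 ≤ k) (hkm : k ≤ m) :
    Function.Injective (colorOrd m k) := by
  rintro ⟨a, ha⟩ ⟨b, hb⟩ h
  unfold colorOrd colorPos at h
  rw [Fin.mk.injEq]
  dsimp only at h
  split_ifs at h <;> omega

theorem colorOrd_lt_zero {m k : ℕ} (hk : 1 ≤ k) (hkm : k ≤ m) (a : Fin (m + 1)) (ha : a ≠ 0) :
    colorOrd m k a < colorOrd m k 0 := by
  have h : (a : ℕ) ≠ 0 := fun h => ha (Fin.ext h)
  have := a.isLt
  unfold colorOrd colorPos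
  simp only [h, Fin.val_zero, if_true, if_false]
  split_ifs <;> omega

theorem val_eq_iff {m k : ℕ} (hkm : k ≤ m) (a : Fin (m + 1)) :
    (a : ℕ) = k ↔ a = Fin.ofNat (m + 1) k := by
  rw [Fin.ext_iff, Fin.val_ofNat, Nat.mod_eq_of_lt (by omega)]

theorem ofNat_ne_zero {m k : ℕ} (hk : 1 ≤ k) (hkm : k ≤ m) : Fin.ofNat (m + 1) k ≠ 0 := by
  intro h
  have := (val_eq_iff hkm 0).2 h.symm
  rw [Fin.val_zero] at this
  omega

theorem isRotation_colorOrd {m k : ℕ} (hk : 1 ≤ k) (hkm : k ≤ m) :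
    IsRotation (colorOrd m k) (colorOrd m (if k = m then 1 else k + 1)) 0
      (Fin.ofNat (m + 1) k) where
  ne := ofNat_ne_zero hk hkm
  lt_top := colorOrd_lt_zero hk hkm
  lt_top' := colorOrd_lt_zero (by split_ifs <;> omega) (by split_ifs <;> omega)
  bot_lt a h := by
    rw [Ne, ← val_eq_iff hkm] at h
    have := (val_eq_iff hkm _).2 rfl
    have := a.isLt
    unfold colorOrd colorPos
    split_ifs <;> omega
  lt_k a h₀ h := by
    rw [Ne, ← val_eq_iff hkm] at h
    have := (val_eq_iff hkm _).2 rfl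
    have h₀ : (a : ℕ) ≠ 0 := fun h => h₀ (Fin.ext h)
    have := a.isLt
    unfold colorOrd colorPos
    split_ifs <;> omega
  iff a b ha hb := by
    rw [Ne, ← val_eq_iff hkm] at ha hb
    have := a.isLt
    have := b.isLt
    unfold colorOrd colorPos
    split_ifs <;> omega

theorem ccond_iff_colorOrd {m k : ℕ} (hk : 1 ≤ k) (hkm : k ≤ m) {a b : Fin (m + 1)}
    (ha : a ≠ 0) (hb : b ≠ 0) : Ccond a b k ↔ colorOrd m k a < colorOrd m k b := by
  have ha : (a : ℕ) ≠ 0 := fun h => ha (Fin.ext h)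
  have hb : (b : ℕ) ≠ 0 := fun h => hb (Fin.ext h)
  rw [ccond_iff (by omega) (by omega) (by omega) (by omega) hk hkm]
  exact Int.ofNat_lt.symm

/-- The couplings of the colors, on the set of all labels. -/
def coup (m : ℕ) (X : ℕ → ℕ → K) (a b : Fin (m + 1)) : K := X a b

variable {m k : ℕ} (hk : 1 ≤ k) (hkm : k ≤ m) (q Φ : K) (X : ℕ → ℕ → K) (z z' : K)
  (nw sw ne se : Fin (m + 1))

include hk hkm in
theorem wtR_left_left : wtR m q Φ X .L .L z z' k nw sw ne se =
    pairWt (strF (q ^ 2) (coupL (q ^ 2) Φ (coup m X) 0) 0 z z')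
      (strG (q ^ 2) (colorOrd m k) z z') nw sw ne se := by
  have h₁ := fun a => colorOrd_lt_zero hk hkm a
  have h₂ := fun a b => ccond_iff_colorOrd (a := a) (b := b) hk hkm
  unfold wtR pairWt strF strG coupL coup
  grind

include hk hkm in
theorem wtR_right_right : wtR m q Φ X .R .R z z' k nw sw ne se =
    pairWt (strF (q ^ 2) (coupR (q ^ 2) Φ (coup m X) 0) 0 z z')
      (strG (q ^ 2) (colorOrd m k) z' z) nw sw ne se := by
  have h₁ := fun a => colorOrd_lt_zero hk hkm a
  have h₂ := fun a b => ccond_iff_colorOrd (a := a) (b := b) hk hkm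
  unfold wtR pairWt strF strG coupR coup
  grind

include hk hkm in
theorem wtR_left_right : wtR m q Φ X .L .R z z' k nw sw ne se =
    pairWt (mixF (q ^ 2) Φ (coupM Φ (coup m X) 0) 0 z z')
      (mixG (q ^ 2) Φ (colorOrd m k) 0 z z') se sw ne nw := by
  have h₀ : ∀ a b, a ≠ b → colorOrd m k a < colorOrd m k b ∨ colorOrd m k b < colorOrd m k a :=
    fun a b h => lt_or_gt_of_ne ((colorOrd_injective hk hkm).ne h)
  have h₁ := fun a => colorOrd_lt_zero hk hkm a
  have h₂ := fun a b => ccond_iff_colorOrd (a := a) (b := b) hk hkm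
  unfold wtR pairWt mixF mixG coupM coup
  by_cases ne = sw <;> by_cases nw = se <;> grind

/-- The label of a column of color `k` as a label of a row. -/
def colLabel (m k : ℕ) (b : Fin 2) : Fin (m + 1) := if b = 0 then 0 else Fin.ofNat (m + 1) k

include hk hkm in
theorem wtT_right (a c : Fin (m + 1)) (b d : Fin 2) : wtT m q Φ X .R z k a b c d =
    pairWt (colRF Φ (coup m X) 0 (Fin.ofNat (m + 1) k) z)
      (colRG (q ^ 2) Φ 0 (Fin.ofNat (m + 1) k) z)
      (colLabel m k b) a c (colLabel m k d) := by
  have h₀ := ofNat_ne_zero hk hkm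
  have h := (val_eq_iff hkm (Fin.ofNat (m + 1) k)).2 rfl
  unfold wtT pairWt colRF colRG coup colLabel
  simp only [val_eq_iff hkm]
  generalize Fin.ofNat (m + 1) k = κ at *
  subst h
  fin_cases b <;> fin_cases d <;> dsimp only <;> grind

include hk hkm in
theorem wtT_left (a c : Fin (m + 1)) (b d : Fin 2) : wtT m q Φ X .L z k a b c d =
    pairWt (colLF Φ (coup m X) 0 (Fin.ofNat (m + 1) k) z)
      (colLG (q ^ 2) Φ 0 (Fin.ofNat (m + 1) k) z)
      (colLabel m k d) a c (colLabel m k b) := by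
  have h₀ := ofNat_ne_zero hk hkm
  have h := (val_eq_iff hkm (Fin.ofNat (m + 1) k)).2 rfl
  unfold wtT pairWt colLF colLG coup colLabel
  simp only [val_eq_iff hkm]
  generalize Fin.ofNat (m + 1) k = κ at *
  subst h
  fin_cases b <;> fin_cases d <;> dsimp only <;> grind

end Weights

section Equations

/-- The Yang–Baxter equation of three matrices acting on the two-fold tensor products. -/
def YBE {V : Type*} [DecidableEq V] [Fintype V] (A B D : Matrix (V × V) (V × V) K) : Prop :=
  tenSnd (α := V) A * (tenFst (γ := V) B * tenSnd (α := V) D) =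
    tenFst (γ := V) D * (tenSnd (α := V) B * tenFst (γ := V) A)

variable {m k : ℕ} (hk : 1 ≤ k) (hkm : k ≤ m) {q Φ : K} {X : ℕ → ℕ → K}

theorem strG_neg {V : Type*} (Q : K) (p : V → ℤ) (z z' : K) :
    strG Q (fun a => -p a) z z' = strG Q p z' z := by
  ext a b
  simp only [strG, neg_lt_neg_iff]
  split_ifs <;> first | rfl | omega

theorem strG_swap {V : Type*} (Q : K) (p : V → ℤ) (z z' : K) :
    (fun a b => strG Q p z' z b a) = strG Q p z z' := by
  ext a b
  simp only [strG]
  split_ifs <;> first | rfl | omega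

theorem coup_mul_coup
    (hXoff : ∀ i j, 1 ≤ i → i ≤ m → 1 ≤ j → j ≤ m → i ≠ j → X i j * X j i = q ^ 2)
    (a b : Fin (m + 1)) (ha : a ≠ 0) (hb : b ≠ 0) (hab : a ≠ b) :
    coup m X a b * coup m X b a = q ^ 2 := by
  have ha : (a : ℕ) ≠ 0 := fun h => ha (Fin.ext h)
  have hb : (b : ℕ) ≠ 0 := fun h => hb (Fin.ext h)
  exact hXoff a b (by omega) (by omega) (by omega) (by omega) fun h => hab (Fin.ext h)

theorem coupL_mul_coupL (hΦ : Φ ≠ 0)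
    (hXoff : ∀ i j, 1 ≤ i → i ≤ m → 1 ≤ j → j ≤ m → i ≠ j → X i j * X j i = q ^ 2)
    (a b : Fin (m + 1)) (hab : a ≠ b) :
    coupL (q ^ 2) Φ (coup m X) 0 a b * coupL (q ^ 2) Φ (coup m X) 0 b a = q ^ 2 := by
  have := coup_mul_coup hXoff a b
  unfold coupL
  grind

theorem coupR_mul_coupR (hΦ : Φ ≠ 0)
    (hXoff : ∀ i j, 1 ≤ i → i ≤ m → 1 ≤ j → j ≤ m → i ≠ j → X i j * X j i = q ^ 2)
    (a b : Fin (m + 1)) (hab : a ≠ b) :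
    coupR (q ^ 2) Φ (coup m X) 0 a b * coupR (q ^ 2) Φ (coup m X) 0 b a = q ^ 2 := by
  have := coup_mul_coup hXoff a b
  unfold coupR
  grind

include hk hkm

theorem Rmat_left_left (z z' : K) : Rmat m q Φ X .L .L z z' k =
    pairMat (strF (q ^ 2) (coupL (q ^ 2) Φ (coup m X) 0) 0 z z')
      (strG (q ^ 2) (colorOrd m k) z z') :=
  Matrix.ext fun _ _ => wtR_left_left hk hkm ..

theorem Rmat_right_right (z z' : K) : Rmat m q Φ X .R .R z z' k =
    pairMat (strF (q ^ 2) (coupR (q ^ 2) Φ (coup m X) 0) 0 z z')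
      (strG (q ^ 2) (colorOrd m k) z' z) :=
  Matrix.ext fun _ _ => wtR_right_right hk hkm ..

theorem Rmat_left_right (z z' : K) : Rmat m q Φ X .L .R z z' k =
    cupMat (mixF (q ^ 2) Φ (coupM Φ (coup m X) 0) 0 z z')
      (mixG (q ^ 2) Φ (colorOrd m k) 0 z z') :=
  Matrix.ext fun _ _ => wtR_left_right hk hkm ..

variable (hq : q ≠ 0) (hΦ : Φ ≠ 0)
  (hXoff : ∀ i j, 1 ≤ i → i ≤ m → 1 ≤ j → j ≤ m → i ≠ j → X i j * X j i = q ^ 2)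
  (z₁ z₂ z₃ : K)
include hq hΦ hXoff

theorem ybe_left_left_left : YBE (Rmat m q Φ X .L .L z₁ z₂ k) (Rmat m q Φ X .L .L z₁ z₃ k)
    (Rmat m q Φ X .L .L z₂ z₃ k) := by
  simp only [Rmat_left_left hk hkm]
  refine Matrix.ext fun ⟨x, y, z⟩ ⟨a, b, c⟩ => ?_
  rw [pair_pair_pair_left, pair_pair_pair_right]
  exact act_straight _ (pow_ne_zero 2 hq) _ (coupL_mul_coupL hΦ hXoff) _ _
    (colorOrd_injective hk hkm) ..

theorem ybe_right_right_right : YBE (Rmat m q Φ X .R .R z₁ z₂ k) (Rmat m q Φ X .R .R z₁ z₃ k)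
    (Rmat m q Φ X .R .R z₂ z₃ k) := by
  simp only [Rmat_right_right hk hkm, ← strG_neg _ (colorOrd m k)]
  refine Matrix.ext fun ⟨x, y, z⟩ ⟨a, b, c⟩ => ?_
  rw [pair_pair_pair_left, pair_pair_pair_right]
  exact act_straight _ (pow_ne_zero 2 hq) _ (coupR_mul_coupR hΦ hXoff) _ _
    (neg_injective.comp (colorOrd_injective hk hkm)) ..

theorem ybe_left_left_right : YBE (Rmat m q Φ X .L .L z₁ z₂ k) (Rmat m q Φ X .L .R z₁ z₃ k)
    (Rmat m q Φ X .L .R z₂ z₃ k) := by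
  simp only [Rmat_left_left hk hkm, Rmat_left_right hk hkm]
  refine Matrix.ext fun ⟨x, y, z⟩ ⟨a, b, c⟩ => ?_
  rw [pair_cup_cup_left, pair_cup_cup_right]
  exact act_mixed_left _ _ (pow_ne_zero 2 hq) hΦ _ _ (coup_mul_coup hXoff) _
    (colorOrd_injective hk hkm) (colorOrd_lt_zero hk hkm) ..

theorem ybe_left_right_right : YBE (Rmat m q Φ X .L .R z₁ z₂ k) (Rmat m q Φ X .L .R z₁ z₃ k)
    (Rmat m q Φ X .R .R z₂ z₃ k) := by
  simp only [Rmat_right_right hk hkm, Rmat_left_right hk hkm]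
  refine Matrix.ext fun ⟨x, y, z⟩ ⟨a, b, c⟩ => ?_
  rw [cup_cup_pair_left, cup_cup_pair_right, strG_swap]
  exact act_mixed_right _ _ (pow_ne_zero 2 hq) hΦ _ _ (coup_mul_coup hXoff) _
    (colorOrd_injective hk hkm) (colorOrd_lt_zero hk hkm) ..

end Equations

section ColumnEquations

/-- The Yang–Baxter equation of two row crossings and two column crossings. -/
def RTT {V : Type*} [DecidableEq V] [Fintype V] (R' R : Matrix (V × V) (V × V) K)
    (S T : Matrix (Fin 2 × V) (V × Fin 2) K) : Prop :=
  tenSnd (α := Fin 2) R' * (tenFst (γ := V) S * tenSnd (α := V) T) =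
    tenFst (γ := V) T * (tenSnd (α := V) S * tenFst (γ := Fin 2) R)

theorem sum_colLabel {m k : ℕ} (hk : 1 ≤ k) (hkm : k ≤ m) (F : Fin (m + 1) → K)
    (hF : ∀ v, v ≠ 0 → v ≠ Fin.ofNat (m + 1) k → F v = 0) :
    ∑ v, F v = ∑ t, F (colLabel m k t) := by
  rw [Fin.sum_univ_two, ← Finset.sum_subset (Finset.subset_univ {0, Fin.ofNat (m + 1) k}),
    Finset.sum_pair (ofNat_ne_zero hk hkm).symm]
  · rfl
  · intro v _ hv
    simp only [Finset.mem_insert, Finset.mem_singleton, not_or] at hv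
    exact hF v hv.1 hv.2

theorem colLabel_eq_or {m k : ℕ} (b : Fin 2) :
    colLabel m k b = 0 ∨ colLabel m k b = Fin.ofNat (m + 1) k := by
  unfold colLabel
  split_ifs <;> simp

/-- A matrix of weights on all labels extends the weights of the column of color `k`. -/
structure IsColumnExt (m k : ℕ) (T : Matrix (Fin 2 × Fin (m + 1)) (Fin (m + 1) × Fin 2) K)
    (T' : Matrix (Fin (m + 1) × Fin (m + 1)) (Fin (m + 1) × Fin (m + 1)) K) : Prop where
  apply_eq : ∀ d c a b, T (d, c) (a, b) = T' (colLabel m k d, c) (a, colLabel m k b)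
  eq_zero : ∀ d c a b, d ≠ 0 → d ≠ Fin.ofNat (m + 1) k → T' (d, c) (a, colLabel m k b) = 0

variable {m k : ℕ} (hk : 1 ≤ k) (hkm : k ≤ m) {q Φ : K} {X : ℕ → ℕ → K}

include hk hkm in
theorem rtt_of_forall {R' R : Matrix (Fin (m + 1) × Fin (m + 1)) (Fin (m + 1) × Fin (m + 1)) K}
    {S T : Matrix (Fin 2 × Fin (m + 1)) (Fin (m + 1) × Fin 2) K}
    {S' T' : Matrix (Fin (m + 1) × Fin (m + 1)) (Fin (m + 1) × Fin (m + 1)) K}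
    (hS : IsColumnExt m k S S') (hT : IsColumnExt m k T T')
    (h : ∀ (x c : Fin 2) (y z a b : Fin (m + 1)),
      (tenSnd (α := Fin (m + 1)) R' * (tenFst (γ := Fin (m + 1)) S' *
        tenSnd (α := Fin (m + 1)) T')) (colLabel m k x, y, z) (a, b, colLabel m k c) =
      (tenFst (γ := Fin (m + 1)) T' * (tenSnd (α := Fin (m + 1)) S' *
        tenFst (γ := Fin (m + 1)) R)) (colLabel m k x, y, z) (a, b, colLabel m k c)) :
    RTT R' R S T := by
  refine Matrix.ext fun ⟨x, y, z⟩ ⟨a, b, c⟩ => ?_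
  have := h x c y z a b
  rw [tenSnd_mul_tenFst_mul_tenSnd_apply, tenFst_mul_tenSnd_mul_tenFst_apply] at this ⊢
  have h₁ : ∀ s, ∑ t, T (t, s) (b, c) * ∑ u, S (x, u) (a, t) * R' (y, z) (u, s) =
      ∑ t, T' (t, s) (b, colLabel m k c) *
        ∑ u, S' (colLabel m k x, u) (a, t) * R' (y, z) (u, s) := fun s => by
    rw [sum_colLabel hk hkm (fun t => T' (t, s) (b, colLabel m k c) *
      ∑ u, S' (colLabel m k x, u) (a, t) * R' (y, z) (u, s))
      fun v h₀ h => by rw [hT.eq_zero v s b c h₀ h, zero_mul]]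
    simp only [hS.apply_eq, hT.apply_eq]
  have h₂ : ∀ u s, ∑ t, S (t, z) (u, c) * T (x, y) (s, t) =
      ∑ t, S' (t, z) (u, colLabel m k c) * T' (colLabel m k x, y) (s, t) := fun u s => by
    rw [sum_colLabel hk hkm (fun t => S' (t, z) (u, colLabel m k c) *
      T' (colLabel m k x, y) (s, t)) fun v h₀ h => by rw [hS.eq_zero v z u c h₀ h, zero_mul]]
    simp only [hS.apply_eq, hT.apply_eq]
  simp only [h₁, h₂, this]

include hk hkm

theorem isColumnExt_right (z : K) : IsColumnExt m k (Tmat m q Φ X .R z k)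
    (pairMat (colRF Φ (coup m X) 0 (Fin.ofNat (m + 1) k) z)
      (colRG (q ^ 2) Φ 0 (Fin.ofNat (m + 1) k) z)) where
  apply_eq _ _ _ _ := wtT_right hk hkm ..
  eq_zero d c a b h₀ h := by
    have := colLabel_eq_or (m := m) (k := k) b
    simp only [pairMat, pairWt, colRG]
    grind

theorem isColumnExt_left (z : K) : IsColumnExt m k (Tmat m q Φ X .L z k)
    (cupMat (colLF Φ (coup m X) 0 (Fin.ofNat (m + 1) k) z)
      (colLG (q ^ 2) Φ 0 (Fin.ofNat (m + 1) k) z)) where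
  apply_eq _ _ _ _ := wtT_left hk hkm ..
  eq_zero d c a b h₀ h := by
    have := colLabel_eq_or (m := m) (k := k) b
    simp only [cupMat, pairWt, colLG]
    grind

variable (hq : q ≠ 0) (hΦ : Φ ≠ 0)
  (hXdiag : ∀ i, 1 ≤ i → i ≤ m → X i i = -(q ^ 2))
  (hXoff : ∀ i j, 1 ≤ i → i ≤ m → 1 ≤ j → j ≤ m → i ≠ j → X i j * X j i = q ^ 2)
  {z₁ z₂ : K}
include hXdiag

theorem coup_self : coup m X (Fin.ofNat (m + 1) k) (Fin.ofNat (m + 1) k) = -q ^ 2 := by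
  rw [coup, (val_eq_iff hkm _).2 rfl, hXdiag k hk hkm]

include hq hΦ hXoff

theorem rtt_right_right :
    RTT (Rmat m q Φ X .R .R z₁ z₂ (if k = m then 1 else k + 1)) (Rmat m q Φ X .R .R z₁ z₂ k)
      (Tmat m q Φ X .R z₁ k) (Tmat m q Φ X .R z₂ k) := by
  refine rtt_of_forall hk hkm (isColumnExt_right hk hkm _) (isColumnExt_right hk hkm _) ?_
  intro x c y z a b
  rw [Rmat_right_right (by split_ifs <;> omega) (by split_ifs <;> omega),
    Rmat_right_right hk hkm, pair_pair_pair_left, pair_pair_pair_right]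
  exact act_column_right _ _ (pow_ne_zero 2 hq) hΦ _ _ _ (coup_mul_coup hXoff)
    (coup_self hk hkm hXdiag) _ _ (isRotation_colorOrd hk hkm) _ _ _ _ _ _ (colLabel_eq_or c)

theorem rtt_left_left (hz₁ : z₁ ≠ 0) (hz₂ : z₂ ≠ 0) :
    RTT (Rmat m q Φ X .L .L z₁ z₂ (if k = m then 1 else k + 1)) (Rmat m q Φ X .L .L z₁ z₂ k)
      (Tmat m q Φ X .L z₁ k) (Tmat m q Φ X .L z₂ k) := by
  refine rtt_of_forall hk hkm (isColumnExt_left hk hkm _) (isColumnExt_left hk hkm _) ?_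
  intro x c y z a b
  rw [Rmat_left_left (by split_ifs <;> omega) (by split_ifs <;> omega),
    Rmat_left_left hk hkm, pair_cup_cup_left, pair_cup_cup_right]
  exact act_column_left _ _ (pow_ne_zero 2 hq) hΦ _ _ _ (coup_mul_coup hXoff)
    (coup_self hk hkm hXdiag) _ _ (isRotation_colorOrd hk hkm) _ _ hz₁ hz₂ _ _ _ _
    (colLabel_eq_or x)

theorem rtt_left_right (hz₁ : z₁ ≠ 0) :
    RTT (Rmat m q Φ X .L .R z₁ z₂ (if k = m then 1 else k + 1)) (Rmat m q Φ X .L .R z₁ z₂ k)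
      (Tmat m q Φ X .L z₁ k) (Tmat m q Φ X .R z₂ k) := by
  refine rtt_of_forall hk hkm (isColumnExt_left hk hkm _) (isColumnExt_right hk hkm _) ?_
  intro x c y z a b
  rw [Rmat_left_right (by split_ifs <;> omega) (by split_ifs <;> omega),
    Rmat_left_right hk hkm, cup_cup_pair_left, cup_cup_pair_right]
  exact act_column_mixed _ _ (pow_ne_zero 2 hq) hΦ _ _ _ (coup_mul_coup hXoff)
    (coup_self hk hkm hXdiag) _ _ (isRotation_colorOrd hk hkm) _ _ hz₁ _ _ _ _
    (colLabel_eq_or x)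

end ColumnEquations

section Inversion

variable {V : Type*} [DecidableEq V]

/-- The function of `n` with the constant values `a₁`, `a₂`, `a₃` for `n < α`, `n = α`, `α < n`. -/
def step (α : ℕ) (a₁ a₂ a₃ : K) (n : ℕ) : K := if n < α then a₁ else if n = α then a₂ else a₃

theorem sum_step_mul_pow (Q a₁ a₂ a₃ : K) {α M : ℕ} (hα : α < M) :
    ∑ n ∈ Finset.range M, step α ((1 - Q) * a₁) a₂ ((1 - Q) * a₃) n * Q ^ n =
      a₁ * (1 - Q ^ α) + a₂ * Q ^ α + a₃ * (Q ^ (α + 1) - Q ^ M) := by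
  induction M, hα using Nat.le_induction with
  | base =>
    have h : ∑ n ∈ Finset.range α, step α ((1 - Q) * a₁) a₂ ((1 - Q) * a₃) n * Q ^ n =
        a₁ * (1 - Q ^ α) := by
      rw [← mul_neg_geom_sum, Finset.mul_sum, Finset.mul_sum]
      refine Finset.sum_congr rfl fun n hn => ?_
      rw [step, if_pos (Finset.mem_range.1 hn)]
      ring
    rw [Finset.sum_range_succ, h, step, if_neg (lt_irrefl _), if_pos rfl, Nat.succ_eq_add_one]
    ring
  | succ M hM ih =>
    rw [Finset.sum_range_succ, ih, step, if_neg (by omega), if_neg (by omega)]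
    ring

theorem sum_step_mul_step_mul_pow_of_lt (Q a₁ a₂ a₃ b₁ b₂ b₃ : K) {α β M : ℕ} (h : α < β)
    (hβ : β < M) :
    ∑ n ∈ Finset.range M, step α ((1 - Q) * a₁) a₂ ((1 - Q) * a₃) n *
        step β ((1 - Q) * b₁) b₂ ((1 - Q) * b₃) n * Q ^ n =
      (1 - Q) * (a₁ * b₁ * (1 - Q ^ α) + a₂ * b₁ * Q ^ α + a₃ * b₁ * (Q ^ (α + 1) - Q ^ β) +
        a₃ * b₂ * Q ^ β + a₃ * b₃ * (Q ^ (β + 1) - Q ^ M)) := by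
  have e (n : ℕ) : step α ((1 - Q) * a₁) a₂ ((1 - Q) * a₃) n *
        step β ((1 - Q) * b₁) b₂ ((1 - Q) * b₃) n * Q ^ n =
      (1 - Q) * (step α ((1 - Q) * (a₁ * b₁ - a₃ * b₁)) (a₂ * b₁ - (1 - Q) * (a₃ * b₁))
          ((1 - Q) * 0) n * Q ^ n +
        step β ((1 - Q) * (a₃ * b₁)) (a₃ * b₂) ((1 - Q) * (a₃ * b₃)) n * Q ^ n) := by
    unfold step
    split_ifs <;> first | omega | ring
  simp only [e, ← Finset.mul_sum, Finset.sum_add_distrib, sum_step_mul_pow _ _ _ _ hβ,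
    sum_step_mul_pow _ _ _ _ (h.trans hβ)]
  ring

theorem sum_step_mul_step_mul_pow (Q a₁ a₂ a₃ b₁ b₂ b₃ : K) {α M : ℕ} (hα : α < M) :
    ∑ n ∈ Finset.range M, step α ((1 - Q) * a₁) a₂ ((1 - Q) * a₃) n *
        step α ((1 - Q) * b₁) b₂ ((1 - Q) * b₃) n * Q ^ n =
      (1 - Q) * a₁ * b₁ * (1 - Q ^ α) + a₂ * b₂ * Q ^ α +
        (1 - Q) * a₃ * b₃ * (Q ^ (α + 1) - Q ^ M) := by
  have e (n : ℕ) : step α ((1 - Q) * a₁) a₂ ((1 - Q) * a₃) n *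
        step α ((1 - Q) * b₁) b₂ ((1 - Q) * b₃) n * Q ^ n =
      step α ((1 - Q) * ((1 - Q) * a₁ * b₁)) (a₂ * b₂) ((1 - Q) * ((1 - Q) * a₃ * b₃)) n *
        Q ^ n := by
    unfold step
    split_ifs <;> ring
  simp only [e, sum_step_mul_pow _ _ _ _ hα]

/-- Crossing weight of a right-moving and a left-moving line, for `M` colors. -/
def dualF (Q Φ : K) (x : V → V → K) (o : V) (M : ℕ) (z z' : K) (a b : V) : K :=
  if a = b then (if a = o then z' - Q ^ (M + 1) * z else (Q ^ M / Q * z - z') / Φ ^ 2)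
  else (if a = o then Φ⁻¹ else if b = o then Φ⁻¹ else x b a / (Q * Φ ^ 2)) * (z' - Q ^ M * z)

/-- Exchange weight of a right-moving and a left-moving line, for `M` colors. -/
def dualG (Q Φ : K) (p : V → ℕ) (o : V) (M : ℕ) (z z' : K) (a b : V) : K :=
  if a = b then 0
  else if a = o then Q ^ M / Q ^ (p b + 1) * (1 - Q) * z' / Φ
  else if b = o then Q ^ p a * (1 - Q) * z / Φ
  else if p a < p b then Q ^ M * Q ^ p a / Q ^ (p b + 1) * (1 - Q) * z / Φ ^ 2
  else Q ^ p a / Q ^ (p b + 1) * (1 - Q) * z' / Φ ^ 2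

/-- The weight for passing from a pair of labels `a` to a pair of labels `b`. -/
def pairDiag (f g : V → V → K) (a b : V) : K := if a = b then f a a else g a b

variable [Fintype V]

theorem cupMat_mul_cupMat (f g f' g' : V → V → K) (c : K)
    (hg : ∀ a, g a a = 0) (hg' : ∀ a, g' a a = 0)
    (hf : ∀ a b, a ≠ b → f' b a * f a b = c)
    (h : ∀ a b, ∑ u, pairDiag f g a u * pairDiag f' g' u b = if a = b then c else 0) :
    cupMat f' g' * cupMat f g = c • (1 : Matrix (V × V) (V × V) K) := by
  refine Matrix.ext fun ⟨y, x⟩ ⟨a, b⟩ => ?_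
  have h := h a y
  have e (u : V) : pairDiag f g a u * pairDiag f' g' u y =
      (if a = u then 1 else 0) * (f a a * pairDiag f' g' a y) +
        ((if u = y then 1 else 0) * (g a y * f' y y) + g a u * g' u y) := by
    unfold pairDiag
    have := hg a
    have := hg' y
    split_ifs <;> grind
  simp only [e, Finset.sum_add_distrib, ite_mul, one_mul, zero_mul, Finset.sum_ite_eq,
    Finset.sum_ite_eq', Finset.mem_univ, if_true] at h
  simp only [Matrix.mul_apply, Fintype.sum_prod_type, cupMat, sum_pairWt_se, Matrix.smul_apply,
    Matrix.one_apply, smul_eq_mul, Prod.mk.injEq]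
  have e' (u : V) : pairWt f g u a u b =
      (if b = a then 1 else 0) * ((if a = u then 1 else 0) * f a a + g a u) := by
    unfold pairWt
    by_cases h₁ : b = a
    · subst h₁
      by_cases h₂ : b = u
      · subst h₂
        simp
      · simp [h₂, Ne.symm h₂]
    · by_cases h₂ : a = u
      · subst h₂
        simp [h₁]
      · simp [h₁, Ne.symm h₂]
  have e'' (u : V) : f' u y * pairWt f g u a y b * (if x = u then 1 else 0) +
      g' u y * pairWt f g u a u b * (if x = y then 1 else 0) =
      (if x = u then f' u y * pairWt f g u a y b else 0) +
        (if x = y then 1 else 0) * (if b = a then 1 else 0) *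
          ((if a = u then 1 else 0) * (g' u y * f a a) + g a u * g' u y) := by
    rw [e', mul_ite, mul_one, mul_zero]
    ring
  simp only [e'', Finset.sum_add_distrib, ← Finset.mul_sum]
  simp only [ite_mul, one_mul, zero_mul,
    Finset.sum_ite_eq, Finset.mem_univ, if_true]
  unfold pairDiag at h
  unfold pairWt
  by_cases hxy : x = y
  · subst hxy
    by_cases hba : b = a
    · subst hba
      by_cases hbx : b = x
      · subst hbx
        simp only [hg, hg', if_true] at h ⊢
        simp only [and_self, if_true]
        linear_combination h
      · simp only [hbx, Ne.symm hbx, if_false, if_true] at h ⊢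
        simp only [false_and, if_false]
        linear_combination h
    · simp only [hba, if_false]
      by_cases hbx : b = x
      · subst hbx
        simp [hba]
      · simp [hbx, Ne.symm hbx]
  · by_cases hya : y = a
    · subst hya
      by_cases hbx : b = x
      · subst hbx
        simp [hxy, Ne.symm hxy, hf y b (Ne.symm hxy)]
      · simp [hxy, Ne.symm hxy, hbx, Ne.symm hbx]
    · simp [hxy, Ne.symm hxy, hya]

omit [DecidableEq V] in
theorem sum_eq_add_sum_range (o : V) (p : V → ℕ) (hp : Function.Injective p)
    (hpo : ∀ a, a ≠ o → p a < p o) (hcard : Fintype.card V = p o + 1) (F : V → K) (G : ℕ → K)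
    (hG : ∀ a, a ≠ o → F a = G (p a)) : ∑ a, F a = F o + ∑ n ∈ Finset.range (p o), G n := by
  classical
  have h : Finset.range (p o) = (Finset.univ.erase o).image p := by
    refine (Finset.eq_of_subset_of_card_le (fun n hn => ?_) ?_).symm
    · obtain ⟨a, ha, rfl⟩ := Finset.mem_image.1 hn
      exact Finset.mem_range.2 (hpo a (Finset.ne_of_mem_erase ha))
    · rw [Finset.card_image_of_injective _ hp, Finset.card_erase_of_mem (Finset.mem_univ o),
        Finset.card_univ, hcard, Finset.card_range, Nat.add_sub_cancel]
  rw [h, Finset.sum_image hp.injOn, ← Finset.add_sum_erase _ _ (Finset.mem_univ o)]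
  exact congrArg _ (Finset.sum_congr rfl fun a ha => hG a (Finset.ne_of_mem_erase ha))

theorem sum_pairDiag_mul (Q Φ : K) (hQ : Q ≠ 0) (hΦ : Φ ≠ 0) (x : V → V → K) (o : V) (p : V → ℕ)
    (hp : Function.Injective p) (hpo : ∀ a, a ≠ o → p a < p o)
    (hcard : Fintype.card V = p o + 1) (z z' : K) (a d : V) :
    ∑ u, pairDiag (mixF Q Φ (coupM Φ x o) o z' z) (mixG Q Φ (fun a => (p a : ℤ)) o z' z) a u *
        pairDiag (dualF Q Φ x o (p o) z z') (dualG Q Φ p o (p o) z z') u d =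
      if a = d then (z' - Q * z) * (z' - Q ^ p o * z) else 0 := by
  have hlt {a b : V} : (p a : ℤ) < p b ↔ p a < p b := Int.ofNat_lt
  have hne {a b : V} (h : a ≠ b) : p a ≠ p b := hp.ne h
  have hQ' (n : ℕ) : Q ^ n ≠ 0 := pow_ne_zero n hQ
  have left (ha : a ≠ o) (u : V) (hu : u ≠ o) :
      pairDiag (mixF Q Φ (coupM Φ x o) o z' z) (mixG Q Φ (fun a => (p a : ℤ)) o z' z) a u =
      Φ ^ 2 * step (p a) ((1 - Q) * (-z')) (Q ^ 2 * z - z') ((1 - Q) * (-(Q * z))) (p u) := by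
    simp only [pairDiag, mixF, mixG, step, hlt, ha, hu]
    by_cases h : a = u
    · subst h
      simp
    · have := hne h
      simp only [h, if_false, if_true, this.symm]
      split_ifs <;> first | omega | ring
  have left_top (ha : a = o) (u : V) (hu : u ≠ o) :
      pairDiag (mixF Q Φ (coupM Φ x o) o z' z) (mixG Q Φ (fun a => (p a : ℤ)) o z' z) a u =
      Φ * (1 - Q) * z' := by
    subst ha
    simp [pairDiag, mixG, hu.symm]
  have right (hd : d ≠ o) (u : V) (hu : u ≠ o) :
      pairDiag (dualF Q Φ x o (p o) z z') (dualG Q Φ p o (p o) z z') u d =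
      step (p d) ((1 - Q) * (Q ^ p o * z)) (Q ^ p o * z - Q * z') ((1 - Q) * z') (p u) *
        Q ^ p u / (Φ ^ 2 * Q ^ (p d + 1)) := by
    simp only [pairDiag, dualF, dualG, step, hd, hu]
    by_cases h : u = d
    · subst h
      simp only [if_true, if_false, lt_irrefl, hu]
      field_simp [hQ' (p u)]
      ring
    · have := hne h
      simp only [h, if_false, this]
      split_ifs <;> field_simp [hQ' (p d)]
  have right_top (hd : d = o) (u : V) (hu : u ≠ o) :
      pairDiag (dualF Q Φ x o (p o) z z') (dualG Q Φ p o (p o) z z') u d =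
      Q ^ p u * (1 - Q) * z / Φ := by
    subst hd
    simp [pairDiag, dualG, hu]
  have hFo : pairDiag (mixF Q Φ (coupM Φ x o) o z' z) (mixG Q Φ (fun a => (p a : ℤ)) o z' z) a o =
      if a = o then z' - z else Φ * (1 - Q) * z := by
    by_cases h : a = o
    · subst h
      simp [pairDiag, mixF]
    · simp [pairDiag, mixG, h]
  have hFo' : pairDiag (dualF Q Φ x o (p o) z z') (dualG Q Φ p o (p o) z z') o d =
      if d = o then z' - Q ^ (p o + 1) * z else
        Q ^ p o / Q ^ (p d + 1) * (1 - Q) * z' / Φ := by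
    by_cases h : d = o
    · subst h
      simp [pairDiag, dualF]
    · simp [pairDiag, dualG, h, Ne.symm h]
  by_cases ha : a = o <;> by_cases hd : d = o
  · rw [sum_eq_add_sum_range o p hp hpo hcard _
      (fun n => z' * z * (1 - Q) * ((1 - Q) * Q ^ n)) fun u hu => by
        rw [left_top ha u hu, right_top hd u hu]; field_simp, hFo, hFo', if_pos ha, if_pos hd,
      if_pos (ha.trans hd.symm), ← Finset.mul_sum, ← Finset.mul_sum, mul_neg_geom_sum]
    ring
  · rw [sum_eq_add_sum_range o p hp hpo hcard _
      (fun n => (1 - Q) * z' / (Φ * Q ^ (p d + 1)) * (step (p d) ((1 - Q) * (Q ^ p o * z))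
        (Q ^ p o * z - Q * z') ((1 - Q) * z') n * Q ^ n)) fun u hu => by
        rw [left_top ha u hu, right hd u hu]; field_simp [hQ' (p d)], hFo, hFo', if_pos ha,
      if_neg hd, if_neg (fun h => hd (h.symm.trans ha)), ← Finset.mul_sum,
      sum_step_mul_pow _ _ _ _ (hpo d hd)]
    field_simp [hQ' (p d)]
    ring
  · rw [sum_eq_add_sum_range o p hp hpo hcard _
      (fun n => Φ * (1 - Q) * z * (step (p a) ((1 - Q) * (-z')) (Q ^ 2 * z - z')
        ((1 - Q) * (-(Q * z))) n * Q ^ n)) fun u hu => by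
        rw [left ha u hu, right_top hd u hu]; field_simp, hFo, hFo', if_neg ha,
      if_pos hd, if_neg (fun h => ha (h.trans hd)), ← Finset.mul_sum,
      sum_step_mul_pow _ _ _ _ (hpo a ha)]
    ring
  · rw [sum_eq_add_sum_range o p hp hpo hcard _
      (fun n => 1 / Q ^ (p d + 1) * (step (p a) ((1 - Q) * (-z')) (Q ^ 2 * z - z')
        ((1 - Q) * (-(Q * z))) n * step (p d) ((1 - Q) * (Q ^ p o * z)) (Q ^ p o * z - Q * z')
        ((1 - Q) * z') n * Q ^ n)) fun u hu => by
        rw [left ha u hu, right hd u hu]; field_simp [hQ' (p d)], hFo, hFo', if_neg ha,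
      if_neg hd, ← Finset.mul_sum]
    rcases lt_trichotomy (p a) (p d) with h | h | h
    · rw [sum_step_mul_step_mul_pow_of_lt _ _ _ _ _ _ _ h (hpo d hd),
        if_neg (fun e => h.ne (congrArg p e))]
      field_simp [hQ' (p d)]
      ring
    · obtain rfl := hp h
      rw [sum_step_mul_step_mul_pow _ _ _ _ _ _ _ (hpo a ha), if_pos rfl]
      field_simp [hQ' (p a)]
      ring
    · simp only [mul_comm (step (p a) _ _ _ _)]
      rw [sum_step_mul_step_mul_pow_of_lt _ _ _ _ _ _ _ h (hpo a ha),
        if_neg (fun e => h.ne (congrArg p e.symm))]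
      field_simp [hQ' (p d)]
      ring

end Inversion

section Duality

theorem resLo_eq {m : ℕ} {x : ℤ} (r t : ℤ) (hr : 0 ≤ r) (hrm : r < m) (hx : x = r + m * t) :
    resLo m x = r := by
  rw [resLo, hx, Int.add_mul_emod_self_left, Int.emod_eq_of_lt hr hrm]

theorem resLo_sub_color {m k a : ℕ} (hk : 1 ≤ k) (hkm : k ≤ m) (ha : a ≠ 0) (ham : a ≤ m) :
    resLo m (a - k) = colorPos m k a := by
  unfold colorPos
  rw [if_neg ha]
  split_ifs
  · exact resLo_eq _ 0 (by omega) (by omega) (by omega)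
  · exact resLo_eq _ (-1) (by omega) (by omega) (by omega)

theorem resHi_sub_color {m k a : ℕ} (hk : 1 ≤ k) (hkm : k ≤ m) (ha : a ≠ 0) (ham : a ≤ m) :
    resHi m (k - a) = m - colorPos m k a := by
  have h : resLo m (k - a - 1) = m - colorPos m k a - 1 := by
    unfold colorPos
    rw [if_neg ha]
    split_ifs
    · exact resLo_eq _ (-1) (by omega) (by omega) (by omega)
    · exact resLo_eq _ 0 (by omega) (by omega) (by omega)
  rw [resLo] at h
  rw [resHi, h]
  ring

theorem resLo_sub {m k a b : ℕ} (hk : 1 ≤ k) (hkm : k ≤ m) (ha : a ≠ 0) (ham : a ≤ m)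
    (hb : b ≠ 0) (hbm : b ≤ m) :
    resLo m (a - b) =
      colorPos m k a - colorPos m k b + if colorPos m k a < colorPos m k b then (m : ℤ) else 0 := by
  have h : ∀ c, c ≠ 0 → c ≤ m → colorPos m k c < m ∧
      ((colorPos m k c : ℤ) = c - k ∨ (colorPos m k c : ℤ) = c - k + m) := by
    intro c hc hcm
    unfold colorPos
    rw [if_neg hc]
    split_ifs <;> omega
  obtain ⟨ha', ha⟩ := h a ha ham
  obtain ⟨hb', hb⟩ := h b hb hbm
  have key (t : ℤ) := resLo_eq (m := m) (x := a - b) (colorPos m k a - colorPos m k b +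
    if colorPos m k a < colorPos m k b then (m : ℤ) else 0) t (by split_ifs <;> omega)
    (by split_ifs <;> omega)
  rcases ha with ha | ha <;> rcases hb with hb | hb <;>
    by_cases h : colorPos m k a < colorPos m k b <;> simp only [h, if_true, if_false] at key ⊢ <;>
    first
    | exact key 0 (by omega)
    | exact key 1 (by omega)
    | exact key (-1) (by omega)

variable {m k : ℕ} (hk : 1 ≤ k) (hkm : k ≤ m) {q Φ : K} {X : ℕ → ℕ → K}

include hk hkm in
theorem wtR_right_left (hq : q ≠ 0) (z z' : K) (nw sw ne se : Fin (m + 1)) :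
    wtR m q Φ X .R .L z z' k nw sw ne se =
    pairWt (dualF (q ^ 2) Φ (coup m X) 0 m z z')
      (dualG (q ^ 2) Φ (fun a => colorPos m k a) 0 m z z') se sw ne nw := by
  have hQ : q ^ 2 ≠ 0 := pow_ne_zero 2 hq
  have hv {a : Fin (m + 1)} : (a : ℕ) ≠ 0 ↔ a ≠ 0 := by rw [Ne, Ne, Fin.ext_iff, Fin.val_zero]
  have hle (a : Fin (m + 1)) : (a : ℕ) ≤ m := Nat.le_of_lt_succ a.2
  have e₁ : q ^ (2 * m + 2) = (q ^ 2) ^ (m + 1) := by rw [← pow_mul]; rfl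
  have e₂ : q ^ (2 * m) = (q ^ 2) ^ m := pow_mul ..
  have e₃ : q ^ (2 * m - 2) = (q ^ 2) ^ m / q ^ 2 := by
    rw [eq_div_iff hQ, ← pow_add, ← pow_mul]; congr 1; omega
  have e₄ (x : ℤ) : q ^ (2 * x) = (q ^ 2) ^ x := by rw [_root_.zpow_mul]; norm_cast
  have e₅ (x : ℤ) : q ^ (2 * x - 2) = (q ^ 2) ^ x / q ^ 2 := by
    rw [zpow_sub₀ hq, e₄]; norm_cast
  have h₁ (a : Fin (m + 1)) (ha : a ≠ 0) : q ^ (2 * resHi m ((k : ℤ) - ((a : ℕ) : ℤ)) - 2) =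
      (q ^ 2) ^ m / (q ^ 2) ^ (colorPos m k a + 1) := by
    rw [resHi_sub_color hk hkm (hv.2 ha) (hle a), e₅, zpow_sub₀ hQ, zpow_natCast, zpow_natCast,
      pow_succ (q ^ 2), div_div]
  have h₂ (a : Fin (m + 1)) (ha : a ≠ 0) : q ^ (2 * resLo m (((a : ℕ) : ℤ) - (k : ℤ))) =
      (q ^ 2) ^ colorPos m k a := by
    rw [resLo_sub_color hk hkm (hv.2 ha) (hle a), e₄, zpow_natCast]
  have h₃ (a b : Fin (m + 1)) (ha : a ≠ 0) (hb : b ≠ 0) :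
      q ^ (2 * resLo m (((a : ℕ) : ℤ) - ((b : ℕ) : ℤ)) - 2) =
      if colorPos m k a < colorPos m k b then
        (q ^ 2) ^ m * (q ^ 2) ^ colorPos m k a / (q ^ 2) ^ (colorPos m k b + 1)
      else (q ^ 2) ^ colorPos m k a / (q ^ 2) ^ (colorPos m k b + 1) := by
    rw [resLo_sub hk hkm (hv.2 ha) (hle a) (hv.2 hb) (hle b), e₅]
    split_ifs
    · rw [zpow_add₀ hQ, zpow_sub₀ hQ, zpow_natCast, zpow_natCast, zpow_natCast, pow_succ (q ^ 2)]
      field_simp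
    · rw [add_zero, zpow_sub₀ hQ, zpow_natCast, zpow_natCast, pow_succ (q ^ 2), div_div]
  have hC (a b : Fin (m + 1)) (ha : a ≠ 0) (hb : b ≠ 0) :
      Ccond a b k ↔ colorPos m k a < colorPos m k b :=
    ccond_iff (by have := hv.2 ha; omega) (hle a) (by have := hv.2 hb; omega) (hle b) hk hkm
  have h₀ (a b : Fin (m + 1)) (hab : a ≠ b) :
      colorPos m k a < colorPos m k b ∨ colorPos m k b < colorPos m k a :=
    lt_or_gt_of_ne fun h => hab (colorOrd_injective hk hkm (congrArg Nat.cast h))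
  unfold wtR pairWt dualF dualG coup
  simp only [e₁, e₂, e₃]
  clear e₁ e₂ e₃ e₄ e₅
  obtain ⟨A, hA⟩ : ∃ A : Fin (m + 1) → K, ∀ a : Fin (m + 1),
    q ^ (2 * resHi m ((k : ℤ) - ((a : ℕ) : ℤ)) - 2) = A a := ⟨_, fun _ => rfl⟩
  obtain ⟨B, hB⟩ : ∃ B : Fin (m + 1) → K, ∀ a : Fin (m + 1),
    q ^ (2 * resLo m (((a : ℕ) : ℤ) - (k : ℤ))) = B a := ⟨_, fun _ => rfl⟩
  obtain ⟨D, hD⟩ : ∃ D : Fin (m + 1) → Fin (m + 1) → K, ∀ a b : Fin (m + 1),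
    q ^ (2 * resLo m (((a : ℕ) : ℤ) - ((b : ℕ) : ℤ)) - 2) = D a b := ⟨_, fun _ _ => rfl⟩
  simp only [hA, hB, hD] at h₁ h₂ h₃ ⊢
  clear hA hB hD
  generalize q ^ 2 = Q at *
  generalize Q ^ m / Q = w at *
  generalize Q ^ m = w' at *
  by_cases ne = sw <;> by_cases nw = se <;> grind

include hk hkm in
theorem Rmat_right_left (hq : q ≠ 0) (z z' : K) : Rmat m q Φ X .R .L z z' k =
    cupMat (dualF (q ^ 2) Φ (coup m X) 0 m z z')
      (dualG (q ^ 2) Φ (fun a => colorPos m k a) 0 m z z') :=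
  Matrix.ext fun _ _ => wtR_right_left hk hkm hq ..

/-- The product of the two mixed crossings of two lines is this multiple of the identity. -/
def unitarity (m : ℕ) (q z z' : K) : K := (z' - q ^ 2 * z) * (z' - (q ^ 2) ^ m * z)

include hk hkm in
theorem Rmat_right_left_mul_left_right (hq : q ≠ 0) (hΦ : Φ ≠ 0)
    (hXoff : ∀ i j, 1 ≤ i → i ≤ m → 1 ≤ j → j ≤ m → i ≠ j → X i j * X j i = q ^ 2) (z z' : K) :
    Rmat m q Φ X .R .L z z' k * Rmat m q Φ X .L .R z' z k =
      unitarity m q z z' • (1 : Matrix (Fin (m + 1) × Fin (m + 1)) _ K) := by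
  have hpos : (fun a : Fin (m + 1) => colorPos m k a) 0 = m := rfl
  rw [Rmat_right_left hk hkm hq, Rmat_left_right hk hkm]
  refine cupMat_mul_cupMat _ _ _ _ _ (fun a => by simp [mixG]) (fun a => by simp [dualG])
    (fun a b hab => ?_) fun a b => ?_
  · have := coup_mul_coup hXoff a b
    have hQ : q ^ 2 ≠ 0 := pow_ne_zero 2 hq
    simp only [dualF, mixF, coupM, hab, hab.symm, if_false, unitarity]
    generalize (q ^ 2) ^ m = w at *
    generalize q ^ 2 = Q at *
    grind
  · exact sum_pairDiag_mul (q ^ 2) Φ (pow_ne_zero 2 hq) hΦ (coup m X) 0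
      (fun a => colorPos m k a) (fun _ _ h => colorOrd_injective hk hkm (congrArg Nat.cast h))
      (fun a ha => Int.ofNat_lt.1 (colorOrd_lt_zero hk hkm a ha)) (Fintype.card_fin _) z z' a b

end Duality

section Crossing

variable {V : Type*} [DecidableEq V] [Fintype V]

theorem tenFst_mul {γ : Type*} [DecidableEq γ] [Fintype γ] (A B : Matrix (V × V) (V × V) K) :
    tenFst (γ := γ) (A * B) = tenFst A * tenFst B := by
  refine Matrix.ext fun ⟨a, b, c⟩ ⟨a', b', c'⟩ => ?_
  simp only [tenFst, Matrix.mul_apply, Fintype.sum_prod_type, ite_mul, mul_ite, zero_mul, mul_zero]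
  by_cases h : c = c' <;> simp [h]

theorem tenSnd_mul {α : Type*} [DecidableEq α] [Fintype α] (A B : Matrix (V × V) (V × V) K) :
    tenSnd (α := α) (A * B) = tenSnd A * tenSnd B := by
  refine Matrix.ext fun ⟨a, b, c⟩ ⟨a', b', c'⟩ => ?_
  simp only [tenSnd, Matrix.mul_apply, Fintype.sum_prod_type, ite_mul, mul_ite, zero_mul, mul_zero]
  by_cases h : a = a' <;> simp [h]

theorem tenFst_smul_one {γ : Type*} [DecidableEq γ] (c : K) :
    tenFst (γ := γ) (c • (1 : Matrix (V × V) (V × V) K)) = c • 1 := by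
  refine Matrix.ext fun ⟨a, b, d⟩ ⟨a', b', d'⟩ => ?_
  simp only [tenFst, Matrix.smul_apply, Matrix.one_apply, Prod.mk.injEq, smul_eq_mul]
  grind

theorem tenSnd_smul_one {α : Type*} [DecidableEq α] (c : K) :
    tenSnd (α := α) (c • (1 : Matrix (V × V) (V × V) K)) = c • 1 := by
  refine Matrix.ext fun ⟨a, b, d⟩ ⟨a', b', d'⟩ => ?_
  simp only [tenSnd, Matrix.smul_apply, Matrix.one_apply, Prod.mk.injEq, smul_eq_mul]
  grind

theorem mul_eq_smul_one_comm {A B : Matrix (V × V) (V × V) K} {c : K} (hc : c ≠ 0)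
    (h : A * B = c • (1 : Matrix (V × V) (V × V) K)) : B * A = c • (1 : Matrix (V × V) _ K) := by
  have h' : (c⁻¹ • A) * B = 1 := by rw [smul_mul_assoc, h, inv_smul_smul₀ hc]
  rw [mul_eq_one_comm, mul_smul_comm] at h'
  rw [← h', smul_inv_smul₀ hc]

theorem YBE.inv_right {A B D D' : Matrix (V × V) (V × V) K} (h : YBE A B D) {c : K} (hc : c ≠ 0)
    (hD : D' * D = c • (1 : Matrix (V × V) (V × V) K)) : YBE B A D' := by
  have h₁ := congrArg (tenFst (γ := V)) hD
  have h₂ := congrArg (tenSnd (α := V)) (mul_eq_smul_one_comm hc hD)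
  rw [tenFst_mul, tenFst_smul_one] at h₁
  rw [tenSnd_mul, tenSnd_smul_one] at h₂
  have h := congrArg (fun M => tenFst D' * M * tenSnd D') h
  simp only [← mul_assoc, h₁] at h
  simp only [mul_assoc, h₂, smul_mul_assoc, mul_smul_comm, one_mul, mul_one] at h
  exact (smul_right_injective _ hc h).symm

theorem YBE.inv_left {A B D A' : Matrix (V × V) (V × V) K} (h : YBE A B D) {c : K} (hc : c ≠ 0)
    (hA : A' * A = c • (1 : Matrix (V × V) (V × V) K)) : YBE A' D B := by
  have h₁ := congrArg (tenSnd (α := V)) hA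
  have h₂ := congrArg (tenFst (γ := V)) (mul_eq_smul_one_comm hc hA)
  rw [tenSnd_mul, tenSnd_smul_one] at h₁
  rw [tenFst_mul, tenFst_smul_one] at h₂
  have h := congrArg (fun M => tenSnd A' * M * tenFst A') h
  simp only [← mul_assoc, h₁] at h
  simp only [mul_assoc, h₂, smul_mul_assoc, mul_smul_comm, one_mul, mul_one] at h
  exact (smul_right_injective _ hc h).symm

theorem RTT.inv {R' R N' N : Matrix (V × V) (V × V) K} {S T : Matrix (Fin 2 × V) (V × Fin 2) K}
    (h : RTT R' R S T) {c : K} (hc : c ≠ 0)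
    (hR' : N' * R' = c • (1 : Matrix (V × V) (V × V) K))
    (hR : N * R = c • (1 : Matrix (V × V) (V × V) K)) : RTT N' N T S := by
  have h₁ := congrArg (tenSnd (α := Fin 2)) hR'
  have h₂ := congrArg (tenFst (γ := Fin 2)) (mul_eq_smul_one_comm hc hR)
  rw [tenSnd_mul, tenSnd_smul_one] at h₁
  rw [tenFst_mul, tenFst_smul_one] at h₂
  have h := congrArg
    (fun M : Matrix (Fin 2 × V × V) (V × V × Fin 2) K =>
      tenSnd (α := Fin 2) N' * M * tenFst (γ := Fin 2) N) h
  simp only [← Matrix.mul_assoc, h₁] at h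
  simp only [Matrix.mul_assoc, h₂, Matrix.smul_mul, Matrix.mul_smul, Matrix.one_mul,
    Matrix.mul_one] at h
  exact (smul_right_injective _ hc h).symm

end Crossing

section Density

open Polynomial

/-- The entries of a family of matrices are polynomials in the parameter of the family. -/
def IsPolyFamily {α β : Type*} (M : K → Matrix α β K) : Prop :=
  ∀ a b, ∃ p : K[X], ∀ z, M z a b = p.eval z

theorem isPolyFamily_const {α β : Type*} (M : Matrix α β K) : IsPolyFamily fun _ => M :=
  fun a b => ⟨C (M a b), fun _ => (eval_C ..).symm⟩

theorem isPolyFamily_affine {α β : Type*} {M : K → Matrix α β K} (M₀ M₁ : Matrix α β K)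
    (h : ∀ z, M z = M₀ + z • M₁) : IsPolyFamily M :=
  fun a b => ⟨C (M₀ a b) + C (M₁ a b) * X, fun z => by simp [h, mul_comm z]⟩

variable {α β γ α₁ α₂ β₁ β₂ : Type*}

theorem IsPolyFamily.mul [Fintype β] {M : K → Matrix α β K} {N : K → Matrix β γ K}
    (hM : IsPolyFamily M) (hN : IsPolyFamily N) : IsPolyFamily fun z => M z * N z := by
  intro a b
  choose p hp using hM a
  choose r hr using fun c => hN c b
  exact ⟨∑ c, p c * r c, fun z => by simp [Matrix.mul_apply, eval_finsetSum, hp, hr]⟩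

theorem IsPolyFamily.tenFst [DecidableEq γ] {M : K → Matrix (α₂ × β₂) (α₁ × β₁) K}
    (hM : IsPolyFamily M) : IsPolyFamily fun z => tenFst (γ := γ) (M z) := by
  intro a b
  by_cases h : a.2.2 = b.2.2
  · obtain ⟨p, hp⟩ := hM (a.1, a.2.1) (b.1, b.2.1)
    exact ⟨p, fun z => (if_pos h).trans (hp z)⟩
  · exact ⟨0, fun z => (if_neg h).trans eval_zero.symm⟩

theorem IsPolyFamily.tenSnd [DecidableEq γ] {M : K → Matrix (α₂ × β₂) (α₁ × β₁) K}
    (hM : IsPolyFamily M) : IsPolyFamily fun z => tenSnd (α := γ) (M z) := by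
  intro a b
  by_cases h : a.1 = b.1
  · obtain ⟨p, hp⟩ := hM a.2 b.2
    exact ⟨p, fun z => (if_pos h).trans (hp z)⟩
  · exact ⟨0, fun z => (if_neg h).trans eval_zero.symm⟩

theorem IsPolyFamily.eq_of_eval_ne_zero [Infinite K] {M N : K → Matrix α β K}
    (hM : IsPolyFamily M) (hN : IsPolyFamily N) (c : K[X]) (hc : c ≠ 0)
    (h : ∀ z, c.eval z ≠ 0 → M z = N z) (z : K) : M z = N z := by
  ext a b
  obtain ⟨p, hp⟩ := hM a b
  obtain ⟨r, hr⟩ := hN a b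
  have h' : c * (p - r) = 0 := Polynomial.funext fun w => by
    rw [eval_mul, eval_sub, ← hp, ← hr, eval_zero, mul_eq_zero, sub_eq_zero]
    exact or_iff_not_imp_left.2 fun hw => by rw [h w hw]
  rw [hp, hr, sub_eq_zero.1 ((mul_eq_zero.1 h').resolve_left hc)]

theorem ite_eq_mul_add_mul {p : Prop} [Decidable p] {z z' a a₁ a₂ b b₁ b₂ : K}
    (ha : a = z * a₁ + z' * a₂) (hb : b = z * b₁ + z' * b₂) :
    (if p then a else b) = z * (if p then a₁ else b₁) + z' * (if p then a₂ else b₂) := by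
  split_ifs <;> assumption

theorem wtR_eq_add (m : ℕ) (q Φ : K) (x : ℕ → ℕ → K) (tx ty : RowType) (z z' : K) (k : ℕ)
    (nw sw ne se : Fin (m + 1)) : wtR m q Φ x tx ty z z' k nw sw ne se =
      z * wtR m q Φ x tx ty 1 0 k nw sw ne se + z' * wtR m q Φ x tx ty 0 1 k nw sw ne se := by
  unfold wtR
  cases tx <;> cases ty <;> dsimp only <;> repeat' apply ite_eq_mul_add_mul
  all_goals ring

theorem isPolyFamily_Rmat_left (m : ℕ) (q Φ : K) (x : ℕ → ℕ → K) (tx ty : RowType) (z' : K)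
    (k : ℕ) : IsPolyFamily fun z => Rmat m q Φ x tx ty z z' k :=
  isPolyFamily_affine (z' • Rmat m q Φ x tx ty 0 1 k) (Rmat m q Φ x tx ty 1 0 k) fun z => by
    ext
    simp only [Rmat, Matrix.add_apply, Matrix.smul_apply, smul_eq_mul]
    rw [wtR_eq_add, add_comm]

theorem isPolyFamily_Rmat_right (m : ℕ) (q Φ : K) (x : ℕ → ℕ → K) (tx ty : RowType) (z : K)
    (k : ℕ) : IsPolyFamily fun z' => Rmat m q Φ x tx ty z z' k :=
  isPolyFamily_affine (z • Rmat m q Φ x tx ty 1 0 k) (Rmat m q Φ x tx ty 0 1 k) fun z' => by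
    ext
    simp only [Rmat, Matrix.add_apply, Matrix.smul_apply, smul_eq_mul]
    rw [wtR_eq_add]

theorem isPolyFamily_Tmat (m : ℕ) (q Φ : K) (x : ℕ → ℕ → K) (k : ℕ) :
    IsPolyFamily fun z => Tmat m q Φ x .R z k :=
  isPolyFamily_affine (Tmat m q Φ x .R 0 k) (Tmat m q Φ x .R 1 k - Tmat m q Φ x .R 0 k)
    fun z => by
      ext
      simp only [Tmat, Matrix.add_apply, Matrix.sub_apply, Matrix.smul_apply, smul_eq_mul, wtT]
      split_ifs <;> ring

theorem ybe_of_unitarity_ne_zero [Infinite K] {V : Type*} [DecidableEq V] [Fintype V]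
    (m : ℕ) (q z : K)
    {A B D : K → Matrix (V × V) (V × V) K} (hA : IsPolyFamily A) (hB : IsPolyFamily B)
    (hD : IsPolyFamily D) (h : ∀ w, unitarity m q z w ≠ 0 → YBE (A w) (B w) (D w)) (w : K) :
    YBE (A w) (B w) (D w) := by
  refine IsPolyFamily.eq_of_eval_ne_zero (hA.tenSnd.mul (hB.tenFst.mul hD.tenSnd))
    (hD.tenFst.mul (hB.tenSnd.mul hA.tenFst)) ((X - C (q ^ 2 * z)) * (X - C ((q ^ 2) ^ m * z)))
    (mul_ne_zero (X_sub_C_ne_zero _) (X_sub_C_ne_zero _)) (fun w hw => h w ?_) w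
  simpa [unitarity] using hw

end Density

section MixedEquations

variable {m k : ℕ} (hk : 1 ≤ k) (hkm : k ≤ m) {q Φ : K} {X : ℕ → ℕ → K}
  (hq : q ≠ 0) (hΦ : Φ ≠ 0)
  (hXoff : ∀ i j, 1 ≤ i → i ≤ m → 1 ≤ j → j ≤ m → i ≠ j → X i j * X j i = q ^ 2)
  [Infinite K] (z₁ z₂ z₃ : K)
include hk hkm hq hΦ hXoff

theorem ybe_left_right_left : YBE (Rmat m q Φ X .L .R z₁ z₂ k) (Rmat m q Φ X .L .L z₁ z₃ k)
    (Rmat m q Φ X .R .L z₂ z₃ k) :=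
  ybe_of_unitarity_ne_zero m q z₂ (isPolyFamily_const _) (isPolyFamily_Rmat_right m q Φ X _ _ _ k)
    (isPolyFamily_Rmat_right m q Φ X _ _ _ k) (fun w hw =>
      (ybe_left_left_right hk hkm hq hΦ hXoff z₁ w z₂).inv_right hw
        (Rmat_right_left_mul_left_right hk hkm hq hΦ hXoff z₂ w)) z₃

theorem ybe_right_left_right : YBE (Rmat m q Φ X .R .L z₁ z₂ k) (Rmat m q Φ X .R .R z₁ z₃ k)
    (Rmat m q Φ X .L .R z₂ z₃ k) :=
  ybe_of_unitarity_ne_zero m q z₁ (isPolyFamily_Rmat_right m q Φ X _ _ _ k) (isPolyFamily_const _)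
    (isPolyFamily_Rmat_left m q Φ X _ _ _ k) (fun w hw =>
      (ybe_left_right_right hk hkm hq hΦ hXoff w z₁ z₃).inv_left hw
        (Rmat_right_left_mul_left_right hk hkm hq hΦ hXoff z₁ w)) z₂

theorem ybe_right_left_left : YBE (Rmat m q Φ X .R .L z₁ z₂ k) (Rmat m q Φ X .R .L z₁ z₃ k)
    (Rmat m q Φ X .L .L z₂ z₃ k) :=
  ybe_of_unitarity_ne_zero m q z₁ (isPolyFamily_Rmat_right m q Φ X _ _ _ k) (isPolyFamily_const _)
    (isPolyFamily_Rmat_left m q Φ X _ _ _ k) (fun w hw =>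
      (ybe_left_right_left hk hkm hq hΦ hXoff w z₁ z₃).inv_left hw
        (Rmat_right_left_mul_left_right hk hkm hq hΦ hXoff z₁ w)) z₂

theorem ybe_right_right_left : YBE (Rmat m q Φ X .R .R z₁ z₂ k) (Rmat m q Φ X .R .L z₁ z₃ k)
    (Rmat m q Φ X .R .L z₂ z₃ k) :=
  ybe_of_unitarity_ne_zero m q z₂ (isPolyFamily_const _) (isPolyFamily_Rmat_right m q Φ X _ _ _ k)
    (isPolyFamily_Rmat_right m q Φ X _ _ _ k) (fun w hw =>
      (ybe_right_left_right hk hkm hq hΦ hXoff z₁ w z₂).inv_right hw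
        (Rmat_right_left_mul_left_right hk hkm hq hΦ hXoff z₂ w)) z₃

theorem rtt_right_left (hXdiag : ∀ i, 1 ≤ i → i ≤ m → X i i = -(q ^ 2)) (hz₂ : z₂ ≠ 0) :
    RTT (Rmat m q Φ X .R .L z₁ z₂ (if k = m then 1 else k + 1)) (Rmat m q Φ X .R .L z₁ z₂ k)
      (Tmat m q Φ X .R z₁ k) (Tmat m q Φ X .L z₂ k) := by
  refine IsPolyFamily.eq_of_eval_ne_zero
    ((isPolyFamily_Rmat_left m q Φ X _ _ _ _).tenSnd.mul
      ((isPolyFamily_Tmat m q Φ X k).tenFst.mul (isPolyFamily_const _)))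
    ((isPolyFamily_const _).mul
      ((isPolyFamily_Tmat m q Φ X k).tenSnd.mul (isPolyFamily_Rmat_left m q Φ X _ _ _ _).tenFst))
    ((Polynomial.C z₂ - Polynomial.C (q ^ 2) * Polynomial.X) *
      (Polynomial.C z₂ - Polynomial.C ((q ^ 2) ^ m) * Polynomial.X))
    (fun h => ?_) (fun w hw => ?_) z₁
  · simpa [hz₂] using congrArg (Polynomial.eval 0) h
  · exact RTT.inv (rtt_left_right hk hkm hq hΦ hXdiag hXoff hz₂)
      (c := unitarity m q w z₂) (by simpa [unitarity] using hw)
      (Rmat_right_left_mul_left_right (by split_ifs <;> omega) (by split_ifs <;> omega)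
        hq hΦ hXoff w z₂)
      (Rmat_right_left_mul_left_right hk hkm hq hΦ hXoff w z₂)

end MixedEquations
/-- The families of left- and right-moving lattice models satisfy all the
auxiliary `RTT` and `RRR` Yang–Baxter equations. -/
theorem yang_baxter_equations (m : ℕ) (hm : 1 ≤ m) (K : Type*) [Field K] [CharZero K]
    (q Φ z₁ z₂ z₃ : K) (hq : q ≠ 0) (hΦ : Φ ≠ 0)
    (hz₁ : z₁ ≠ 0) (hz₂ : z₂ ≠ 0) (hz₃ : z₃ ≠ 0)
    (X : ℕ → ℕ → K)
    (hXdiag : ∀ i, 1 ≤ i → i ≤ m → X i i = -(q ^ 2))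
    (hXoff : ∀ i j, 1 ≤ i → i ≤ m → 1 ≤ j → j ≤ m → i ≠ j → X i j * X j i = q ^ 2) :
    (∀ (tx ty : RowType) (k : ℕ), 1 ≤ k → k ≤ m →
      (tenSnd (α := Fin 2)
          (Rmat m q Φ X tx ty z₁ z₂ (if k = m then 1 else k + 1))).mulVecLin ∘ₗ
        (tenFst (γ := Fin (m + 1)) (Tmat m q Φ X tx z₁ k)).mulVecLin ∘ₗ
        (tenSnd (α := Fin (m + 1)) (Tmat m q Φ X ty z₂ k)).mulVecLin
      = (tenFst (γ := Fin (m + 1)) (Tmat m q Φ X ty z₂ k)).mulVecLin ∘ₗ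
        (tenSnd (α := Fin (m + 1)) (Tmat m q Φ X tx z₁ k)).mulVecLin ∘ₗ
        (tenFst (γ := Fin 2) (Rmat m q Φ X tx ty z₁ z₂ k)).mulVecLin) ∧
    (∀ (tx ty tz : RowType) (k : ℕ), 1 ≤ k → k ≤ m →
      (tenSnd (α := Fin (m + 1)) (Rmat m q Φ X tx ty z₁ z₂ k)).mulVecLin ∘ₗ
        (tenFst (γ := Fin (m + 1)) (Rmat m q Φ X tx tz z₁ z₃ k)).mulVecLin ∘ₗ
        (tenSnd (α := Fin (m + 1)) (Rmat m q Φ X ty tz z₂ z₃ k)).mulVecLin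
      = (tenFst (γ := Fin (m + 1)) (Rmat m q Φ X ty tz z₂ z₃ k)).mulVecLin ∘ₗ
        (tenSnd (α := Fin (m + 1)) (Rmat m q Φ X tx tz z₁ z₃ k)).mulVecLin ∘ₗ
        (tenFst (γ := Fin (m + 1)) (Rmat m q Φ X tx ty z₁ z₂ k)).mulVecLin) := by
  refine ⟨fun tx ty k hk hkm => ?_, fun tx ty tz k hk hkm => ?_⟩ <;>
    simp only [← Matrix.mulVecLin_mul] <;> refine congrArg Matrix.mulVecLin ?_
  · cases tx <;> cases ty
    · exact rtt_left_left hk hkm hq hΦ hXdiag hXoff hz₁ hz₂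
    · exact rtt_left_right hk hkm hq hΦ hXdiag hXoff hz₁
    · exact rtt_right_left hk hkm hq hΦ hXoff z₁ z₂ hXdiag hz₂
    · exact rtt_right_right hk hkm hq hΦ hXdiag hXoff
  · cases tx <;> cases ty <;> cases tz
    · exact ybe_left_left_left hk hkm hq hΦ hXoff z₁ z₂ z₃
    · exact ybe_left_left_right hk hkm hq hΦ hXoff z₁ z₂ z₃
    · exact ybe_left_right_left hk hkm hq hΦ hXoff z₁ z₂ z₃
    · exact ybe_left_right_right hk hkm hq hΦ hXoff z₁ z₂ z₃
    · exact ybe_right_left_left hk hkm hq hΦ hXoff z₁ z₂ z₃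
    · exact ybe_right_left_right hk hkm hq hΦ hXoff z₁ z₂ z₃
    · exact ybe_right_right_left hk hkm hq hΦ hXoff z₁ z₂ z₃
    · exact ybe_right_right_right hk hkm hq hΦ hXoff z₁ z₂ z₃


end Stmt0
end

section
/- Let m ≥ 1 be an integer and K a field containing nonzero elements q, Φ, elements z₁, z₂, and elements 𝔛_{i,j} (1 ≤ i,j ≤ m) with 𝔛_{i,i} = −q² and 𝔛_{i,j}·𝔛_{j,i} = q² for i ≠ j. Then for every vertex color 1 ≤ k ≤ m, the mixed R-matrices defined in the context satisfy R^L_R(z₂,z₁;k) ∘ R^R_L(z₁,z₂;k) = C·id_{V⊗V} and R^R_L(z₁,z₂;k) ∘ R^L_R(z₂,z₁;k) = C·id_{V⊗V}, where C = (z₂ − q²z₁)(z₂ − q^{2m}z₁). -/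
open Matrix

namespace Stmt1

/-- The condition `C(i,j,k)`: `i < j < k` or `j < k ≤ i` or `k ≤ i < j`. -/
def Ccond (i j k : ℕ) : Prop :=
  (i < j ∧ j < k) ∨ (j < k ∧ k ≤ i) ∨ (k ≤ i ∧ i < j)

instance (i j k : ℕ) : Decidable (Ccond i j k) := by
  unfold Ccond; infer_instance

/-- `res_m(x) ∈ {0,…,m−1}`, the representative of `x` modulo `m`. -/
def resLo (m : ℕ) (x : ℤ) : ℤ := x % m

/-- `res^m(x) ∈ {1,…,m}`, the representative of `x` modulo `m`. -/
def resHi (m : ℕ) (x : ℤ) : ℤ := (x - 1) % m + 1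

variable {K : Type*} [Field K]

/-- The weight function `W^L_R(nw, sw; ne, se)` with parameters `(z, z′)` and vertex
color `c_k`. -/
def wtLR (m : ℕ) (q Φ : K) (X : ℕ → ℕ → K) (z z' : K) (k : ℕ)
    (nw sw ne se : Fin (m + 1)) : K :=
  if nw = 0 ∧ sw = 0 ∧ ne = 0 ∧ se = 0 then z - z'
  else if nw = 0 ∧ sw ≠ 0 ∧ ne = sw ∧ se = 0 then Φ * (z - q ^ 2 * z')
  else if nw ≠ 0 ∧ sw = 0 ∧ ne = 0 ∧ se = nw then Φ * (z - q ^ 2 * z')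
  else if nw ≠ 0 ∧ sw = nw ∧ ne = nw ∧ se = nw then Φ ^ 2 * (q ^ 4 * z' - z)
  else if nw ≠ 0 ∧ sw ≠ 0 ∧ sw ≠ nw ∧ ne = sw ∧ se = nw then
    Φ ^ 2 * X (nw : ℕ) (sw : ℕ) * (z - q ^ 2 * z')
  else if nw = 0 ∧ sw = 0 ∧ ne ≠ 0 ∧ se = ne then Φ * (1 - q ^ 2) * z
  else if nw ≠ 0 ∧ sw = nw ∧ ne = 0 ∧ se = 0 then Φ * (1 - q ^ 2) * z'
  else if nw ≠ 0 ∧ sw = nw ∧ ne ≠ 0 ∧ ne ≠ nw ∧ se = ne then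
    (if Ccond (nw : ℕ) (ne : ℕ) k then -(Φ ^ 2) * (1 - q ^ 2) * q ^ 2 * z'
     else if Ccond (ne : ℕ) (nw : ℕ) k then -(Φ ^ 2) * (1 - q ^ 2) * z else 0)
  else 0

/-- The weight function `W^R_L(nw, sw; ne, se)` with parameters `(z, z′)` and vertex
color `c_k`. -/
def wtRL (m : ℕ) (q Φ : K) (X : ℕ → ℕ → K) (z z' : K) (k : ℕ)
    (nw sw ne se : Fin (m + 1)) : K :=
  if nw = 0 ∧ sw = 0 ∧ ne = 0 ∧ se = 0 then z' - q ^ (2 * m + 2) * z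
  else if nw = 0 ∧ sw ≠ 0 ∧ ne = sw ∧ se = 0 then (z' - q ^ (2 * m) * z) / Φ
  else if nw ≠ 0 ∧ sw = 0 ∧ ne = 0 ∧ se = nw then (z' - q ^ (2 * m) * z) / Φ
  else if nw ≠ 0 ∧ sw = nw ∧ ne = nw ∧ se = nw then (q ^ (2 * m - 2) * z - z') / Φ ^ 2
  else if nw ≠ 0 ∧ sw ≠ 0 ∧ sw ≠ nw ∧ ne = sw ∧ se = nw then
    X (nw : ℕ) (sw : ℕ) * (z' - q ^ (2 * m) * z) / (q ^ 2 * Φ ^ 2)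
  else if nw = 0 ∧ sw = 0 ∧ ne ≠ 0 ∧ se = ne then
    q ^ (2 * resHi m ((k : ℤ) - ((ne : ℕ) : ℤ)) - 2) * (1 - q ^ 2) * z' / Φ
  else if nw ≠ 0 ∧ sw = nw ∧ ne = 0 ∧ se = 0 then
    q ^ (2 * resLo m (((nw : ℕ) : ℤ) - (k : ℤ))) * (1 - q ^ 2) * z / Φ
  else if nw ≠ 0 ∧ sw = nw ∧ ne ≠ 0 ∧ ne ≠ nw ∧ se = ne then
    (if Ccond (nw : ℕ) (ne : ℕ) k then
        q ^ (2 * resLo m (((nw : ℕ) : ℤ) - ((ne : ℕ) : ℤ)) - 2) * (1 - q ^ 2) * z / Φ ^ 2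
     else if Ccond (ne : ℕ) (nw : ℕ) k then
        q ^ (2 * resLo m (((nw : ℕ) : ℤ) - ((ne : ℕ) : ℤ)) - 2) * (1 - q ^ 2) * z' / Φ ^ 2
     else 0)
  else 0

/-- `R^L_R(z,z′;k) : V ⊗ V → V ⊗ V`, `R(v_a ⊗ v_b) = Σ W^L_R(b,a;c,d) · v_d ⊗ v_c`,
as a matrix. -/
def RmatLR (m : ℕ) (q Φ : K) (X : ℕ → ℕ → K) (z z' : K) (k : ℕ) :
    Matrix (Fin (m + 1) × Fin (m + 1)) (Fin (m + 1) × Fin (m + 1)) K :=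
  fun o i => wtLR m q Φ X z z' k i.2 i.1 o.2 o.1

/-- `R^R_L(z,z′;k) : V ⊗ V → V ⊗ V`, `R(v_a ⊗ v_b) = Σ W^R_L(b,a;c,d) · v_d ⊗ v_c`,
as a matrix. -/
def RmatRL (m : ℕ) (q Φ : K) (X : ℕ → ℕ → K) (z z' : K) (k : ℕ) :
    Matrix (Fin (m + 1) × Fin (m + 1)) (Fin (m + 1) × Fin (m + 1)) K :=
  fun o i => wtRL m q Φ X z z' k i.2 i.1 o.2 o.1

section Blocks

/-- Abel summation against a product of two step functions. -/
theorem sum_telescope_two_steps (w : ℕ → K) (x y x' y' : K) {a b n : ℕ} (hab : a ≤ b)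
    (hbn : b ≤ n) :
    ∑ l ∈ Finset.range n, (w l - w (l + 1)) * (if l < a then x else y) * (if l < b then x' else y')
      = x * x' * (w 0 - w a) + y * x' * (w a - w b) + y * y' * (w b - w n) := by
  have key : ∀ n, ∑ l ∈ Finset.range n,
      (w l - w (l + 1)) * (if l < a then x else y) * (if l < b then x' else y')
      = x * x' * (w 0 - w (min n a)) + y * x' * (w (min n a) - w (min n b))
        + y * y' * (w (min n b) - w n) := by
    intro n
    induction n with
    | zero => simp
    | succ n ih =>
      rw [Finset.sum_range_succ, ih]
      rcases lt_or_ge n a with h1 | h1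
      · have h2 : n < b := by omega
        rw [min_eq_left h1.le, min_eq_left h2.le, min_eq_left (Nat.succ_le_of_lt h1),
          min_eq_left (Nat.succ_le_of_lt h2), if_pos h1, if_pos h2]
        ring
      · rcases lt_or_ge n b with h2 | h2
        · rw [min_eq_right h1, min_eq_left h2.le, min_eq_right (by omega : a ≤ n + 1),
            min_eq_left (Nat.succ_le_of_lt h2), if_neg (by omega), if_pos h2]
          ring
        · rw [min_eq_right h1, min_eq_right h2, min_eq_right (by omega : a ≤ n + 1),
            min_eq_right (by omega : b ≤ n + 1), if_neg (by omega), if_neg (by omega)]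
          ring
  rw [key n, min_eq_right hbn, min_eq_right (hab.trans hbn)]

/-- Abel summation against a single step function. -/
theorem sum_telescope_step (w : ℕ → K) (x y : K) {a n : ℕ} (han : a ≤ n) :
    ∑ l ∈ Finset.range n, (w l - w (l + 1)) * (if l < a then x else y)
      = x * (w 0 - w a) + y * (w a - w n) := by
  simpa using sum_telescope_two_steps w x y 1 1 han le_rfl

/-- The coefficient `v_l ⊗ v_l ↦ v_j ⊗ v_j` of `R^L_R(z₂,z₁;k)` between colors at cyclic
positions `l` and `j` after `k`, with `t = q²` and up to a power of `Φ`. -/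
def blockLR (t z₁ z₂ : K) (l j : ℕ) : K :=
  -(1 - t) * (if l < j then t * z₁ else z₂) + if l = j then t * (t * z₁ - z₂) else 0

/-- The coefficient `v_l ⊗ v_l ↦ v_j ⊗ v_j` of `R^R_L(z₁,z₂;k)` between colors at cyclic
positions `l` and `j` after `k`, with `t = q²` and up to a power of `Φ`. -/
def blockRL (t : K) (m : ℕ) (z₁ z₂ : K) (l j : ℕ) : K :=
  t ^ l * (t ^ (j + 1))⁻¹ *
    ((1 - t) * (if l < j then t ^ m * z₁ else z₂) + if l = j then t ^ m * z₁ - z₂ else 0)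

variable {t : K} (ht : t ≠ 0) (m : ℕ) (z₁ z₂ : K)
include ht

theorem sum_blockRL_mul_blockLR {i j : ℕ} (hi : i < m) (hj : j < m) :
    (1 - t) * z₂ * (t ^ i * (1 - t) * z₁)
        + ∑ l ∈ Finset.range m, blockLR t z₁ z₂ l j * blockRL t m z₁ z₂ i l
      = if j = i then (z₂ - t * z₁) * (z₂ - t ^ m * z₁) else 0 := by
  have hterm : ∀ l, blockLR t z₁ z₂ l j * blockRL t m z₁ z₂ i l =
      t ^ i * (1 - t) * (((t ^ l)⁻¹ - (t ^ (l + 1))⁻¹) * (if l < j then t * z₁ else z₂) *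
        (if l < i + 1 then z₂ else t ^ m * z₁))
      + (if l = j then t * (t * z₁ - z₂) * blockRL t m z₁ z₂ i j else 0)
      + (if l = i then -(1 - t) * (if i < j then t * z₁ else z₂) * t⁻¹ * (t ^ m * z₁ - z₂)
          else 0) := by
    intro l
    have e : (if i < l then t ^ m * z₁ else z₂) = if l < i + 1 then z₂ else t ^ m * z₁ := by
      by_cases h : i < l
      · rw [if_pos h, if_neg (by omega)]
      · rw [if_neg h, if_pos (by omega)]
    unfold blockLR blockRL
    rcases eq_or_ne l j with rfl | h1 <;> rcases eq_or_ne l i with rfl | h2 <;> rw [e]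
    · generalize (if l < l + 1 then z₂ else t ^ m * z₁) = x, (if l < l then t * z₁ else z₂) = y
      simp only [if_true]
      field_simp
      ring
    · generalize (if l < i + 1 then z₂ else t ^ m * z₁) = x, (if l < l then t * z₁ else z₂) = y
      simp only [if_true, h2, h2.symm, if_false]
      field_simp
      ring
    · generalize (if l < l + 1 then z₂ else t ^ m * z₁) = x, (if l < j then t * z₁ else z₂) = y
      simp only [if_true, h1, if_false]
      field_simp
      ring
    · generalize (if l < i + 1 then z₂ else t ^ m * z₁) = x, (if l < j then t * z₁ else z₂) = y
      simp only [h1, h2, h2.symm, if_false]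
      field_simp
      ring
  simp_rw [hterm]
  rw [Finset.sum_add_distrib, Finset.sum_add_distrib, ← Finset.mul_sum,
    Finset.sum_ite_eq', Finset.sum_ite_eq', if_pos (Finset.mem_range.2 hi),
    if_pos (Finset.mem_range.2 hj)]
  obtain ⟨T, hT0, hT⟩ : ∃ T : K, T ≠ 0 ∧ t ^ m = T := ⟨_, pow_ne_zero _ ht, rfl⟩
  rcases lt_or_ge i j with h | h
  · have hs := sum_telescope_two_steps (fun l => (t ^ l)⁻¹) z₂ (t ^ m * z₁) (t * z₁) z₂
      (show i + 1 ≤ j by omega) hj.le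
    simp_rw [mul_right_comm _ (ite (_ < i + 1) _ _)] at hs
    rw [hs]
    simp only [blockRL, h, if_true, h.ne, h.ne', if_false, hT]
    field_simp
    ring
  · have hs := sum_telescope_two_steps (fun l => (t ^ l)⁻¹) (t * z₁) z₂ z₂ (t ^ m * z₁)
      (show j ≤ i + 1 by omega) (show i + 1 ≤ m by omega)
    rw [hs]
    rcases h.eq_or_lt with rfl | h
    · simp only [blockRL, lt_irrefl, if_true, if_false, hT]
      field_simp
      ring
    · simp only [blockRL, h.not_gt, h.ne, h.ne', if_false, hT]
      field_simp
      ring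

theorem sum_blockLR_mul_blockRL {i j : ℕ} (hi : i < m) (hj : j < m) :
    t ^ m * (t ^ (j + 1))⁻¹ * (1 - t) * z₂ * ((1 - t) * z₁)
        + ∑ l ∈ Finset.range m, blockRL t m z₁ z₂ l j * blockLR t z₁ z₂ i l
      = if j = i then (z₂ - t * z₁) * (z₂ - t ^ m * z₁) else 0 := by
  have hterm : ∀ l, blockRL t m z₁ z₂ l j * blockLR t z₁ z₂ i l =
      -(1 - t) * (t ^ (j + 1))⁻¹ * ((t ^ l - t ^ (l + 1)) * (if l < j then t ^ m * z₁ else z₂) *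
        (if l < i + 1 then z₂ else t * z₁))
      + (if l = j then t⁻¹ * (t ^ m * z₁ - z₂) * blockLR t z₁ z₂ i j else 0)
      + (if l = i then t ^ i * (t ^ (j + 1))⁻¹ * (1 - t) * (if i < j then t ^ m * z₁ else z₂) *
          (t * (t * z₁ - z₂)) else 0) := by
    intro l
    have e : (if i < l then t * z₁ else z₂) = if l < i + 1 then z₂ else t * z₁ := by
      by_cases h : i < l
      · rw [if_pos h, if_neg (by omega)]
      · rw [if_neg h, if_pos (by omega)]
    unfold blockLR blockRL
    rcases eq_or_ne l j with rfl | h1 <;> rcases eq_or_ne l i with rfl | h2 <;> rw [e]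
    · generalize (if l < l + 1 then z₂ else t * z₁) = x, (if l < l then t ^ m * z₁ else z₂) = y
      simp only [if_true]
      field_simp
      ring
    · generalize (if l < i + 1 then z₂ else t * z₁) = x, (if l < l then t ^ m * z₁ else z₂) = y
      simp only [if_true, h2, h2.symm, if_false]
      field_simp
      ring
    · generalize (if l < l + 1 then z₂ else t * z₁) = x, (if l < j then t ^ m * z₁ else z₂) = y
      simp only [if_true, h1, if_false]
      field_simp
      ring
    · generalize (if l < i + 1 then z₂ else t * z₁) = x, (if l < j then t ^ m * z₁ else z₂) = y
      simp only [h1, h2, h2.symm, if_false]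
      field_simp
      ring
  simp_rw [hterm]
  rw [Finset.sum_add_distrib, Finset.sum_add_distrib, ← Finset.mul_sum,
    Finset.sum_ite_eq', Finset.sum_ite_eq', if_pos (Finset.mem_range.2 hi),
    if_pos (Finset.mem_range.2 hj)]
  obtain ⟨T, hT⟩ : ∃ T : K, t ^ m = T := ⟨_, rfl⟩
  rcases lt_or_ge i j with h | h
  · have hs := sum_telescope_two_steps (fun l => t ^ l) z₂ (t * z₁) (t ^ m * z₁) z₂
      (show i + 1 ≤ j by omega) hj.le
    simp_rw [mul_right_comm _ (ite (_ < i + 1) _ _)] at hs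
    rw [hs]
    simp only [blockLR, h, if_true, h.ne, h.ne', if_false, hT]
    field_simp
    ring
  · have hs := sum_telescope_two_steps (fun l => t ^ l) (t ^ m * z₁) z₂ z₂ (t * z₁)
      (show j ≤ i + 1 by omega) (show i + 1 ≤ m by omega)
    rw [hs]
    rcases h.eq_or_lt with rfl | h
    · simp only [blockLR, lt_irrefl, if_true, if_false, hT]
      field_simp
      ring
    · simp only [blockLR, h.not_gt, h.ne, h.ne', if_false, hT]
      field_simp
      ring

/-- The column of `R^L_R ∘ R^R_L` indexed by `v₀ ⊗ v₀`, row at a color. -/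
theorem sum_zeroRL_mul_blockLR {j : ℕ} (hj : j < m) :
    (1 - t) * z₂ * (z₂ - t * t ^ m * z₁)
        + ∑ l ∈ Finset.range m, blockLR t z₁ z₂ l j * (t ^ m * (t ^ (l + 1))⁻¹ * (1 - t) * z₂)
      = 0 := by
  have hterm : ∀ l, blockLR t z₁ z₂ l j * (t ^ m * (t ^ (l + 1))⁻¹ * (1 - t) * z₂) =
      t ^ m * (1 - t) * z₂ * (((t ^ l)⁻¹ - (t ^ (l + 1))⁻¹) * (if l < j then t * z₁ else z₂))
      + (if l = j then t * (t * z₁ - z₂) * (t ^ m * (t ^ (j + 1))⁻¹ * (1 - t) * z₂) else 0) := by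
    intro l
    unfold blockLR
    rcases eq_or_ne l j with rfl | h
    · generalize (if l < l then t * z₁ else z₂) = x
      simp only [if_true]
      field_simp
      ring
    · generalize (if l < j then t * z₁ else z₂) = x
      simp only [h, if_false]
      field_simp
      ring
  simp_rw [hterm]
  rw [Finset.sum_add_distrib, ← Finset.mul_sum, Finset.sum_ite_eq',
    if_pos (Finset.mem_range.2 hj), sum_telescope_step (fun l => (t ^ l)⁻¹) _ _ hj.le]
  field_simp
  ring

/-- The row of `R^L_R ∘ R^R_L` indexed by `v₀ ⊗ v₀`, column at a color. -/
theorem sum_blockRL_mul_zeroLR {i : ℕ} (hi : i < m) :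
    (z₂ - z₁) * (t ^ i * (1 - t) * z₁)
        + ∑ l ∈ Finset.range m, (1 - t) * z₁ * blockRL t m z₁ z₂ i l
      = 0 := by
  have hterm : ∀ l, (1 - t) * z₁ * blockRL t m z₁ z₂ i l =
      -(t ^ i * (1 - t) * z₁) * (((t ^ l)⁻¹ - (t ^ (l + 1))⁻¹) *
        (if l < i + 1 then z₂ else t ^ m * z₁))
      + (if l = i then (1 - t) * z₁ * t⁻¹ * (t ^ m * z₁ - z₂) else 0) := by
    intro l
    have e : (if i < l then t ^ m * z₁ else z₂) = if l < i + 1 then z₂ else t ^ m * z₁ := by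
      by_cases h : i < l
      · rw [if_pos h, if_neg (by omega)]
      · rw [if_neg h, if_pos (by omega)]
    unfold blockRL
    rw [e]
    rcases eq_or_ne l i with rfl | h
    · generalize (if l < l + 1 then z₂ else t ^ m * z₁) = x
      simp only [if_true]
      field_simp
      ring
    · generalize (if l < i + 1 then z₂ else t ^ m * z₁) = x
      simp only [h, h.symm, if_false]
      field_simp
      ring
  simp_rw [hterm]
  rw [Finset.sum_add_distrib, ← Finset.mul_sum, Finset.sum_ite_eq',
    if_pos (Finset.mem_range.2 hi),
    sum_telescope_step (fun l => (t ^ l)⁻¹) _ _ (show i + 1 ≤ m by omega)]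
  field_simp
  ring

/-- The `v₀ ⊗ v₀` diagonal coefficient of `R^L_R ∘ R^R_L`. -/
theorem sum_zeroRL_mul_zeroLR :
    (z₂ - z₁) * (z₂ - t * t ^ m * z₁)
        + ∑ l ∈ Finset.range m, (1 - t) * z₁ * (t ^ m * (t ^ (l + 1))⁻¹ * (1 - t) * z₂)
      = (z₂ - t * z₁) * (z₂ - t ^ m * z₁) := by
  have hterm : ∀ l, (1 - t) * z₁ * (t ^ m * (t ^ (l + 1))⁻¹ * (1 - t) * z₂) =
      (1 - t) * z₁ * t ^ m * z₂ * ((t ^ (l + 1))⁻¹ - (t ^ l)⁻¹) := by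
    intro l
    field_simp
    ring
  simp_rw [hterm]
  rw [← Finset.mul_sum, Finset.sum_range_sub (fun l => (t ^ l)⁻¹)]
  field_simp
  ring

/-- The column of `R^R_L ∘ R^L_R` indexed by `v₀ ⊗ v₀`, row at a color. -/
theorem sum_zeroLR_mul_blockRL {j : ℕ} (hj : j < m) :
    t ^ m * (t ^ (j + 1))⁻¹ * (1 - t) * z₂ * (z₂ - z₁)
        + ∑ l ∈ Finset.range m, blockRL t m z₁ z₂ l j * ((1 - t) * z₂)
      = 0 := by
  have hterm : ∀ l, blockRL t m z₁ z₂ l j * ((1 - t) * z₂) =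
      (t ^ (j + 1))⁻¹ * (1 - t) * z₂ * ((t ^ l - t ^ (l + 1)) *
        (if l < j then t ^ m * z₁ else z₂))
      + (if l = j then t⁻¹ * (t ^ m * z₁ - z₂) * ((1 - t) * z₂) else 0) := by
    intro l
    unfold blockRL
    rcases eq_or_ne l j with rfl | h
    · generalize (if l < l then t ^ m * z₁ else z₂) = x
      simp only [if_true]
      field_simp
      ring
    · generalize (if l < j then t ^ m * z₁ else z₂) = x
      simp only [h, if_false]
      field_simp
      ring
  simp_rw [hterm]
  rw [Finset.sum_add_distrib, ← Finset.mul_sum, Finset.sum_ite_eq',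
    if_pos (Finset.mem_range.2 hj), sum_telescope_step (fun l => t ^ l) _ _ hj.le]
  field_simp
  ring

omit ht in
/-- The row of `R^R_L ∘ R^L_R` indexed by `v₀ ⊗ v₀`, column at a color. -/
theorem sum_blockLR_mul_zeroRL {i : ℕ} (hi : i < m) :
    (z₂ - t * t ^ m * z₁) * ((1 - t) * z₁)
        + ∑ l ∈ Finset.range m, t ^ l * (1 - t) * z₁ * blockLR t z₁ z₂ i l
      = 0 := by
  have hterm : ∀ l, t ^ l * (1 - t) * z₁ * blockLR t z₁ z₂ i l =
      -(1 - t) * z₁ * ((t ^ l - t ^ (l + 1)) * (if l < i + 1 then z₂ else t * z₁))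
      + (if l = i then t ^ i * (1 - t) * z₁ * (t * (t * z₁ - z₂)) else 0) := by
    intro l
    have e : (if i < l then t * z₁ else z₂) = if l < i + 1 then z₂ else t * z₁ := by
      by_cases h : i < l
      · rw [if_pos h, if_neg (by omega)]
      · rw [if_neg h, if_pos (by omega)]
    unfold blockLR
    rw [e]
    rcases eq_or_ne l i with rfl | h
    · generalize (if l < l + 1 then z₂ else t * z₁) = x
      simp only [if_true]
      ring
    · generalize (if l < i + 1 then z₂ else t * z₁) = x
      simp only [h, h.symm, if_false]
      ring
  simp_rw [hterm]
  rw [Finset.sum_add_distrib, ← Finset.mul_sum, Finset.sum_ite_eq',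
    if_pos (Finset.mem_range.2 hi),
    sum_telescope_step (fun l => t ^ l) _ _ (show i + 1 ≤ m by omega)]
  ring

omit ht in
/-- The `v₀ ⊗ v₀` diagonal coefficient of `R^R_L ∘ R^L_R`. -/
theorem sum_zeroLR_mul_zeroRL :
    (z₂ - t * t ^ m * z₁) * (z₂ - z₁)
        + ∑ l ∈ Finset.range m, t ^ l * (1 - t) * z₁ * ((1 - t) * z₂)
      = (z₂ - t * z₁) * (z₂ - t ^ m * z₁) := by
  have hterm : ∀ l, t ^ l * (1 - t) * z₁ * ((1 - t) * z₂) =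
      -((1 - t) * z₁ * z₂) * (t ^ (l + 1) - t ^ l) := by
    intro l
    ring
  simp_rw [hterm]
  rw [← Finset.mul_sum, Finset.sum_range_sub (fun l => t ^ l)]
  ring

end Blocks

/-- A product of two matrices on `V ⊗ V` that swap `v_a ⊗ v_b` (`a ≠ b`) up to scalars and
preserve the span of the `v_a ⊗ v_a` is scalar as soon as it is so on both kinds of vectors. -/
theorem mul_eq_smul_one_of_swap_or_diag {ι : Type*} [Fintype ι] [DecidableEq ι]
    (M N : Matrix (ι × ι) (ι × ι) K) (c : K)
    (hM : ∀ o i : ι × ι, o ≠ i.swap → ¬(o.1 = o.2 ∧ i.1 = i.2) → M o i = 0)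
    (hN : ∀ o i : ι × ι, o ≠ i.swap → ¬(o.1 = o.2 ∧ i.1 = i.2) → N o i = 0)
    (hswap : ∀ a b, a ≠ b → M (a, b) (b, a) * N (b, a) (a, b) = c)
    (hdiag : ∀ a b, ∑ l, M (a, a) (l, l) * N (l, l) (b, b) = if a = b then c else 0) :
    M * N = c • (1 : Matrix (ι × ι) (ι × ι) K) := by
  ext o ⟨a, b⟩
  rw [Matrix.mul_apply, Matrix.smul_apply, Matrix.one_apply, smul_eq_mul, mul_ite, mul_one,
    mul_zero]
  by_cases hab : a = b
  · subst hab
    rw [Fintype.sum_prod_type]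
    have hin : ∀ x, ∑ y, M o (x, y) * N (x, y) (a, a) = M o (x, x) * N (x, x) (a, a) := by
      intro x
      refine Finset.sum_eq_single x (fun y _ hy => ?_) (by simp)
      rw [hN (x, y) (a, a) (by rintro h; simp_all) (by rintro ⟨h, -⟩; exact hy h.symm), mul_zero]
    simp_rw [hin]
    obtain ⟨o1, o2⟩ := o
    by_cases ho : o1 = o2
    · subst ho
      rw [hdiag]
      simp
    · rw [if_neg (by rintro h; simp_all)]
      refine Finset.sum_eq_zero fun x _ => ?_
      rw [hM (o1, o2) (x, x) (by rintro h; simp_all) (by rintro ⟨h, -⟩; exact ho h), zero_mul]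
  · rw [Finset.sum_eq_single (b, a)]
    · by_cases ho : o = (a, b)
      · rw [ho, if_pos rfl, hswap a b hab]
      · rw [if_neg ho, hM o (b, a) ho (by rintro ⟨-, h⟩; exact hab h.symm), zero_mul]
    · intro x _ hx
      rw [hN x (a, b) hx (by rintro ⟨-, h⟩; exact hab h), mul_zero]
    · simp

section Weights

/-- The position of the color `l + 1` in the cyclic order `k, k+1, …, m, 1, …, k-1`. -/
def cyclicPos (m k l : ℕ) : ℕ := if k ≤ l + 1 then l + 1 - k else l + 1 + m - k

theorem cyclicPos_lt {m k l : ℕ} (hk : 1 ≤ k) (hl : l < m) : cyclicPos m k l < m := by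
  unfold cyclicPos; split_ifs <;> omega

theorem cyclicPos_inj {m k l j : ℕ} (hkm : k ≤ m) (hl : l < m) (hj : j < m) :
    cyclicPos m k l = cyclicPos m k j ↔ l = j := by
  unfold cyclicPos; split_ifs <;> omega

theorem Ccond_iff_cyclicPos_lt {m k l j : ℕ} (hkm : k ≤ m) (hl : l < m) (hj : j < m) :
    Ccond (l + 1) (j + 1) k ↔ cyclicPos m k l < cyclicPos m k j := by
  unfold cyclicPos Ccond; split_ifs <;> omega

theorem sum_cyclicPos {m k : ℕ} (hk : 1 ≤ k) (hkm : k ≤ m) (F : ℕ → K) :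
    ∑ l : Fin m, F (cyclicPos m k l) = ∑ l ∈ Finset.range m, F l := by
  rw [Fin.sum_univ_eq_sum_range (fun l => F (cyclicPos m k l)) m]
  refine Finset.sum_nbij' (cyclicPos m k)
    (fun x => if x + k ≤ m then x + k - 1 else x + k - m - 1) ?_ ?_ ?_ ?_ ?_
  · intro l hl
    exact Finset.mem_range.2 (cyclicPos_lt hk (Finset.mem_range.1 hl))
  · intro x hx
    rw [Finset.mem_range] at hx ⊢
    split_ifs <;> omega
  · intro l hl
    rw [Finset.mem_range] at hl
    unfold cyclicPos
    split_ifs <;> omega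
  · intro x hx
    rw [Finset.mem_range] at hx
    unfold cyclicPos
    split_ifs <;> omega
  · intro l _
    rfl

theorem emod_eq_of_eq_add_mul {m : ℕ} {x r : ℤ} (c : ℤ) (h : x = r + m * c) (h0 : 0 ≤ r)
    (h1 : r < m) : x % m = r := by
  rw [h, Int.add_mul_emod_self_left, Int.emod_eq_of_lt h0 h1]

theorem resLo_color_sub {m k l : ℕ} (hk : 1 ≤ k) (hkm : k ≤ m) (hl : l < m) :
    resLo m (((l + 1 : ℕ) : ℤ) - k) = cyclicPos m k l := by
  unfold resLo cyclicPos
  split_ifs with h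
  · exact emod_eq_of_eq_add_mul 0 (by omega) (by omega) (by omega)
  · exact emod_eq_of_eq_add_mul (-1) (by omega) (by omega) (by omega)

theorem resHi_sub_color {m k l : ℕ} (hk : 1 ≤ k) (hkm : k ≤ m) (hl : l < m) :
    resHi m ((k : ℤ) - ((l + 1 : ℕ) : ℤ)) = m - cyclicPos m k l := by
  unfold resHi cyclicPos
  split_ifs with h
  · rw [emod_eq_of_eq_add_mul (r := m - (l + 1 - k : ℕ) - 1) (-1) (by omega) (by omega) (by omega)]
    ring
  · rw [emod_eq_of_eq_add_mul (r := k - (l + 1) - 1) 0 (by omega) (by omega) (by omega)]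
    omega

theorem resLo_color_sub_color {m k l j : ℕ} (hk : 1 ≤ k) (hkm : k ≤ m) (hl : l < m) (hj : j < m) :
    resLo m (((l + 1 : ℕ) : ℤ) - ((j + 1 : ℕ) : ℤ)) =
      cyclicPos m k l - cyclicPos m k j
        + if cyclicPos m k l < cyclicPos m k j then (m : ℤ) else 0 := by
  unfold resLo cyclicPos
  split_ifs <;>
  first
  | exact emod_eq_of_eq_add_mul 0 (by omega) (by omega) (by omega)
  | exact emod_eq_of_eq_add_mul (-1) (by omega) (by omega) (by omega)

variable {m : ℕ} {q Φ : K} (X : ℕ → ℕ → K) (z z' : K) {k : ℕ}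

theorem wtLR_eq_zero {nw sw ne se : Fin (m + 1)} (h1 : ¬(se = nw ∧ ne = sw))
    (h2 : ¬(se = ne ∧ sw = nw)) : wtLR m q Φ X z z' k nw sw ne se = 0 := by
  unfold wtLR
  repeat rw [if_neg (by rintro h; simp_all)]

theorem wtRL_eq_zero {nw sw ne se : Fin (m + 1)} (h1 : ¬(se = nw ∧ ne = sw))
    (h2 : ¬(se = ne ∧ sw = nw)) : wtRL m q Φ X z z' k nw sw ne se = 0 := by
  unfold wtRL
  repeat rw [if_neg (by rintro h; simp_all)]

theorem wtLR_zero_zero : wtLR m q Φ X z z' k 0 0 0 0 = z - z' := by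
  simp [wtLR]

theorem wtLR_zero_color (j : Fin m) :
    wtLR m q Φ X z z' k 0 0 j.succ j.succ = Φ * ((1 - q ^ 2) * z) := by
  simp [wtLR, mul_assoc]

theorem wtLR_color_zero (l : Fin m) :
    wtLR m q Φ X z z' k l.succ l.succ 0 0 = Φ * ((1 - q ^ 2) * z') := by
  simp [wtLR, (Fin.succ_ne_zero _).symm, mul_assoc]

theorem wtLR_color_color (hkm : k ≤ m) (l j : Fin m) :
    wtLR m q Φ X z z' k l.succ l.succ j.succ j.succ =
      Φ ^ 2 * blockLR (q ^ 2) z' z (cyclicPos m k l) (cyclicPos m k j) := by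
  by_cases h : l = j
  · subst h
    simp only [wtLR, blockLR, Fin.succ_ne_zero, ne_eq, not_true, not_false_eq_true, and_self,
      and_false, false_and, lt_irrefl, if_true, if_false]
    ring
  · have hne : ¬ cyclicPos m k l = cyclicPos m k j := by
      rw [cyclicPos_inj hkm l.2 j.2]
      exact fun h' => h (Fin.ext h')
    have c1 := Ccond_iff_cyclicPos_lt hkm l.2 j.2
    have c2 := Ccond_iff_cyclicPos_lt hkm j.2 l.2
    simp only [wtLR, blockLR, Fin.succ_ne_zero, Fin.succ_inj, Ne.symm h, Fin.val_succ, c1, c2,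
      hne]
    rcases lt_or_gt_of_ne hne with h' | h'
    · simp [h', Ne.symm h]; ring
    · simp [h', h'.not_gt, Ne.symm h]; ring

theorem wtRL_zero_zero :
    wtRL m q Φ X z z' k 0 0 0 0 = z' - q ^ 2 * (q ^ 2) ^ m * z := by
  simp only [wtRL, and_self, if_true]
  ring

theorem wtRL_zero_color (hq : q ≠ 0) (hk : 1 ≤ k) (hkm : k ≤ m) (j : Fin m) :
    wtRL m q Φ X z z' k 0 0 j.succ j.succ =
      Φ⁻¹ * ((q ^ 2) ^ m * ((q ^ 2) ^ (cyclicPos m k j + 1))⁻¹ * (1 - q ^ 2) * z') := by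
  have e : q ^ (2 * ((m : ℤ) - cyclicPos m k j) - 2) =
      (q ^ 2) ^ m * ((q ^ 2) ^ (cyclicPos m k j + 1))⁻¹ := by
    rw [← pow_mul, ← pow_mul, ← zpow_natCast, ← zpow_natCast, ← _root_.zpow_neg, ← zpow_add₀ hq]
    congr 1
    push_cast
    ring
  rw [← e, ← resHi_sub_color hk hkm j.2]
  simp only [wtRL, Fin.succ_ne_zero, ne_eq, not_true,
    not_false_eq_true, and_self, and_false, false_and, if_true, if_false, Fin.val_succ]
  ring

theorem wtRL_color_zero (hk : 1 ≤ k) (hkm : k ≤ m) (l : Fin m) :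
    wtRL m q Φ X z z' k l.succ l.succ 0 0 =
      Φ⁻¹ * ((q ^ 2) ^ cyclicPos m k l * (1 - q ^ 2) * z) := by
  have e : q ^ (2 * (cyclicPos m k l : ℤ)) = (q ^ 2) ^ cyclicPos m k l := by
    rw [← pow_mul, ← zpow_natCast]
    congr 1
  rw [← e, ← resLo_color_sub hk hkm l.2]
  simp only [wtRL, Fin.succ_ne_zero, (Fin.succ_ne_zero _).symm, ne_eq, not_true,
    not_false_eq_true, and_self, and_false, false_and, if_true, if_false, Fin.val_succ]
  ring

theorem wtRL_color_color (hq : q ≠ 0) (hk : 1 ≤ k) (hkm : k ≤ m) (l j : Fin m) :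
    wtRL m q Φ X z z' k l.succ l.succ j.succ j.succ =
      (Φ ^ 2)⁻¹ * blockRL (q ^ 2) m z z' (cyclicPos m k l) (cyclicPos m k j) := by
  by_cases h : l = j
  · subst h
    have e : q ^ (2 * m - 2) = (q ^ 2)⁻¹ * (q ^ 2) ^ m := by
      obtain ⟨n, rfl⟩ : ∃ n, m = n + 1 := ⟨m - 1, by omega⟩
      rw [show 2 * (n + 1) - 2 = 2 * n by omega, pow_mul]
      rw [pow_succ' (q ^ 2) n, inv_mul_cancel_left₀ (pow_ne_zero 2 hq)]
    simp [wtRL, blockRL, e]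
    field_simp
    ring
  · have hne : ¬ cyclicPos m k l = cyclicPos m k j := by
      rw [cyclicPos_inj hkm l.2 j.2]
      exact fun h' => h (Fin.ext h')
    have c1 := Ccond_iff_cyclicPos_lt hkm l.2 j.2
    have c2 := Ccond_iff_cyclicPos_lt hkm j.2 l.2
    have r := resLo_color_sub_color hk hkm l.2 j.2
    simp only [wtRL, blockRL, Fin.succ_ne_zero, Fin.succ_inj, Ne.symm h, Fin.val_succ, c1, c2,
      hne, r]
    generalize cyclicPos m k l = a at *
    generalize cyclicPos m k j = b at *
    have e0 : q ^ (2 * ((a : ℤ) - b) - 2) = (q ^ 2) ^ a * ((q ^ 2) ^ (b + 1))⁻¹ := by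
      rw [← pow_mul, ← pow_mul, ← zpow_natCast, ← zpow_natCast, ← _root_.zpow_neg, ← zpow_add₀ hq]
      congr 1
      push_cast
      ring
    have e1 : q ^ (2 * ((a : ℤ) - b + m) - 2) =
        (q ^ 2) ^ a * ((q ^ 2) ^ (b + 1))⁻¹ * (q ^ 2) ^ m := by
      rw [← e0, ← pow_mul, ← zpow_natCast, ← zpow_add₀ hq]
      congr 1
      push_cast
      ring
    rcases lt_or_gt_of_ne hne with h' | h'
    · simp [h', Ne.symm h, e1]; ring
    · simp [h', h'.not_gt, Ne.symm h, e0]; ring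

theorem wtLR_mul_wtRL_swap (hq : q ≠ 0) (hΦ : Φ ≠ 0)
    (hXoff : ∀ i j, 1 ≤ i → i ≤ m → 1 ≤ j → j ≤ m → i ≠ j → X i j * X j i = q ^ 2)
    (z₁ z₂ : K) {a b : Fin (m + 1)} (hab : a ≠ b) :
    wtLR m q Φ X z₂ z₁ k a b b a * wtRL m q Φ X z₁ z₂ k b a a b =
      (z₂ - q ^ 2 * z₁) * (z₂ - q ^ (2 * m) * z₁) := by
  cases a using Fin.cases with
  | zero =>
    cases b using Fin.cases with
    | zero => exact absurd rfl hab
    | succ b =>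
      simp [wtLR, wtRL]
      field_simp
  | succ a =>
    cases b using Fin.cases with
    | zero =>
      simp [wtLR, wtRL]
      field_simp
    | succ b =>
      have hab' : a ≠ b := fun h => hab (by rw [h])
      have hX := hXoff (a + 1) (b + 1) (by omega) (by omega) (by omega) (by omega)
        (fun h => hab' (Fin.ext (by omega)))
      simp only [wtLR, wtRL, Fin.succ_ne_zero, Fin.succ_inj, hab', hab'.symm, Fin.val_succ]
      simp [hab', hab'.symm]
      field_simp
      linear_combination (z₂ - q ^ 2 * z₁) * (z₂ - q ^ (2 * m) * z₁) * hX

end Weights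

/-- The mixed `R`-matrices satisfy
`R^L_R(z₂,z₁;k) ∘ R^R_L(z₁,z₂;k) = C · id` and `R^R_L(z₁,z₂;k) ∘ R^L_R(z₂,z₁;k) = C · id`
with `C = (z₂ − q²z₁)(z₂ − q^{2m}z₁)`. -/
theorem mixed_R_inverse (m : ℕ) (hm : 1 ≤ m) (K : Type*) [Field K]
    (q Φ : K) (hq : q ≠ 0) (hΦ : Φ ≠ 0) (z₁ z₂ : K)
    (X : ℕ → ℕ → K)
    (hXdiag : ∀ i, 1 ≤ i → i ≤ m → X i i = -(q ^ 2))
    (hXoff : ∀ i j, 1 ≤ i → i ≤ m → 1 ≤ j → j ≤ m → i ≠ j → X i j * X j i = q ^ 2) :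
    ∀ k : ℕ, 1 ≤ k → k ≤ m →
      (RmatLR m q Φ X z₂ z₁ k).mulVecLin ∘ₗ (RmatRL m q Φ X z₁ z₂ k).mulVecLin
          = ((z₂ - q ^ 2 * z₁) * (z₂ - q ^ (2 * m) * z₁)) •
              (LinearMap.id : (Fin (m + 1) × Fin (m + 1) → K) →ₗ[K] _) ∧
      (RmatRL m q Φ X z₁ z₂ k).mulVecLin ∘ₗ (RmatLR m q Φ X z₂ z₁ k).mulVecLin
          = ((z₂ - q ^ 2 * z₁) * (z₂ - q ^ (2 * m) * z₁)) •
              (LinearMap.id : (Fin (m + 1) × Fin (m + 1) → K) →ₗ[K] _) := by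
  intro k hk hkm
  have ht : q ^ 2 ≠ 0 := pow_ne_zero 2 hq
  have hLR : ∀ o i : Fin (m + 1) × Fin (m + 1), o ≠ i.swap → ¬(o.1 = o.2 ∧ i.1 = i.2) →
      RmatLR m q Φ X z₂ z₁ k o i = 0 := fun o i h1 h2 =>
    wtLR_eq_zero X _ _ (fun h => h1 (Prod.ext h.1 h.2)) h2
  have hRL : ∀ o i : Fin (m + 1) × Fin (m + 1), o ≠ i.swap → ¬(o.1 = o.2 ∧ i.1 = i.2) →
      RmatRL m q Φ X z₁ z₂ k o i = 0 := fun o i h1 h2 =>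
    wtRL_eq_zero X _ _ (fun h => h1 (Prod.ext h.1 h.2)) h2
  have key : ∀ M N : Matrix (Fin (m + 1) × Fin (m + 1)) (Fin (m + 1) × Fin (m + 1)) K, ∀ c : K,
      M * N = c • 1 → M.mulVecLin ∘ₗ N.mulVecLin = c • LinearMap.id := by
    intro M N c h
    rw [← Matrix.mulVecLin_mul, h]
    ext v i
    simp
  constructor
  · refine key _ _ _ (mul_eq_smul_one_of_swap_or_diag _ _ _ hLR hRL
      (fun a b hab => wtLR_mul_wtRL_swap X hq hΦ hXoff z₁ z₂ hab) fun a b => ?_)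
    rw [Fin.sum_univ_succ, pow_mul]
    simp only [RmatLR, RmatRL]
    rcases Fin.eq_zero_or_eq_succ a with rfl | ⟨a, rfl⟩ <;>
      rcases Fin.eq_zero_or_eq_succ b with rfl | ⟨b, rfl⟩
    · have h := sum_zeroRL_mul_zeroLR ht m z₁ z₂
      rw [← sum_cyclicPos hk hkm (fun l =>
        (1 - q ^ 2) * z₁ * ((q ^ 2) ^ m * ((q ^ 2) ^ (l + 1))⁻¹ * (1 - q ^ 2) * z₂))] at h
      refine Eq.trans ?_ (h.trans (if_pos rfl).symm)
      simp only [wtLR_zero_zero, wtLR_color_zero,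
        wtRL_zero_zero, wtRL_zero_color X _ _ hq hk hkm]
      refine congrArg₂ (· + ·) ?_ (Finset.sum_congr rfl fun l _ => ?_) <;> field_simp
    · have hb := cyclicPos_lt hk b.2
      have h := sum_blockRL_mul_zeroLR ht m z₁ z₂ hb
      rw [← sum_cyclicPos hk hkm (fun l =>
        (1 - q ^ 2) * z₁ * blockRL (q ^ 2) m z₁ z₂ (cyclicPos m k b) l)] at h
      rw [if_neg (Fin.succ_ne_zero _).symm, ← mul_zero Φ⁻¹, ← h, mul_add, Finset.mul_sum]
      simp only [wtLR_zero_zero, wtLR_color_zero,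
        wtRL_color_zero X _ _ hk hkm, wtRL_color_color X _ _ hq hk hkm]
      refine congrArg₂ (· + ·) ?_ (Finset.sum_congr rfl fun l _ => ?_) <;> field_simp
    · have ha := cyclicPos_lt hk a.2
      have h := sum_zeroRL_mul_blockLR ht m z₁ z₂ ha
      rw [← sum_cyclicPos hk hkm (fun l =>
        blockLR (q ^ 2) z₁ z₂ l (cyclicPos m k a) *
          ((q ^ 2) ^ m * ((q ^ 2) ^ (l + 1))⁻¹ * (1 - q ^ 2) * z₂))] at h
      rw [if_neg (Fin.succ_ne_zero _), ← mul_zero Φ, ← h, mul_add, Finset.mul_sum]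
      simp only [wtLR_zero_color, wtLR_color_color X _ _ hkm,
        wtRL_zero_zero, wtRL_zero_color X _ _ hq hk hkm]
      refine congrArg₂ (· + ·) ?_ (Finset.sum_congr rfl fun l _ => ?_) <;> field_simp
    · have hb := cyclicPos_lt hk b.2
      have ha := cyclicPos_lt hk a.2
      have h := sum_blockRL_mul_blockLR ht m z₁ z₂ hb ha
      rw [← sum_cyclicPos hk hkm (fun l =>
        blockLR (q ^ 2) z₁ z₂ l (cyclicPos m k a) *
          blockRL (q ^ 2) m z₁ z₂ (cyclicPos m k b) l)] at h
      refine Eq.trans ?_ (h.trans (if_congr ?_ rfl rfl))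
      swap
      · rw [cyclicPos_inj hkm a.2 b.2, ← Fin.ext_iff, ← Fin.succ_inj]
      simp only [wtLR_zero_color, wtLR_color_color X _ _ hkm,
        wtRL_color_zero X _ _ hk hkm, wtRL_color_color X _ _ hq hk hkm]
      refine congrArg₂ (· + ·) ?_ (Finset.sum_congr rfl fun l _ => ?_) <;> field_simp
  · refine key _ _ _ (mul_eq_smul_one_of_swap_or_diag _ _ _ hRL hLR
      (fun a b hab => (mul_comm _ _).trans
        (wtLR_mul_wtRL_swap X hq hΦ hXoff z₁ z₂ hab.symm)) fun a b => ?_)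
    rw [Fin.sum_univ_succ, pow_mul]
    simp only [RmatLR, RmatRL]
    rcases Fin.eq_zero_or_eq_succ a with rfl | ⟨a, rfl⟩ <;>
      rcases Fin.eq_zero_or_eq_succ b with rfl | ⟨b, rfl⟩
    · have h := sum_zeroLR_mul_zeroRL (t := q ^ 2) m z₁ z₂
      rw [← sum_cyclicPos hk hkm (fun l =>
        (q ^ 2) ^ l * (1 - q ^ 2) * z₁ * ((1 - q ^ 2) * z₂))] at h
      refine Eq.trans ?_ (h.trans (if_pos rfl).symm)
      simp only [wtRL_zero_zero, wtRL_color_zero X _ _ hk hkm,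
        wtLR_zero_zero, wtLR_zero_color]
      refine congrArg₂ (· + ·) ?_ (Finset.sum_congr rfl fun l _ => ?_) <;> field_simp
    · have hb := cyclicPos_lt hk b.2
      have h := sum_blockLR_mul_zeroRL (t := q ^ 2) m z₁ z₂ hb
      rw [← sum_cyclicPos hk hkm (fun l =>
        (q ^ 2) ^ l * (1 - q ^ 2) * z₁ * blockLR (q ^ 2) z₁ z₂ (cyclicPos m k b) l)] at h
      rw [if_neg (Fin.succ_ne_zero _).symm, ← mul_zero Φ, ← h, mul_add, Finset.mul_sum]
      simp only [wtRL_zero_zero, wtRL_color_zero X _ _ hk hkm,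
        wtLR_color_zero, wtLR_color_color X _ _ hkm]
      refine congrArg₂ (· + ·) ?_ (Finset.sum_congr rfl fun l _ => ?_) <;> field_simp
    · have ha := cyclicPos_lt hk a.2
      have h := sum_zeroLR_mul_blockRL ht m z₁ z₂ ha
      rw [← sum_cyclicPos hk hkm (fun l =>
        blockRL (q ^ 2) m z₁ z₂ l (cyclicPos m k a) *
          ((1 - q ^ 2) * z₂))] at h
      rw [if_neg (Fin.succ_ne_zero _), ← mul_zero Φ⁻¹, ← h, mul_add, Finset.mul_sum]
      simp only [wtRL_zero_color X _ _ hq hk hkm, wtRL_color_color X _ _ hq hk hkm,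
        wtLR_zero_zero, wtLR_zero_color]
      refine congrArg₂ (· + ·) ?_ (Finset.sum_congr rfl fun l _ => ?_) <;> field_simp
    · have hb := cyclicPos_lt hk b.2
      have ha := cyclicPos_lt hk a.2
      have h := sum_blockLR_mul_blockRL ht m z₁ z₂ hb ha
      rw [← sum_cyclicPos hk hkm (fun l =>
        blockRL (q ^ 2) m z₁ z₂ l (cyclicPos m k a) *
          blockLR (q ^ 2) z₁ z₂ (cyclicPos m k b) l)] at h
      refine Eq.trans ?_ (h.trans (if_congr ?_ rfl rfl))
      swap
      · rw [cyclicPos_inj hkm a.2 b.2, ← Fin.ext_iff, ← Fin.succ_inj]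
      simp only [wtRL_zero_color X _ _ hq hk hkm, wtRL_color_color X _ _ hq hk hkm,
        wtLR_color_zero, wtLR_color_color X _ _ hkm]
      refine congrArg₂ (· + ·) ?_ (Finset.sum_congr rfl fun l _ => ?_) <;> field_simp

end Stmt1
end

section
/- Let V_X, V_Y, W be vector spaces over a field K and let R_{XY} : V_X ⊗ V_Y → V_Y ⊗ V_X and R_{YX} : V_Y ⊗ V_X → V_X ⊗ V_Y be linear maps with R_{XY} ∘ R_{YX} = id_{V_Y ⊗ V_X} and R_{YX} ∘ R_{XY} = id_{V_X ⊗ V_Y}. Then for all linear maps T_X : V_X ⊗ W → W ⊗ V_X, T_Y : V_Y ⊗ W → W ⊗ V_Y and R_{YY} : V_Y ⊗ V_Y → V_Y ⊗ V_Y, the following three identities hold: (id_W ⊗ R_{YX}) ∘ ⟦R_{XY}, T_X, T_Y⟧ ∘ (R_{YX} ⊗ id_W) = −⟦R_{YX}, T_Y, T_X⟧; (id_{V_Y} ⊗ R_{YX}) ∘ ⟦R_{XY}, R_{XY}, R_{YY}⟧ ∘ (R_{YX} ⊗ id_{V_Y}) = −⟦R_{YX}, R_{YY}, R_{XY}⟧;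 and (R_{YX} ⊗ id_{V_Y}) ∘ ⟦R_{YX}, R_{YY}, R_{XY}⟧ ∘ (id_{V_Y} ⊗ R_{YX}) = −⟦R_{YY}, R_{YX}, R_{YX}⟧. -/
open TensorProduct

namespace YB

variable (K : Type*) [Field K]
variable {U V W : Type*} [AddCommGroup U] [AddCommGroup V] [AddCommGroup W]
  [Module K U] [Module K V] [Module K W]

/-- The Yang–Baxter commutator
`⟦R,S,T⟧ = (id_W ⊗ R)(S ⊗ id_V)(id_U ⊗ T) − (T ⊗ id_U)(id_V ⊗ S)(R ⊗ id_W)`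
as a linear map `U ⊗ V ⊗ W → W ⊗ V ⊗ U` (with the canonical associators inserted). -/
noncomputable def yb (R : U ⊗[K] V →ₗ[K] V ⊗[K] U) (S : U ⊗[K] W →ₗ[K] W ⊗[K] U)
    (T : V ⊗[K] W →ₗ[K] W ⊗[K] V) :
    (U ⊗[K] (V ⊗[K] W)) →ₗ[K] (W ⊗[K] (V ⊗[K] U)) :=
  (TensorProduct.map (LinearMap.id : W →ₗ[K] W) R
      ∘ₗ (TensorProduct.assoc K W U V).toLinearMap
      ∘ₗ TensorProduct.map S (LinearMap.id : V →ₗ[K] V)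
      ∘ₗ (TensorProduct.assoc K U W V).symm.toLinearMap
      ∘ₗ TensorProduct.map (LinearMap.id : U →ₗ[K] U) T)
  - ((TensorProduct.assoc K W V U).toLinearMap
      ∘ₗ TensorProduct.map T (LinearMap.id : U →ₗ[K] U)
      ∘ₗ (TensorProduct.assoc K V W U).symm.toLinearMap
      ∘ₗ TensorProduct.map (LinearMap.id : V →ₗ[K] V) S
      ∘ₗ (TensorProduct.assoc K V U W).toLinearMap
      ∘ₗ TensorProduct.map R (LinearMap.id : W →ₗ[K] W)
      ∘ₗ (TensorProduct.assoc K U V W).symm.toLinearMap)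

/-- `f ⊗ id_W` acting on a right-nested triple tensor product, with the canonical
associators inserted. -/
noncomputable def tenIdW {A B C D : Type*}
    [AddCommGroup A] [AddCommGroup B] [AddCommGroup C] [AddCommGroup D]
    [Module K A] [Module K B] [Module K C] [Module K D]
    (f : A ⊗[K] B →ₗ[K] C ⊗[K] D) :
    (A ⊗[K] (B ⊗[K] W)) →ₗ[K] (C ⊗[K] (D ⊗[K] W)) :=
  (TensorProduct.assoc K C D W).toLinearMap
    ∘ₗ TensorProduct.map f (LinearMap.id : W →ₗ[K] W)
    ∘ₗ (TensorProduct.assoc K A B W).symm.toLinearMap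

section Conjugation

variable {K}

theorem yb_eq_tenIdW (R : U ⊗[K] V →ₗ[K] V ⊗[K] U) (S : U ⊗[K] W →ₗ[K] W ⊗[K] U)
    (T : V ⊗[K] W →ₗ[K] W ⊗[K] V) :
    yb K R S T = TensorProduct.map LinearMap.id R ∘ₗ tenIdW K S ∘ₗ TensorProduct.map LinearMap.id T
      - tenIdW K T ∘ₗ TensorProduct.map LinearMap.id S ∘ₗ tenIdW K R :=
  rfl

theorem tenIdW_comp {A B C D E F : Type*}
    [AddCommGroup A] [AddCommGroup B] [AddCommGroup C] [AddCommGroup D]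
    [AddCommGroup E] [AddCommGroup F]
    [Module K A] [Module K B] [Module K C] [Module K D] [Module K E] [Module K F]
    (g : C ⊗[K] D →ₗ[K] E ⊗[K] F) (f : A ⊗[K] B →ₗ[K] C ⊗[K] D) :
    tenIdW K (W := W) (g ∘ₗ f) = tenIdW K g ∘ₗ tenIdW K f := by
  ext a b w
  simp [tenIdW]

theorem tenIdW_id : tenIdW K (W := W) (LinearMap.id : U ⊗[K] V →ₗ[K] U ⊗[K] V) =
    LinearMap.id := by
  ext a b w
  simp [tenIdW]

theorem map_id_comp_map_id {A B C : Type*} [AddCommGroup A] [AddCommGroup B] [AddCommGroup C]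
    [Module K A] [Module K B] [Module K C] {g : B →ₗ[K] C} {f : A →ₗ[K] B} {h : A →ₗ[K] C}
    (hgf : g ∘ₗ f = h) :
    TensorProduct.map (LinearMap.id : W →ₗ[K] W) g ∘ₗ TensorProduct.map LinearMap.id f =
      TensorProduct.map LinearMap.id h := by
  rw [← TensorProduct.map_comp, hgf, LinearMap.id_comp]

/-- Conjugating the Yang–Baxter commutator by the inverse of its first argument. -/
theorem map_id_comp_yb_comp_tenIdW {R : U ⊗[K] V →ₗ[K] V ⊗[K] U}
    {R' : V ⊗[K] U →ₗ[K] U ⊗[K] V} (h1 : R ∘ₗ R' = LinearMap.id) (h2 : R' ∘ₗ R = LinearMap.id)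
    (S : U ⊗[K] W →ₗ[K] W ⊗[K] U) (T : V ⊗[K] W →ₗ[K] W ⊗[K] V) :
    TensorProduct.map (LinearMap.id : W →ₗ[K] W) R' ∘ₗ yb K R S T ∘ₗ tenIdW K R' =
      -(yb K R' T S) := by
  have e1 := map_id_comp_map_id (W := W) h2
  have e2 := tenIdW_comp (W := W) R R'
  rw [TensorProduct.map_id] at e1
  rw [h1, tenIdW_id] at e2
  rw [yb_eq_tenIdW, yb_eq_tenIdW, LinearMap.sub_comp, LinearMap.comp_sub, neg_sub]
  congr 1
  · simp only [← LinearMap.comp_assoc]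
    rw [e1, LinearMap.id_comp]
  · simp only [LinearMap.comp_assoc]
    rw [← e2, LinearMap.comp_id]

/-- Conjugating the Yang–Baxter commutator by the inverse of its third argument. -/
theorem tenIdW_comp_yb_comp_map_id {T : V ⊗[K] W →ₗ[K] W ⊗[K] V}
    {T' : W ⊗[K] V →ₗ[K] V ⊗[K] W} (h1 : T ∘ₗ T' = LinearMap.id) (h2 : T' ∘ₗ T = LinearMap.id)
    (R : U ⊗[K] V →ₗ[K] V ⊗[K] U) (S : U ⊗[K] W →ₗ[K] W ⊗[K] U) :
    tenIdW K T' ∘ₗ yb K R S T ∘ₗ TensorProduct.map (LinearMap.id : U →ₗ[K] U) T' =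
      -(yb K S R T') := by
  have e1 := map_id_comp_map_id (W := U) h1
  have e2 := tenIdW_comp (W := U) T' T
  rw [TensorProduct.map_id] at e1
  rw [h2, tenIdW_id] at e2
  rw [yb_eq_tenIdW, yb_eq_tenIdW, LinearMap.sub_comp, LinearMap.comp_sub, neg_sub]
  congr 1
  · simp only [LinearMap.comp_assoc]
    rw [e1, LinearMap.comp_id]
  · simp only [← LinearMap.comp_assoc]
    rw [← e2, LinearMap.id_comp]

end Conjugation

/-- Conjugation identities for the Yang–Baxter commutator by the mutually
inverse `R`-matrices `R_{XY}` and `R_{YX}`. -/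
theorem yb_conjugation {K : Type*} [Field K]
    {VX VY W : Type*} [AddCommGroup VX] [AddCommGroup VY] [AddCommGroup W]
    [Module K VX] [Module K VY] [Module K W]
    (RXY : VX ⊗[K] VY →ₗ[K] VY ⊗[K] VX) (RYX : VY ⊗[K] VX →ₗ[K] VX ⊗[K] VY)
    (h1 : RXY ∘ₗ RYX = LinearMap.id) (h2 : RYX ∘ₗ RXY = LinearMap.id)
    (TX : VX ⊗[K] W →ₗ[K] W ⊗[K] VX) (TY : VY ⊗[K] W →ₗ[K] W ⊗[K] VY)
    (RYY : VY ⊗[K] VY →ₗ[K] VY ⊗[K] VY) :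
    (TensorProduct.map (LinearMap.id : W →ₗ[K] W) RYX
        ∘ₗ yb K RXY TX TY ∘ₗ tenIdW K RYX = -(yb K RYX TY TX)) ∧
    (TensorProduct.map (LinearMap.id : VY →ₗ[K] VY) RYX
        ∘ₗ yb K RXY RXY RYY ∘ₗ tenIdW K RYX = -(yb K RYX RYY RXY)) ∧
    (tenIdW K RYX ∘ₗ yb K RYX RYY RXY
        ∘ₗ TensorProduct.map (LinearMap.id : VY →ₗ[K] VY) RYX = -(yb K RYY RYX RYX)) :=
  ⟨map_id_comp_yb_comp_tenIdW h1 h2 TX TY, map_id_comp_yb_comp_tenIdW h1 h2 RXY RYY,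
    tenIdW_comp_yb_comp_map_id h1 h2 RYX RYY⟩

end YB
end

section
/- Let R be a commutative ring, M an R-module, and B : M × M → R an R-bilinear map that is alternating (B(u,u) = 0 for all u ∈ M, so in particular B(u,v) = −B(v,u)). Suppose a, b, c, d, e, f, i, j, k, l, m, n ∈ M satisfy the conservation equations a + b = i + j, j + k = e + f, i + c = d + k, b + c = n + l, a + n = f + m and m + l = d + e. Then B(a,b) + B(i,j) + B(i,c) + B(d,k) + B(j,k) + B(e,f) = B(a,n) + B(m,f) + B(b,c) + B(l,n) + B(m,l) + B(d,e). -/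
/-- Let `R` be a commutative ring, `M` an `R`-module and `B` an `R`-bilinear
alternating map `M × M → R`.  If `a, …, n` satisfy the conservation equations of the lattice
model, then the twisting factors on the two sides of the `RRR` Yang–Baxter equation agree. -/
theorem twisting_factors_agree
    (R : Type*) (M : Type*) [CommRing R] [AddCommGroup M] [Module R M]
    (B : M →ₗ[R] M →ₗ[R] R) (halt : ∀ u : M, B u u = 0)
    (a b c d e f i j k l m n : M)
    (h1 : a + b = i + j) (h2 : j + k = e + f) (h3 : i + c = d + k)
    (h4 : b + c = n + l) (h5 : a + n = f + m) (h6 : m + l = d + e) :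
    B a b + B i j + B i c + B d k + B j k + B e f
      = B a n + B m f + B b c + B l n + B m l + B d e := by
  have skew (u v : M) : B u v = -B v u := (LinearMap.IsAlt.neg halt v u).symm
  obtain rfl : j = a + b - i := eq_sub_of_add_eq' h1.symm
  obtain rfl : k = i + c - d := eq_sub_of_add_eq' h3.symm
  obtain rfl : l = b + c - n := eq_sub_of_add_eq' h4.symm
  obtain rfl : m = a + n - f := eq_sub_of_add_eq' h5.symm
  obtain rfl : e = a + b + c - d - f := by
    rw [eq_sub_of_add_eq h2.symm]; abel
  simp only [map_add, map_sub, LinearMap.add_apply, LinearMap.sub_apply, halt]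
  linear_combination skew i a + skew i b + skew d i - skew d a - skew d b
    - skew n b - skew n c - skew f n + skew f b + skew f c
end

section
/- Let m ≥ 1 and let K = ℚ(z) be the field of rational functions in one variable z. Consider the fused crystal vertex configurations of the context. For the fused crystal Γ weights: if the fused weight of a configuration (a, S_top, c, S_bot) is nonzero and S_bot contains at most one color, then S_top contains at most one color. The same statement holds for the fused crystal Δ weights. -/
namespace Stmt8

/-- The field `K = ℚ(z)` of rational functions in one variable. -/
noncomputable abbrev K : Type := RatFunc ℚ

/-- The indeterminate `z`. -/
noncomputable def z : K := RatFunc.X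

/-- Unfused crystal Γ weights of a configuration `(left, top, right, bottom) = (a,b,c,d)`
at a column of color `c_j`. -/
noncomputable def wtG (j a b c d : ℕ) : K :=
  if a = 0 ∧ b = 0 ∧ c = 0 ∧ d = 0 then 1
  else if a ≠ 0 ∧ b = j ∧ c = a ∧ d = j then
    (if a < j then 0 else if a = j then z else 1)
  else if a = 0 ∧ b = j ∧ c = 0 ∧ d = j then 0
  else if a ≠ 0 ∧ b = 0 ∧ c = a ∧ d = 0 then (if a = j then z else 1)
  else if a = j ∧ b = 0 ∧ c = 0 ∧ d = j then z
  else if a = 0 ∧ b = j ∧ c = j ∧ d = 0 then 1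
  else 0

/-- Unfused crystal Δ weights of a configuration `(left, top, right, bottom) = (a,b,c,d)`
at a column of color `c_j`. -/
noncomputable def wtD (j a b c d : ℕ) : K :=
  if a = 0 ∧ b = 0 ∧ c = 0 ∧ d = 0 then 1
  else if a ≠ 0 ∧ b = j ∧ c = a ∧ d = j then
    (if a < j then 1 else if a = j then z⁻¹ else 0)
  else if a = 0 ∧ b = j ∧ c = 0 ∧ d = j then 0
  else if a ≠ 0 ∧ b = 0 ∧ c = a ∧ d = 0 then (if a = j then z⁻¹ else 1)
  else if a = 0 ∧ b = 0 ∧ c = j ∧ d = j then 1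
  else if a = j ∧ b = j ∧ c = 0 ∧ d = 0 then z⁻¹
  else 0

/-- The fused weight of a fused configuration `(a, S_top, c, S_bot)`: the sum over all
assignments of spins to the `m+1` horizontal edge positions of one row of the `m`
single-colored columns (the boundary positions being fixed to `a` and `c`) of the product of
the `m` unfused vertex weights. -/
noncomputable def fusedWt (m : ℕ) (wt : ℕ → ℕ → ℕ → ℕ → ℕ → K)
    (a c : Fin (m + 1)) (Stop Sbot : Finset (Fin m)) : K :=
  ∑ g : Fin (m + 1) → Fin (m + 1),
    if g 0 = a ∧ g (Fin.last m) = c then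
      ∏ p : Fin m,
        wt ((p : ℕ) + 1) (g p.castSucc : ℕ)
          (if p ∈ Stop then (p : ℕ) + 1 else 0) ((g p.succ : ℕ))
          (if p ∈ Sbot then (p : ℕ) + 1 else 0)
    else 0

/-- The number of elements of a set of colors that lie in the first `k` columns. -/
def countBelow {m : ℕ} (S : Finset (Fin m)) (k : ℕ) : ℕ :=
  (S.filter fun p : Fin m => (p : ℕ) < k).card

theorem countBelow_zero {m : ℕ} (S : Finset (Fin m)) : countBelow S 0 = 0 := by
  simp [countBelow]

theorem countBelow_self {m : ℕ} (S : Finset (Fin m)) : countBelow S m = S.card := by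
  simp [countBelow]

theorem countBelow_succ {m : ℕ} (S : Finset (Fin m)) (p : Fin m) :
    countBelow S (p + 1) = countBelow S p + if p ∈ S then 1 else 0 := by
  have h : (S.filter fun q : Fin m => (q : ℕ) < p + 1) =
      (S.filter fun q : Fin m => (q : ℕ) < p) ∪ S.filter fun q : Fin m => q = p := by
    ext q
    simp only [Finset.mem_filter, Finset.mem_union, Fin.ext_iff]
    grind
  rw [countBelow, h, Finset.card_union_of_disjoint]
  · rw [Finset.filter_eq']
    split_ifs <;> simp [countBelow]
  · rw [Finset.disjoint_left]
    intro q hq hq'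
    simp only [Finset.mem_filter] at hq hq'
    exact absurd hq.2 (by simp [hq'.2])

/-- A property of (number of columns passed, current spin, colors so far on top, colors so far on
the bottom) that holds at the left boundary and is preserved by every vertex of nonzero weight
holds at the right boundary of a fused configuration of nonzero weight. -/
theorem fusedWt_ne_zero_induction {m : ℕ} {wt : ℕ → ℕ → ℕ → ℕ → ℕ → K}
    {a c : Fin (m + 1)} {Stop Sbot : Finset (Fin m)} (P : ℕ → ℕ → ℕ → ℕ → Prop)
    (h : fusedWt m wt a c Stop Sbot ≠ 0) (zero : ∀ s, P 0 s 0 0)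
    (succ : ∀ (k s s' T B : ℕ) (t b : Prop) [Decidable t] [Decidable b],
      wt (k + 1) s (if t then k + 1 else 0) s' (if b then k + 1 else 0) ≠ 0 → P k s T B →
        P (k + 1) s' (T + if t then 1 else 0) (B + if b then 1 else 0)) :
    P m c Stop.card Sbot.card := by
  obtain ⟨g, -, hg⟩ := Finset.exists_ne_zero_of_sum_ne_zero h
  rw [ne_eq, ite_eq_right_iff, Classical.not_imp] at hg
  obtain ⟨⟨-, hc⟩, hg⟩ := hg
  rw [← ne_eq, Finset.prod_ne_zero_iff] at hg
  have key : ∀ k : Fin (m + 1), P k (g k) (countBelow Stop k) (countBelow Sbot k) := by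
    intro k
    induction k using Fin.induction with
    | zero => simpa [countBelow_zero] using zero _
    | succ p ih =>
      rw [Fin.val_succ, countBelow_succ, countBelow_succ]
      exact succ _ _ _ _ _ _ _ (hg p (Finset.mem_univ p)) ih
  simpa [countBelow_self, hc] using key (Fin.last m)

theorem card_top_le_of_fusedWt_wtG_ne_zero {m : ℕ} {a c : Fin (m + 1)}
    {Stop Sbot : Finset (Fin m)} (h : fusedWt m wtG a c Stop Sbot ≠ 0) :
    Stop.card ≤ max 1 Sbot.card := by
  have := fusedWt_ne_zero_induction (fun k s T B =>
    (s = 0 → T + 1 ≤ B ∨ T = 0) ∧ (k < s → T ≤ B) ∧ (T ≤ B ∨ T ≤ 1)) h (by simp) ?_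
  · omega
  · intro k s s' T B t b _ _ hw
    unfold wtG at hw
    grind

theorem card_top_le_of_fusedWt_wtD_ne_zero {m : ℕ} {a c : Fin (m + 1)}
    {Stop Sbot : Finset (Fin m)} (h : fusedWt m wtD a c Stop Sbot ≠ 0) :
    Stop.card ≤ max 1 Sbot.card := by
  have := fusedWt_ne_zero_induction (fun k s T B =>
    (s = 0 → T ≤ 1) ∧ (k < s → T = 0) ∧ (s ≠ 0 → T ≤ B)) h (by simp) ?_
  · omega
  · intro k s s' T B t b _ _ hw
    unfold wtD at hw
    grind

/-- For the fused crystal Γ (respectively Δ) weights: if a fused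
configuration has nonzero weight and its bottom edge carries at most one color, then its top
edge carries at most one color. -/
theorem fused_top_at_most_one_color (m : ℕ) (hm : 1 ≤ m) :
    (∀ (a c : Fin (m + 1)) (Stop Sbot : Finset (Fin m)),
      fusedWt m wtG a c Stop Sbot ≠ 0 → Sbot.card ≤ 1 → Stop.card ≤ 1) ∧
    (∀ (a c : Fin (m + 1)) (Stop Sbot : Finset (Fin m)),
      fusedWt m wtD a c Stop Sbot ≠ 0 → Sbot.card ≤ 1 → Stop.card ≤ 1) := by
  have le_one {s t : ℕ} (h : t ≤ max 1 s) (hs : s ≤ 1) : t ≤ 1 := by omega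
  exact ⟨fun _ _ _ _ h => le_one (card_top_le_of_fusedWt_wtG_ne_zero h),
    fun _ _ _ _ h => le_one (card_top_le_of_fusedWt_wtD_ne_zero h)⟩

end Stmt8
end

section
/- Let 𝔱 be a short pattern. If wt(𝔱) = (w₂, w₁), then wt(t_short 𝔱) = (w₁, w₂); equivalently, the sum of the middle row of t_short 𝔱 equals the sum of the top row plus the sum of the bottom row minus the sum of the middle row of 𝔱. -/
namespace ShortPattern

/-- The middle row of `t_short 𝔱` for a short pattern with rows
`(x₀,…,x_{l+2}; y₀,…,y_{l+1}; z₀,…,z_l)`. -/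
def tshort (l : ℕ) (x y z : ℕ → ℕ) : ℕ → ℕ := fun j =>
  if j = 0 then x 0 + max (x 1) (z 0) - y 0
  else if j = l + 1 then min (x (l + 1)) (z l) + x (l + 2) - y (l + 1)
  else min (x j) (z (j - 1)) + max (x (j + 1)) (z j) - y j

/-- The weight of a short pattern: the pair of differences of consecutive row sums. -/
def wtShort (l : ℕ) (x y z : ℕ → ℕ) : ℤ × ℤ :=
  ((∑ j ∈ Finset.range (l + 2), (y j : ℤ)) - ∑ j ∈ Finset.range (l + 1), (z j : ℤ),
   (∑ j ∈ Finset.range (l + 3), (x j : ℤ)) - ∑ j ∈ Finset.range (l + 2), (y j : ℤ))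

/-- Sum of an initial segment of the middle row of `tshort`, short of its last entry. -/
theorem sum_range_tshort {l : ℕ} {x y z : ℕ → ℕ} (hxy : ∀ j ≤ l, y j ≤ x j)
    (hyz : ∀ j < l, y (j + 1) ≤ z j) {k : ℕ} (hk : k ≤ l) :
    ∑ j ∈ Finset.range (k + 1), (tshort l x y z j : ℤ)
      = ∑ j ∈ Finset.range (k + 1), (x j : ℤ) + ∑ j ∈ Finset.range k, (z j : ℤ)
        + max (x (k + 1) : ℤ) (z k) - ∑ j ∈ Finset.range (k + 1), (y j : ℤ) := by
  induction k with
  | zero =>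
    have h := hxy 0 hk
    simp only [zero_add, Finset.sum_range_one, Finset.sum_range_zero, tshort, if_true]
    omega
  | succ k ih =>
    have h₁ := hxy (k + 1) hk
    have h₂ := hyz k hk
    have ht : tshort l x y z (k + 1)
        = min (x (k + 1)) (z k) + max (x (k + 1 + 1)) (z (k + 1)) - y (k + 1) := by
      simp [tshort, (Nat.lt_of_succ_le hk).ne]
    rw [Finset.sum_range_succ, ih (by omega), ht, Finset.sum_range_succ _ (k + 1),
      Finset.sum_range_succ (fun j => (z j : ℤ)) k,
      Finset.sum_range_succ (fun j => (y j : ℤ)) (k + 1)]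
    omega

/-- For a short pattern `𝔱`, if `wt 𝔱 = (w₂, w₁)` then
`wt (t_short 𝔱) = (w₁, w₂)`; equivalently the middle-row sum of `t_short 𝔱` equals the
top-row sum plus the bottom-row sum minus the middle-row sum of `𝔱`. -/
theorem wt_tshort_swap (l : ℕ) (x y z : ℕ → ℕ)
    (hxy : ∀ j, j ≤ l + 1 → x j ≥ y j ∧ y j ≥ x (j + 1))
    (hyz : ∀ j, j ≤ l → y j ≥ z j ∧ z j ≥ y (j + 1)) :
    wtShort l x (tshort l x y z) z = (wtShort l x y z).swap ∧
    (∑ j ∈ Finset.range (l + 2), (tshort l x y z j : ℤ))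
      = (∑ j ∈ Finset.range (l + 3), (x j : ℤ)) + (∑ j ∈ Finset.range (l + 1), (z j : ℤ))
        - ∑ j ∈ Finset.range (l + 2), (y j : ℤ) := by
  have hsum : (∑ j ∈ Finset.range (l + 2), (tshort l x y z j : ℤ))
      = (∑ j ∈ Finset.range (l + 3), (x j : ℤ)) + (∑ j ∈ Finset.range (l + 1), (z j : ℤ))
        - ∑ j ∈ Finset.range (l + 2), (y j : ℤ) := by
    have h₁ := (hxy (l + 1) le_rfl).1
    have h₂ := (hyz l le_rfl).2
    have ht : tshort l x y z (l + 1)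
        = min (x (l + 1)) (z l) + x (l + 2) - y (l + 1) := by
      simp [tshort]
    rw [Finset.sum_range_succ,
      sum_range_tshort (fun j hj => (hxy j (by omega)).1) (fun j hj => (hyz j hj.le).2) le_rfl,
      ht, Finset.sum_range_succ _ (l + 2), Finset.sum_range_succ _ (l + 1),
      Finset.sum_range_succ (fun j => (z j : ℤ)) l,
      Finset.sum_range_succ (fun j => (y j : ℤ)) (l + 1)]
    omega
  refine ⟨?_, hsum⟩
  simp only [wtShort, Prod.swap_prod_mk, Prod.mk.injEq]
  constructor <;> linarith

end ShortPattern
end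

section
/- For every Gelfand–Tsetlin pattern 𝔗 with r rows and every 1 ≤ i ≤ r−1, wt(t_{r−i}𝔗) = s_{r−i}·wt(𝔗), where s_k acts on ℤ^r by interchanging the k-th and (k+1)-th coordinates. -/
namespace GTP

/-- A triangular array, encoded as a function `ℕ → ℕ → ℕ` vanishing outside the triangle,
is a Gelfand–Tsetlin pattern with `r` rows if the interlacing inequalities hold. -/
def IsGTP (r : ℕ) (a : ℕ → ℕ → ℕ) : Prop :=
  (∀ i j, (j < i ∨ r ≤ j) → a i j = 0) ∧
  (∀ i j, 1 ≤ i → i ≤ j → j < r → a (i - 1) (j - 1) ≥ a i j ∧ a i j ≥ a (i - 1) j)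

/-- The new value of the entry `a_{i,j}` under the Berenstein–Kirillov involution `t_{r−i}`
(which acts on row `i`), with the boundary omissions when `j = i` and `j = r−1`. -/
def bkEntry (r : ℕ) (a : ℕ → ℕ → ℕ) (i j : ℕ) : ℕ :=
  (if j = i then a (i - 1) (j - 1) else min (a (i - 1) (j - 1)) (a (i + 1) j)) +
    (if j = r - 1 then a (i - 1) j else max (a (i - 1) j) (a (i + 1) (j + 1))) - a i j

/-- The Berenstein–Kirillov involution `t_{r−i}`, acting on row `i` of a triangular array
with `r` rows. -/
def bkMap (r i : ℕ) (a : ℕ → ℕ → ℕ) : ℕ → ℕ → ℕ :=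
  fun i' j => if i' = i ∧ i ≤ j ∧ j < r then bkEntry r a i j else a i' j

/-- The sum of the entries of row `i` of a triangular array with `r` rows. -/
def rowSum (r : ℕ) (a : ℕ → ℕ → ℕ) (i : ℕ) : ℕ :=
  ∑ j ∈ Finset.range r, a i j

/-- The weight `wt = (d_{r−1}, d_{r−2}−d_{r−1}, …, d_0−d_1) ∈ ℤ^r` of a triangular array,
where `d_i` is the sum of row `i`; here recorded via its `0`-based `t`-th entry
`d_{r−1−t} − d_{r−t}` (with `d_r = 0`). -/
def wtGTP (r : ℕ) (a : ℕ → ℕ → ℕ) (t : Fin r) : ℤ :=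
  (rowSum r a (r - 1 - (t : ℕ)) : ℤ) - (rowSum r a (r - (t : ℕ)) : ℤ)

/-- The first summand in `bkEntry`. -/
def bkMin (a : ℕ → ℕ → ℕ) (i j : ℕ) : ℕ :=
  if j = i then a (i - 1) (j - 1) else min (a (i - 1) (j - 1)) (a (i + 1) j)

/-- For a Gelfand–Tsetlin pattern, the subtraction in `bkEntry` does not truncate. -/
theorem bkEntry_add_self {r : ℕ} {a : ℕ → ℕ → ℕ} (ha : IsGTP r a) {i j : ℕ}
    (hi : 1 ≤ i) (hij : i ≤ j) (hjr : j < r) :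
    bkEntry r a i j + a i j = bkMin a i j +
      (if j = r - 1 then a (i - 1) j else max (a (i - 1) j) (a (i + 1) (j + 1))) := by
  have hle : a i j ≤ bkMin a i j := by
    have h := (ha.2 i j hi hij hjr).1
    unfold bkMin
    split_ifs with hj
    · exact h
    · exact le_min h (ha.2 (i + 1) j (by omega) (by omega) hjr).2
  unfold bkEntry
  unfold bkMin at hle ⊢
  omega

theorem bkMap_row_of_mem {r i j : ℕ} (a : ℕ → ℕ → ℕ) (hij : i ≤ j) (hjr : j < r) :
    bkMap r i a i j = bkEntry r a i j := by
  simp [bkMap, hij, hjr]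

theorem sum_bkMap_add_bkMin {r : ℕ} {a : ℕ → ℕ → ℕ} (ha : IsGTP r a) {i : ℕ} (hi : 1 ≤ i)
    {n : ℕ} (hin : i ≤ n) (hnr : n < r) :
    ∑ j ∈ Finset.range n, bkMap r i a i j + ∑ j ∈ Finset.range n, a i j + bkMin a i n
      = ∑ j ∈ Finset.range n, a (i - 1) j + ∑ j ∈ Finset.range (n + 1), a (i + 1) j := by
  induction n, hin using Nat.le_induction with
  | base =>
    obtain ⟨k, rfl⟩ : ∃ k, i = k + 1 := ⟨i - 1, by omega⟩
    have h1 : ∑ j ∈ Finset.range (k + 1), bkMap r (k + 1) a (k + 1) j = 0 := by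
      refine Finset.sum_eq_zero fun j hj => ?_
      have hj := Finset.mem_range.1 hj
      have hj' : ¬ k + 1 ≤ j := by omega
      simp [bkMap, hj', ha.1 (k + 1) j (Or.inl hj)]
    have h2 : ∑ j ∈ Finset.range (k + 1), a (k + 1) j = 0 :=
      Finset.sum_eq_zero fun j hj => ha.1 _ j (Or.inl (Finset.mem_range.1 hj))
    have h3 : ∑ j ∈ Finset.range k, a k j = 0 :=
      Finset.sum_eq_zero fun j hj => ha.1 _ j (Or.inl (Finset.mem_range.1 hj))
    have h4 : ∑ j ∈ Finset.range (k + 1 + 1), a (k + 1 + 1) j = 0 :=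
      Finset.sum_eq_zero fun j hj => ha.1 _ j (Or.inl (Finset.mem_range.1 hj))
    rw [h1, h2, h4, Nat.add_sub_cancel, Finset.sum_range_succ, h3]
    simp [bkMin]
  | succ n hin ih =>
    have ih := ih (by omega)
    have h := bkEntry_add_self ha hi hin (by omega)
    rw [if_neg (by omega)] at h
    have hmin : bkMin a i (n + 1) = min (a (i - 1) n) (a (i + 1) (n + 1)) := by
      simp [bkMin, show n + 1 ≠ i by omega]
    have hmm := min_add_max (a (i - 1) n) (a (i + 1) (n + 1))
    rw [Finset.sum_range_succ _ n, Finset.sum_range_succ _ n, Finset.sum_range_succ _ n,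
      Finset.sum_range_succ _ (n + 1), bkMap_row_of_mem a hin (by omega), hmin]
    omega

/-- The involution replaces the sum `d_i` of row `i` by `d_{i-1} + d_{i+1} - d_i`. -/
theorem rowSum_bkMap_self {r : ℕ} {a : ℕ → ℕ → ℕ} (ha : IsGTP r a) {i : ℕ} (hi : 1 ≤ i)
    (hir : i < r) :
    rowSum r (bkMap r i a) i + rowSum r a i = rowSum r a (i - 1) + rowSum r a (i + 1) := by
  obtain ⟨n, rfl⟩ : ∃ n, r = n + 1 := ⟨r - 1, by omega⟩
  have hin : i ≤ n := by omega
  have hs := sum_bkMap_add_bkMin ha hi hin (by omega)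
  have h := bkEntry_add_self ha hi hin (by omega)
  rw [if_pos (by omega)] at h
  unfold rowSum
  rw [Finset.sum_range_succ _ n, Finset.sum_range_succ _ n, Finset.sum_range_succ _ n,
    bkMap_row_of_mem a hin (by omega)]
  omega

theorem rowSum_bkMap_of_ne {r i k : ℕ} (a : ℕ → ℕ → ℕ) (hk : k ≠ i) :
    rowSum r (bkMap r i a) k = rowSum r a k := by
  simp [rowSum, bkMap, hk]

/-- For every Gelfand–Tsetlin pattern `𝔗` with `r` rows and every
`1 ≤ i ≤ r−1`, `wt (t_{r−i} 𝔗) = s_{r−i} · wt 𝔗`. -/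
theorem wt_bk (r : ℕ) (a : ℕ → ℕ → ℕ) (ha : IsGTP r a)
    (i : ℕ) (hi1 : 1 ≤ i) (hir : i < r) :
    ∀ t : Fin r,
      wtGTP r (bkMap r i a) t
        = wtGTP r a (Equiv.swap (⟨r - i - 1, by omega⟩ : Fin r) ⟨r - i, by omega⟩ t) := by
  have hl : r - i - 1 < r := by omega
  have hr : r - i < r := by omega
  intro t
  have hself := rowSum_bkMap_self ha hi1 hir
  have ht := t.isLt
  by_cases h1 : t = ⟨r - i - 1, hl⟩
  · subst h1
    rw [Equiv.swap_apply_left]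
    simp only [wtGTP]
    rw [show r - 1 - (r - i - 1) = i by omega, show r - (r - i - 1) = i + 1 by omega,
      show r - 1 - (r - i) = i - 1 by omega, show r - (r - i) = i by omega,
      rowSum_bkMap_of_ne a (show i + 1 ≠ i by omega)]
    omega
  by_cases h2 : t = ⟨r - i, hr⟩
  · subst h2
    rw [Equiv.swap_apply_right]
    simp only [wtGTP]
    rw [show r - 1 - (r - i - 1) = i by omega, show r - (r - i - 1) = i + 1 by omega,
      show r - 1 - (r - i) = i - 1 by omega, show r - (r - i) = i by omega,
      rowSum_bkMap_of_ne a (show i - 1 ≠ i by omega)]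
    omega
  rw [Equiv.swap_apply_of_ne_of_ne h1 h2]
  rw [Fin.ext_iff] at h1 h2
  simp only at h1 h2
  unfold wtGTP
  rw [rowSum_bkMap_of_ne a (by omega), rowSum_bkMap_of_ne a (by omega)]

end GTP
end
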